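/- arXiv:2206.10037 — 4 statements merged into one kernel-verified Lean document; each statement's English description precedes it below -/
import Mathlib

section
/- If S is a set of positive integers such that the sum of reciprocals Σ_{n∈S} 1/n diverges, then S contains a nontrivial three-term arithmetic progression, i.e., there exist integers x and y ≠ 0 with x, x+y, x+2y ∈ S. -/
namespace KelleyMeka

open Finset
open scoped Pointwise ComplexConjugate

set_option linter.unusedSectionVars false

/-! ### Correlations and convolutions -/

section Correlation

variable {G : Type*} [AddCommGroup G] [Fintype G]

/-- The real-valued indicator function of a finite set. -/
def ind [DecidableEq G] (A : Finset G) (x : G) : ℝ := if x ∈ A then 1 else 0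

/-- The autocorrelation of a function, with respect to counting measure. -/
def corr (F : G → ℝ) (z : G) : ℝ := ∑ s, F (z + s) * F s

/-- The self-convolution of a function, with respect to counting measure. -/
def conv (F : G → ℝ) (z : G) : ℝ := ∑ s, F (z - s) * F s

lemma corr_sub_pow (F : G → ℝ) (u v : G) (q : ℕ) :
    corr F (u - v) ^ q = ∑ s : Fin q → G, (∏ j, F (u + s j)) * ∏ j, F (v + s j) := by
  have h : corr F (u - v) = ∑ s, F (u + s) * F (v + s) := by
    rw [corr, ← Equiv.sum_comp (Equiv.addLeft v)]
    refine sum_congr rfl fun s _ => ?_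
    simp only [Equiv.coe_addLeft]
    congr 2
    abel
  rw [h, Fintype.sum_pow]
  simp only [prod_mul_distrib]

lemma sum_corr_pow (F : G → ℝ) (E : Finset G) (q : ℕ) :
    ∑ u ∈ E, ∑ v ∈ E, corr F (u - v) ^ q =
      ∑ s : Fin q → G, (∑ u ∈ E, ∏ j, F (u + s j)) ^ 2 := by
  simp only [corr_sub_pow, sq, sum_mul_sum]
  exact (sum_congr rfl fun u _ => sum_comm).trans sum_comm

lemma sum_corr_pow_nonneg (F : G → ℝ) (E : Finset G) (q : ℕ) :
    0 ≤ ∑ u ∈ E, ∑ v ∈ E, corr F (u - v) ^ q := by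
  rw [sum_corr_pow]
  positivity

lemma sum_conv_pow_le (F : G → ℝ) {E : Finset G} (hE : ∀ x ∈ E, -x ∈ E) (y : G) (p : ℕ) :
    ∑ u ∈ E, ∑ v ∈ E, conv F (y + u - v) ^ p ≤ ∑ u ∈ E, ∑ v ∈ E, corr F (u - v) ^ p := by
  have h (u v : G) : conv F (y + u - v) ^ p =
      ∑ s : Fin p → G, (∏ j, F (y + u - s j)) * ∏ j, F (s j - v) := by
    have h : conv F (y + u - v) = ∑ s, F (y + u - s) * F (s - v) := by
      rw [conv, ← Equiv.sum_comp (Equiv.subRight v)]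
      refine sum_congr rfl fun s _ => ?_
      simp only [Equiv.subRight_apply]
      congr 2
      abel
    rw [h, Fintype.sum_pow]
    simp only [prod_mul_distrib]
  have h1 : ∑ u ∈ E, ∑ v ∈ E, conv F (y + u - v) ^ p = ∑ s : Fin p → G,
      (∑ u ∈ E, ∏ j, F (y + u - s j)) * ∑ v ∈ E, ∏ j, F (s j - v) := by
    simp only [h, sum_mul_sum]
    exact (sum_congr rfl fun u _ => sum_comm).trans sum_comm
  have h2 : ∑ s : Fin p → G, (∑ u ∈ E, ∏ j, F (y + u - s j)) ^ 2 =
      ∑ s : Fin p → G, (∑ u ∈ E, ∏ j, F (u + s j)) ^ 2 := by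
    rw [← Equiv.sum_comp (Equiv.subLeft (fun _ : Fin p => y))]
    refine sum_congr rfl fun s _ => ?_
    congr 1
    refine sum_congr rfl fun u _ => prod_congr rfl fun j _ => ?_
    simp only [Equiv.subLeft_apply, Pi.sub_apply]
    congr 1
    abel
  have h3 : ∑ s : Fin p → G, (∑ v ∈ E, ∏ j, F (s j - v)) ^ 2 =
      ∑ s : Fin p → G, (∑ u ∈ E, ∏ j, F (u + s j)) ^ 2 := by
    refine sum_congr rfl fun s _ => ?_
    congr 1
    refine sum_nbij' (fun x => -x) (fun x => -x) hE hE (by simp) (by simp) fun v _ => ?_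
    refine prod_congr rfl fun j _ => ?_
    congr 1
    abel
  rw [h1, sum_corr_pow]
  have h4 : ∑ s : Fin p → G, (∑ u ∈ E, ∏ j, F (y + u - s j)) * ∑ v ∈ E, ∏ j, F (s j - v) ≤
      ∑ s : Fin p → G, ((∑ u ∈ E, ∏ j, F (y + u - s j)) ^ 2 / 2 +
        (∑ v ∈ E, ∏ j, F (s j - v)) ^ 2 / 2) := by
    refine sum_le_sum fun s _ => ?_
    nlinarith [sq_nonneg ((∑ u ∈ E, ∏ j, F (y + u - s j)) - ∑ v ∈ E, ∏ j, F (s j - v))]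
  refine h4.trans_eq ?_
  rw [sum_add_distrib, ← sum_div, ← sum_div, h2, h3]
  ring

end Correlation

/-! ### Balanced functions and moments -/

section Balanced

variable {G : Type*} [AddCommGroup G] [Fintype G] [DecidableEq G]

/-- The balanced function of `A` relative to `B`. -/
def bal (A B : Finset G) (α : ℝ) (x : G) : ℝ := ind A x - α * ind B x

lemma ind_nonneg (A : Finset G) (x : G) : 0 ≤ ind A x := by
  unfold ind; split_ifs <;> norm_num

lemma ind_le_one (A : Finset G) (x : G) : ind A x ≤ 1 := by
  unfold ind; split_ifs <;> norm_num

lemma sum_ind_mul_ind (A B : Finset G) (f : G → G) :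
    ∑ a, ind A a * ind B (f a) = #{a ∈ A | f a ∈ B} := by
  simp only [ind, ite_mul, one_mul, zero_mul, sum_ite_mem, univ_inter, card_filter]
  push_cast
  rfl

lemma sum_ind (A : Finset G) : ∑ a, ind A a = #A := by
  simp [ind]

lemma sum_ind_mul_ind_ge {A B : Finset G} (hAB : A ⊆ B) (f : G → G) {κ : ℝ}
    (h : (#{b ∈ B | f b ∉ B} : ℝ) ≤ κ * #B) :
    #A - κ * #B ≤ ∑ a, ind A a * ind B (f a) := by
  rw [sum_ind_mul_ind]
  have h1 : #{a ∈ A | f a ∈ B} + #{a ∈ A | f a ∉ B} = #A :=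
    card_filter_add_card_filter_not _
  have h2 : #{a ∈ A | f a ∉ B} ≤ #{b ∈ B | f b ∉ B} := card_le_card (filter_subset_filter _ hAB)
  have h1' : (#{a ∈ A | f a ∈ B} : ℝ) + #{a ∈ A | f a ∉ B} = #A := by exact_mod_cast h1
  have h2' : (#{a ∈ A | f a ∉ B} : ℝ) ≤ #{b ∈ B | f b ∉ B} := by exact_mod_cast h2
  linarith

lemma card_filter_add_notMem_le {B D : Finset G} {κ : ℝ} (h0 : (0 : G) ∈ D)
    (h : (#(B + D) : ℝ) ≤ (1 + κ) * #B) {z : G} (hz : z ∈ D) :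
    (#{b ∈ B | b + z ∉ B} : ℝ) ≤ κ * #B := by
  have h1 : #{b ∈ B | b + z ∉ B} + #B ≤ #(B + D) := by
    rw [← card_image_of_injective {b ∈ B | b + z ∉ B} (add_left_injective z),
      ← card_union_of_disjoint]
    · refine card_le_card ?_
      intro x hx
      simp only [mem_union, mem_image, mem_filter] at hx
      rcases hx with ⟨b, ⟨hb, -⟩, rfl⟩ | hx
      · exact add_mem_add hb hz
      · simpa using add_mem_add hx h0
    · rw [Finset.disjoint_left]
      intro x hx
      simp only [mem_image, mem_filter] at hx
      obtain ⟨b, ⟨-, hb⟩, rfl⟩ := hx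
      exact hb
  have h1' : (#{b ∈ B | b + z ∉ B} : ℝ) + #B ≤ #(B + D) := by exact_mod_cast h1
  linarith

lemma corr_ind_ge {A B : Finset G} (hAB : A ⊆ B) {α κ : ℝ} (hα : 0 ≤ α) (hA : (#A : ℝ) = α * #B)
    {z : G} (h1 : (#{b ∈ B | b + z ∉ B} : ℝ) ≤ κ * #B)
    (h2 : (#{b ∈ B | b + -z ∉ B} : ℝ) ≤ κ * #B) :
    corr (bal A B α) z + α ^ 2 * #B - 2 * α * κ * #B ≤ corr (ind A) z := by
  have e : corr (bal A B α) z = corr (ind A) z - α * (∑ s, ind A s * ind B (z + s)) -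
      α * (∑ s, ind A s * ind B (s + -z)) + α ^ 2 * ∑ s, ind B s * ind B (z + s) := by
    have : ∑ s, ind A s * ind B (s + -z) = ∑ s, ind A (z + s) * ind B s := by
      rw [← Equiv.sum_comp (Equiv.addLeft z)]
      refine sum_congr rfl fun s _ => ?_
      simp
    rw [this, corr, corr]
    simp only [mul_sum, ← sum_sub_distrib, ← sum_add_distrib]
    refine sum_congr rfl fun s _ => ?_
    simp only [bal]
    ring
  have e1 := sum_ind_mul_ind_ge hAB (fun s => z + s) (κ := κ) (by simpa only [add_comm z] using h1)
  have e2 := sum_ind_mul_ind_ge hAB (fun s => s + -z) h2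
  have e3 : ∑ s, ind B s * ind B (z + s) ≤ #B := by
    rw [← sum_ind B]
    exact sum_le_sum fun s _ => mul_le_of_le_one_right (ind_nonneg _ _) (ind_le_one _ _)
  have e1' := mul_le_mul_of_nonneg_left e1 hα
  have e2' := mul_le_mul_of_nonneg_left e2 hα
  have e3' := mul_le_mul_of_nonneg_left e3 (sq_nonneg α)
  rw [e]
  rw [hA] at e1' e2'
  nlinarith

lemma conv_bal_le {A B : Finset G} (hAB : A ⊆ B) (hB : ∀ x ∈ B, -x ∈ B) {α κ : ℝ} (hα : 0 ≤ α)
    (hA : (#A : ℝ) = α * #B) {z : G} (h2 : (#{b ∈ B | b + -z ∉ B} : ℝ) ≤ κ * #B) :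
    conv (bal A B α) z ≤ conv (ind A) z - α ^ 2 * #B + 2 * α * κ * #B := by
  have e : conv (bal A B α) z = conv (ind A) z - 2 * α * (∑ s, ind A s * ind B (z - s)) +
      α ^ 2 * ∑ s, ind B s * ind B (z - s) := by
    have : ∑ s, ind A s * ind B (z - s) = ∑ s, ind A (z - s) * ind B s := by
      rw [← Equiv.sum_comp (Equiv.subLeft z)]
      refine sum_congr rfl fun s _ => ?_
      simp
    have h' : 2 * α * (∑ s, ind A s * ind B (z - s)) = α * (∑ s, ind A s * ind B (z - s)) +
        α * ∑ s, ind A (z - s) * ind B s := by rw [← this]; ring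
    rw [h', conv, conv]
    simp only [mul_sum, ← sum_sub_distrib, ← sum_add_distrib]
    refine sum_congr rfl fun s _ => ?_
    simp only [bal]
    ring
  have e2 := sum_ind_mul_ind_ge hAB (fun s => z - s) (κ := κ) (by
    refine le_trans ?_ h2
    norm_cast
    refine card_le_card fun b hb => ?_
    simp only [mem_filter] at hb ⊢
    refine ⟨hb.1, fun h => hb.2 ?_⟩
    have := hB _ h
    rwa [neg_add, neg_neg, neg_add_eq_sub] at this)
  have e3 : ∑ s, ind B s * ind B (z - s) ≤ #B := by
    rw [← sum_ind B]
    exact sum_le_sum fun s _ => mul_le_of_le_one_right (ind_nonneg _ _) (ind_le_one _ _)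
  have e2' := mul_le_mul_of_nonneg_left e2 hα
  have e3' := mul_le_mul_of_nonneg_left e3 (sq_nonneg α)
  rw [e]
  rw [hA] at e2'
  nlinarith

lemma abs_corr_bal_le {A B : Finset G} (hAB : A ⊆ B) {α : ℝ} (hα : 0 ≤ α) (hα1 : α ≤ 1) (z : G) :
    |corr (bal A B α) z| ≤ #B := by
  have h (x : G) : |bal A B α x| ≤ ind B x := by
    unfold bal ind
    have := @hAB x
    rw [abs_le]
    split_ifs <;> simp_all
    all_goals linarith
  rw [← sum_ind B]
  refine (abs_sum_le_sum_abs _ _).trans (sum_le_sum fun s _ => ?_)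
  rw [abs_mul]
  have h1 := h (z + s)
  have h2 := h s
  have h3 := ind_le_one B (z + s)
  calc _ ≤ 1 * ind B s := by gcongr; linarith
    _ = _ := one_mul _

/-- If `conv F` is very negative on a dense subset of `D`, then `corr F` has a large moment
on `E - E` for `E` narrow compared to `D`. -/
lemma moment_ge (F : G → ℝ) {C D E : Finset G} (hCD : C ⊆ D) (hE : ∀ x ∈ E, -x ∈ E)
    (hDE : (#(D + E + E) : ℝ) ≤ 2 * #D) {γ t : ℝ} (hγ : γ * #D ≤ #C) (ht : 0 ≤ t) {p : ℕ}
    (hp : Even p) (hF : ∀ c ∈ C, conv F c ≤ -t) (hD : D.Nonempty) :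
    γ / 2 * t ^ p * #E ^ 2 ≤ ∑ u ∈ E, ∑ v ∈ E, corr F (u - v) ^ p := by
  set M := ∑ u ∈ E, ∑ v ∈ E, corr F (u - v) ^ p with hM
  have h1 : ∑ y ∈ D + E + E, ∑ u ∈ E, ∑ v ∈ E, conv F (y + u - v) ^ p ≤ 2 * #D * M := by
    calc _ ≤ ∑ y ∈ D + E + E, M := sum_le_sum fun y _ => sum_conv_pow_le F hE y p
      _ = #(D + E + E) * M := by rw [sum_const, nsmul_eq_mul]
      _ ≤ _ := by
        have : 0 ≤ M := sum_corr_pow_nonneg _ _ _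
        gcongr
  have h2 : ∑ u ∈ E, ∑ v ∈ E, (#C * t ^ p) ≤
      ∑ y ∈ D + E + E, ∑ u ∈ E, ∑ v ∈ E, conv F (y + u - v) ^ p := by
    have : ∑ y ∈ D + E + E, ∑ u ∈ E, ∑ v ∈ E, conv F (y + u - v) ^ p =
        ∑ u ∈ E, ∑ v ∈ E, ∑ y ∈ D + E + E, conv F (y + u - v) ^ p :=
      sum_comm.trans (sum_congr rfl fun u _ => sum_comm)
    rw [this]
    refine sum_le_sum fun u hu => sum_le_sum fun v hv => ?_
    have h3 : ∑ c ∈ C, conv F c ^ p ≤ ∑ y ∈ D + E + E, conv F (y + u - v) ^ p := by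
      have e : ∑ c ∈ C, conv F c ^ p =
          ∑ y ∈ C.image (fun c => c + v - u), conv F (y + u - v) ^ p := by
        rw [sum_image]
        · refine sum_congr rfl fun c _ => ?_
          congr 2
          abel
        · intro a _ b _ h
          simpa using h
      · rw [e]
        refine sum_le_sum_of_subset_of_nonneg ?_ fun i _ _ => hp.pow_nonneg _
        intro x hx
        obtain ⟨c, hc, rfl⟩ := mem_image.1 hx
        rw [sub_eq_add_neg]
        exact add_mem_add (add_mem_add (hCD hc) hv) (hE _ hu)
    refine le_trans ?_ h3
    rw [← nsmul_eq_mul]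
    refine card_nsmul_le_sum _ _ _ fun c hc => ?_
    rw [← hp.neg_pow (conv F c)]
    have := hF c hc
    gcongr
    linarith
  simp only [sum_const, nsmul_eq_mul] at h2
  have hD' : (0 : ℝ) < #D := by exact_mod_cast hD.card_pos
  have h4 : (#E : ℝ) * (#E * (γ * #D * t ^ p)) ≤ #E * (#E * (#C * t ^ p)) := by gcongr
  have : #D * (γ / 2 * t ^ p * #E ^ 2) ≤ #D * M := by nlinarith
  exact le_of_mul_le_mul_left this hD'

/-- Unbalancing: a function with nonnegative odd moment and large even moment is often large. -/
lemma card_gt_ge {ι : Type*} (X : Finset ι) (f : ι → ℝ) {p : ℕ} (hp : Even p) {M γ : ℝ}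
    (hM : 1 ≤ M) (hf : ∀ x ∈ X, |f x| ≤ M) (hodd : 0 ≤ ∑ x ∈ X, f x ^ (p + 1))
    (heven : γ / 2 * (1 / 4) ^ p * #X ≤ ∑ x ∈ X, f x ^ p) (hγ : 8 * (1 / 4) ^ p ≤ γ) :
    γ * (1 / 4) ^ p / 128 * #X ≤ M ^ (p + 1) * #{x ∈ X | 1 / 16 < f x} := by
  have key (a : ℝ) (ha : |a| ≤ M) : a ^ (p + 1) + 1 / 16 * a ^ p ≤
      2 * (1 / 16) ^ (p + 1) + 2 * M ^ (p + 1) * (if 1 / 16 < a then 1 else 0) := by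
    have hM0 : 0 ≤ M := by linarith
    have hp0 : 0 ≤ a ^ p := hp.pow_nonneg _
    rcases le_or_gt a (-(1 / 16)) with h | h
    · rw [if_neg (by linarith)]
      have : a ^ (p + 1) + 1 / 16 * a ^ p = a ^ p * (a + 1 / 16) := by ring
      have h2 : a ^ p * (a + 1 / 16) ≤ 0 := mul_nonpos_of_nonneg_of_nonpos hp0 (by linarith)
      have : (0 : ℝ) ≤ 2 * (1 / 16) ^ (p + 1) := by positivity
      linarith
    rcases le_or_gt a (1 / 16) with h' | h'
    · rw [if_neg (by linarith)]
      have e : |a| ≤ 1 / 16 := abs_le.2 ⟨h.le, h'⟩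
      have e1 : a ^ p ≤ (1 / 16) ^ p := by rw [← hp.pow_abs]; gcongr
      have e2 : a ^ (p + 1) ≤ (1 / 16) ^ (p + 1) := by
        refine (le_abs_self _).trans ?_
        rw [abs_pow]
        gcongr
      rw [pow_succ (1 / 16 : ℝ)] at *
      linarith
    · rw [if_pos h']
      have e : 1 / 16 * a ^ p ≤ a ^ (p + 1) := by
        rw [pow_succ, mul_comm]; gcongr
      have e2 : a ^ (p + 1) ≤ M ^ (p + 1) := by
        have := (le_abs_self a).trans ha
        gcongr
      have : (0 : ℝ) ≤ 2 * (1 / 16) ^ (p + 1) := by positivity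
      linarith
  have h1 := sum_le_sum fun x hx => key (f x) (hf x hx)
  rw [sum_add_distrib, sum_add_distrib, ← mul_sum, sum_const, nsmul_eq_mul, ← mul_sum] at h1
  have h2 : ∑ x ∈ X, (if 1 / 16 < f x then (1 : ℝ) else 0) = #{x ∈ X | 1 / 16 < f x} := by simp
  rw [h2] at h1
  have h3 : (1 / 16 : ℝ) ^ p = (1 / 4) ^ p * (1 / 4) ^ p := by rw [← mul_pow]; norm_num
  rw [pow_succ (1 / 16 : ℝ), h3] at h1
  have h4 : (8 * (1 / 4) ^ p) * ((1 / 4) ^ p * #X) ≤ γ * ((1 / 4 : ℝ) ^ p * #X) := by gcongr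
  nlinarith

end Balanced

/-! ### Sifting -/

section Sifting

variable {G : Type*} [AddCommGroup G] [Fintype G] [DecidableEq G]

lemma corr_ind_nonneg (A : Finset G) (z : G) : 0 ≤ corr (ind A) z :=
  sum_nonneg fun _ _ => mul_nonneg (ind_nonneg _ _) (ind_nonneg _ _)

/-- Dependent random choice: if many differences from `E` are popular differences of `A`, then
there is a large subset of `E` almost all of whose differences are popular. -/
lemma sifting {A B E : Finset G} (hAB : A ⊆ B) (hE : ∀ x ∈ E, -x ∈ E) {α : ℝ} (hα : 0 < α)
    (hBE : (#(B + E) : ℝ) ≤ 2 * #B) {π : ℝ} {q : ℕ}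
    (hπ : π * #E ^ 2 ≤
      #{x ∈ E ×ˢ E | 67 / 64 * (α ^ 2 * #B) ≤ corr (ind A) (x.1 - x.2)})
    (hq : 2048 ≤ π * (67 / 65) ^ q) (hE0 : E.Nonempty) (hB0 : B.Nonempty) :
    ∃ A' ⊆ E, (α ^ 2 / 2) ^ q * #E ^ 2 ≤ (#A' : ℝ) ^ 2 ∧
      1024 * (#{x ∈ A' ×ˢ A' | corr (ind A) (x.1 - x.2) < 65 / 64 * (α ^ 2 * #B)} : ℝ)
        ≤ (#A' : ℝ) ^ 2 := by
  by_contra! hcon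
  have hE' : (0 : ℝ) < #E := by exact_mod_cast hE0.card_pos
  have hB' : (0 : ℝ) < #B := by exact_mod_cast hB0.card_pos
  set W : ℝ := α ^ 2 * #B with hW
  have hW0 : 0 < W := by positivity
  let S (s : Fin q → G) : Finset G := {u ∈ E | ∀ j, u + s j ∈ A}
  have hS (s : Fin q → G) (u : G) (hu : u ∈ E) :
      ∏ j, ind A (u + s j) = if u ∈ S s then 1 else 0 := by
    by_cases h : ∀ j, u + s j ∈ A
    · rw [if_pos (by simp [S, hu, h])]
      exact prod_eq_one fun j _ => by simp [ind, h j]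
    · rw [if_neg (by simp only [S, mem_filter, not_and]; exact fun _ => h)]
      push Not at h
      obtain ⟨j, hj⟩ := h
      exact prod_eq_zero (mem_univ j) (by simp [ind, hj])
  have hSE (s : Fin q → G) : S s ⊆ E := filter_subset _ _
  have hR : ∑ u ∈ E, ∑ v ∈ E, corr (ind A) (u - v) ^ q = ∑ s, (#(S s) : ℝ) ^ 2 := by
    rw [sum_corr_pow]
    refine sum_congr rfl fun s _ => ?_
    rw [sum_congr rfl (hS s), sum_ite_mem, inter_eq_right.2 (hSE s)]
    simp
  have hbad : ∑ x ∈ E ×ˢ E with corr (ind A) (x.1 - x.2) < 65 / 64 * W,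
      corr (ind A) (x.1 - x.2) ^ q = ∑ s,
        (#{x ∈ S s ×ˢ S s | corr (ind A) (x.1 - x.2) < 65 / 64 * W} : ℝ) := by
    simp only [corr_sub_pow]
    rw [sum_comm]
    refine sum_congr rfl fun s _ => ?_
    have : ∀ x ∈ E ×ˢ E, corr (ind A) (x.1 - x.2) < 65 / 64 * W →
        (∏ j, ind A (x.1 + s j)) * ∏ j, ind A (x.2 + s j) =
        if x ∈ S s ×ˢ S s then 1 else 0 := by
      intro x hx _
      rw [mem_product] at hx
      rw [hS s _ hx.1, hS s _ hx.2]
      simp only [mem_product]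
      split_ifs <;> simp_all
    rw [sum_congr rfl fun x hx => this x (mem_filter.1 hx).1 (mem_filter.1 hx).2, sum_ite_mem,
      filter_inter, inter_eq_right.2 (product_subset_product (hSE s) (hSE s))]
    simp
  set Y : ℝ := (65 / 64 * W) ^ q * #E ^ 2 with hY
  have hY0 : 0 < Y := by positivity
  have hlow : 2048 * Y ≤ ∑ s, (#(S s) : ℝ) ^ 2 := by
    rw [← hR, ← sum_product' (f := fun u v => corr (ind A) (u - v) ^ q)]
    calc 2048 * Y ≤ (π * (67 / 65) ^ q) * Y := by gcongr
      _ = (π * #E ^ 2) * (67 / 64 * W) ^ q := by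
        rw [hY, show (67 / 64 : ℝ) * W = 67 / 65 * (65 / 64 * W) by ring, mul_pow (67 / 65 : ℝ)]
        ring
      _ ≤ #{x ∈ E ×ˢ E | 67 / 64 * W ≤ corr (ind A) (x.1 - x.2)} * (67 / 64 * W) ^ q := by gcongr
      _ ≤ ∑ x ∈ E ×ˢ E with 67 / 64 * W ≤ corr (ind A) (x.1 - x.2),
          corr (ind A) (x.1 - x.2) ^ q := by
        rw [← nsmul_eq_mul]
        refine card_nsmul_le_sum _ _ _ fun x hx => ?_
        have := (mem_filter.1 hx).2
        gcongr
      _ ≤ _ := sum_le_sum_of_subset_of_nonneg (filter_subset _ _) fun x _ _ =>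
          pow_nonneg (corr_ind_nonneg _ _) _
  have hbad2 : ∑ s, (#{x ∈ S s ×ˢ S s | corr (ind A) (x.1 - x.2) < 65 / 64 * W} : ℝ) ≤ Y := by
    rw [← hbad]
    calc _ ≤ ∑ x ∈ E ×ˢ E with corr (ind A) (x.1 - x.2) < 65 / 64 * W, (65 / 64 * W) ^ q := by
          refine sum_le_sum fun x hx => ?_
          have := (mem_filter.1 hx).2
          have := corr_ind_nonneg A (x.1 - x.2)
          gcongr
      _ ≤ ∑ x ∈ E ×ˢ E, (65 / 64 * W) ^ q :=
          sum_le_sum_of_subset_of_nonneg (filter_subset _ _) fun x _ _ => by positivity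
      _ = Y := by rw [sum_const, card_product, nsmul_eq_mul, hY]; push_cast; ring
  have hpt (s : Fin q → G) : (#(S s) : ℝ) ^ 2 ≤
      (if s ∈ Fintype.piFinset fun _ => B + E then (α ^ 2 / 2) ^ q * #E ^ 2 else 0) +
        1024 * (#{x ∈ S s ×ˢ S s | corr (ind A) (x.1 - x.2) < 65 / 64 * W} : ℝ) := by
    rcases (S s).eq_empty_or_nonempty with h | ⟨u, hu⟩
    · rw [h]
      simp only [card_empty, CharP.cast_eq_zero, ne_eq, OfNat.ofNat_ne_zero, not_false_eq_true,
        zero_pow]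
      split_ifs <;> positivity
    · rw [if_pos]
      · rcases le_or_gt ((α ^ 2 / 2) ^ q * #E ^ 2) ((#(S s) : ℝ) ^ 2) with h | h
        · have := hcon _ (hSE s) h
          have h0 : 0 ≤ (α ^ 2 / 2) ^ q * (#E : ℝ) ^ 2 := by positivity
          linarith
        · have h0 : 0 ≤ 1024 *
            (#{x ∈ S s ×ˢ S s | corr (ind A) (x.1 - x.2) < 65 / 64 * W} : ℝ) := by positivity
          linarith
      · rw [Fintype.mem_piFinset]
        intro j
        have h1 := mem_filter.1 hu
        have := add_mem_add (hAB (h1.2 j)) (hE _ h1.1)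
        rwa [add_neg_cancel_comm] at this
  have hup := sum_le_sum fun s (_ : s ∈ univ) => hpt s
  rw [sum_add_distrib, ← mul_sum, sum_ite_mem, univ_inter, sum_const, Fintype.card_piFinset_const,
    nsmul_eq_mul] at hup
  have hτ : ((#(B + E) ^ q : ℕ) : ℝ) * ((α ^ 2 / 2) ^ q * #E ^ 2) ≤ Y := by
    push_cast
    calc _ ≤ (2 * #B : ℝ) ^ q * ((α ^ 2 / 2) ^ q * #E ^ 2) := by gcongr
      _ = W ^ q * #E ^ 2 := by
        rw [← mul_assoc, ← mul_pow, hW]; ring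
      _ ≤ Y := by
        rw [hY]
        gcongr
        linarith
  linarith

/-- The first half of the density increment: the absence of progressions yields a dense subset of
the narrow set `E` almost all of whose differences are popular differences of `A`. -/
theorem exists_sifted {A B C D E Z : Finset G} {α : ℝ} {n : ℕ} (hn : 1 ≤ n) (hAB : A ⊆ B)
    (hB : ∀ x ∈ B, -x ∈ B) (hE : ∀ x ∈ E, -x ∈ E) (hZ : ∀ x ∈ Z, -x ∈ Z) (hZ0 : (0 : G) ∈ Z)
    (hBZ : (#(B + Z) : ℝ) ≤ (1 + α / 128) * #B) (hDZ : D ⊆ Z) (hEZ : E + E ⊆ Z) (hEZ' : E ⊆ Z)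
    (hDE : (#(D + E + E) : ℝ) ≤ 2 * #D) (hCD : C ⊆ D)
    (hA : (#A : ℝ) = α * #B) (hα : 1 / 2 ^ n ≤ α) (hα1 : α ≤ 1) (hC : 1 / 2 ^ n * (#D : ℝ) ≤ #C)
    (hconv : ∀ c ∈ C, conv (ind A) c ≤ 1) (hlarge : 2 ≤ α ^ 2 * #B)
    (hD0 : D.Nonempty) (hE0 : E.Nonempty) :
    ∃ A' ⊆ E, (#E : ℝ) ≤ 2 ^ (2000 * n ^ 3) * #A' ∧
      1024 * (#{x ∈ A' ×ˢ A' | corr (ind A) (x.1 - x.2) < 65 / 64 * (α ^ 2 * #B)} : ℝ)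
        ≤ (#A' : ℝ) ^ 2 := by
  have hα0 : 0 < α := lt_of_lt_of_le (by positivity) hα
  have hB0 : B.Nonempty := by
    rw [nonempty_iff_ne_empty]
    rintro rfl
    norm_num at hlarge
  have hE' : (0 : ℝ) < #E := by exact_mod_cast hE0.card_pos
  have hB' : (0 : ℝ) < #B := by exact_mod_cast hB0.card_pos
  have hst {z : G} (hz : z ∈ Z) : (#{b ∈ B | b + z ∉ B} : ℝ) ≤ α / 128 * #B :=
    card_filter_add_notMem_le hZ0 hBZ hz
  set W : ℝ := α ^ 2 * #B with hW
  have hW0 : 0 < W := by positivity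
  have hF : ∀ c ∈ C, conv (bal A B α) c ≤ -(W / 4) := by
    intro c hc
    have h1 := conv_bal_le hAB hB hα0.le hA (hst (hZ _ (hDZ (hCD hc))))
    have h2 := hconv c hc
    have h3 : 2 * α * (α / 128) * #B = W / 64 := by rw [hW]; ring
    rw [h3, ← hW] at h1
    linarith
  have hev : Even (2 * n) := even_two_mul n
  have hM := moment_ge (bal A B α) hCD hE hDE hC (t := W / 4) (by positivity) hev hF hD0
  let f (x : G × G) : ℝ := corr (bal A B α) (x.1 - x.2) / W
  have hsum (p : ℕ) : ∑ x ∈ E ×ˢ E, f x ^ p =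
      (∑ u ∈ E, ∑ v ∈ E, corr (bal A B α) (u - v) ^ p) / W ^ p := by
    rw [sum_product, sum_div]
    refine sum_congr rfl fun u _ => ?_
    rw [sum_div]
    refine sum_congr rfl fun v _ => ?_
    rw [div_pow]
  have h4n : (4 : ℝ) ^ n = 2 ^ n * 2 ^ n := by rw [← mul_pow]; norm_num
  have hinv : 1 ≤ α * 2 ^ n := by rwa [div_le_iff₀ (by positivity)] at hα
  have hcard := card_gt_ge (E ×ˢ E) f hev (M := 4 ^ n) (γ := 1 / 2 ^ n)
    (one_le_pow₀ (by norm_num)) (by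
      intro x _
      simp only [f]
      rw [abs_div, abs_of_pos hW0, div_le_iff₀ hW0]
      refine (abs_corr_bal_le hAB hα0.le hα1 _).trans ?_
      rw [hW, h4n]
      have : (1 : ℝ) * #B ≤ (α * 2 ^ n) ^ 2 * #B := by
        gcongr
        exact one_le_pow₀ hinv
      linarith) (by
      rw [hsum]
      exact div_nonneg (sum_corr_pow_nonneg _ _ _) (by positivity)) (by
      rw [hsum, le_div_iff₀ (by positivity), card_product]
      refine le_trans (le_of_eq ?_) hM
      rw [div_pow, div_pow]
      push_cast
      ring) (by
      have : (2 : ℝ) ^ 3 ≤ 2 ^ (3 * n) := by gcongr; norm_num; omega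
      have h2 : (4 : ℝ) ^ (2 * n) = 2 ^ (3 * n) * 2 ^ n := by
        rw [← pow_add, show (4 : ℝ) = 2 ^ 2 by norm_num, ← pow_mul]; congr 1; ring
      rw [one_div_pow, h2, mul_one_div, div_le_div_iff₀ (by positivity) (by positivity)]
      nlinarith [show (0 : ℝ) < 2 ^ n by positivity])
  have hpop : ({x ∈ E ×ˢ E | 1 / 16 < f x} : Finset (G × G)) ⊆
      {x ∈ E ×ˢ E | 67 / 64 * W ≤ corr (ind A) (x.1 - x.2)} := by
    intro x hx
    rw [mem_filter, mem_product] at hx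
    rw [mem_filter, mem_product]
    refine ⟨hx.1, ?_⟩
    have hz : x.1 - x.2 ∈ Z := by
      rw [sub_eq_add_neg]; exact hEZ (add_mem_add hx.1.1 (hE _ hx.1.2))
    have h1 := corr_ind_ge hAB hα0.le hA (hst hz) (hst (hZ _ hz))
    have h3 : 2 * α * (α / 128) * #B = W / 64 := by rw [hW]; ring
    have h4 := hx.2
    simp only [f] at h4
    rw [lt_div_iff₀ hW0] at h4
    rw [h3, ← hW] at h1
    linarith
  set π : ℝ := 1 / 2 ^ (18 * n ^ 2) with hπ
  have hpi : π * #E ^ 2 ≤ #{x ∈ E ×ˢ E | 67 / 64 * W ≤ corr (ind A) (x.1 - x.2)} := by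
    have h1 : (#({x ∈ E ×ˢ E | 1 / 16 < f x} : Finset (G × G)) : ℝ) ≤
        #{x ∈ E ×ˢ E | 67 / 64 * W ≤ corr (ind A) (x.1 - x.2)} := by
      exact_mod_cast card_le_card hpop
    refine le_trans ?_ h1
    have e : (1 : ℝ) / 2 ^ n * (1 / 4) ^ (2 * n) / 128 / (4 ^ n) ^ (2 * n + 1) =
        1 / 2 ^ (7 + 7 * n + 4 * n ^ 2) := by
      rw [show (4 : ℝ) = 2 ^ 2 by norm_num, show (128 : ℝ) = 2 ^ 7 by norm_num, one_div_pow,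
        one_div_mul_one_div, div_div, div_div]
      congr 1
      simp only [← pow_mul, ← pow_add]
      congr 1
      ring
    have e2 : π ≤ 1 / 2 ^ n * (1 / 4) ^ (2 * n) / 128 / (4 ^ n) ^ (2 * n + 1) := by
      rw [e, hπ]
      gcongr
      · norm_num
      · nlinarith
    rw [card_product] at hcard
    push_cast at hcard
    calc π * #E ^ 2 ≤ 1 / 2 ^ n * (1 / 4) ^ (2 * n) / 128 / (4 ^ n) ^ (2 * n + 1) * #E ^ 2 := by
          gcongr
      _ ≤ _ := by
        rw [div_mul_eq_mul_div, div_le_iff₀ (by positivity)]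
        linarith
  have hq : 2048 ≤ π * (67 / 65) ^ (1000 * n ^ 2) := by
    have h33 : (2 : ℝ) ≤ (67 / 65) ^ 33 := by norm_num
    have h1 : (2 : ℝ) ^ (30 * n ^ 2) ≤ (67 / 65) ^ (1000 * n ^ 2) := by
      calc (2 : ℝ) ^ (30 * n ^ 2) ≤ ((67 / 65) ^ 33) ^ (30 * n ^ 2) := by gcongr
        _ = (67 / 65) ^ (33 * (30 * n ^ 2)) := by rw [← pow_mul]
        _ ≤ _ := pow_le_pow_right₀ (by norm_num) (by omega)
    calc (2048 : ℝ) ≤ 2 ^ (12 * 1 ^ 2) := by norm_num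
      _ ≤ 2 ^ (12 * n ^ 2) := by gcongr; norm_num
      _ = π * 2 ^ (30 * n ^ 2) := by
        rw [hπ, one_div, ← div_eq_inv_mul, eq_div_iff (by positivity), ← pow_add]
        congr 1
        ring
      _ ≤ _ := by gcongr
  have hBE : (#(B + E) : ℝ) ≤ 2 * #B := by
    have h1 : (#(B + E) : ℝ) ≤ #(B + Z) := by
      exact_mod_cast card_le_card (add_subset_add_left hEZ')
    nlinarith
  obtain ⟨A', hA'E, hA', hbad⟩ := sifting hAB hE hα0 hBE hpi hq hE0 hB0
  refine ⟨A', hA'E, ?_, hbad⟩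
  have h5 : (1 : ℝ) / 2 ^ (4 * n) ≤ α ^ 2 / 2 := by
    rw [div_le_div_iff₀ (by positivity) (by positivity)]
    have h6 : (1 : ℝ) ≤ (α * 2 ^ n) ^ 2 := one_le_pow₀ hinv
    have h7 : (2 : ℝ) ^ (4 * n) = (2 ^ n) ^ 2 * 2 ^ (2 * n) := by
      rw [← pow_mul, ← pow_add]; congr 1; ring
    have h8 : (2 : ℝ) ^ 1 ≤ 2 ^ (2 * n) := by gcongr; norm_num; omega
    rw [h7]
    calc (1 : ℝ) * 2 ≤ (α * 2 ^ n) ^ 2 * 2 ^ (2 * n) := by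
          rw [pow_one] at h8; gcongr
      _ = _ := by ring
  have h6 : (1 / 2 ^ (2000 * n ^ 3) * #E : ℝ) ^ 2 ≤ (#A' : ℝ) ^ 2 := by
    refine le_trans ?_ hA'
    rw [mul_pow]
    gcongr
    calc ((1 : ℝ) / 2 ^ (2000 * n ^ 3)) ^ 2 = (1 / 2 ^ (4 * n)) ^ (1000 * n ^ 2) := by
          rw [one_div_pow, one_div_pow, ← pow_mul, ← pow_mul]
          congr 2
          ring
      _ ≤ _ := by gcongr
  have h7 := le_of_sq_le_sq h6 (by positivity)
  rwa [one_div, ← div_eq_inv_mul, div_le_iff₀ (by positivity), mul_comm] at h7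

end Sifting

/-! ### Almost periodicity -/

section AlmostPeriods

/-- Hoeffding's inequality for tuples drawn uniformly from a finite set. -/
lemma card_tuples_ge_le {ι : Type*} [DecidableEq ι] (A : Finset ι) (φ : ι → ℝ)
    (hφ : ∀ a ∈ A, |φ a| ≤ 1) (h0 : ∑ a ∈ A, φ a = 0) (m : ℕ) {ε : ℝ} (hε : 0 ≤ ε) :
    (#{u ∈ Fintype.piFinset (fun _ : Fin m => A) | ε * m ≤ ∑ j, φ (u j)} : ℝ) ≤
      Real.exp (-(m * ε ^ 2 / 2)) * #A ^ m := by
  set P := Fintype.piFinset (fun _ : Fin m => A)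
  have h1 : ∑ u ∈ P, Real.exp (ε * ∑ j, φ (u j)) = (∑ a ∈ A, Real.exp (φ a * ε)) ^ m := by
    have := prod_univ_sum (fun _ : Fin m => A) (fun _ a => Real.exp (φ a * ε))
    rw [prod_const, card_univ, Fintype.card_fin] at this
    rw [this]
    refine sum_congr rfl fun u _ => ?_
    rw [← Real.exp_sum, mul_sum]
    congr 1
    exact sum_congr rfl fun j _ => mul_comm _ _
  have h2 : ∑ a ∈ A, Real.exp (φ a * ε) ≤ #A * Real.exp (ε ^ 2 / 2) := by
    calc _ ≤ ∑ a ∈ A, (Real.cosh ε + φ a * Real.sinh ε) :=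
          sum_le_sum fun a ha => Real.exp_mul_le_cosh_add_mul_sinh (hφ a ha) ε
      _ = #A * Real.cosh ε := by
          rw [sum_add_distrib, ← sum_mul, h0, sum_const, nsmul_eq_mul]; ring
      _ ≤ _ := by gcongr; exact Real.cosh_le_exp_half_sq ε
  have h3 : #{u ∈ P | ε * m ≤ ∑ j, φ (u j)} * Real.exp (ε * (ε * m)) ≤
      ∑ u ∈ P, Real.exp (ε * ∑ j, φ (u j)) := by
    rw [← nsmul_eq_mul]
    refine (card_nsmul_le_sum _ (fun u => Real.exp (ε * ∑ j, φ (u j))) _ fun u hu => ?_).trans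
      (sum_le_sum_of_subset_of_nonneg (filter_subset _ _) fun _ _ _ => (Real.exp_pos _).le)
    have := (mem_filter.1 hu).2
    gcongr
  have h4 : (∑ a ∈ A, Real.exp (φ a * ε)) ^ m ≤ (#A * Real.exp (ε ^ 2 / 2)) ^ m := by
    have : 0 ≤ ∑ a ∈ A, Real.exp (φ a * ε) := sum_nonneg fun _ _ => (Real.exp_pos _).le
    gcongr
  have h5 := h3.trans (h1.le.trans h4)
  rw [mul_pow, ← Real.exp_nat_mul] at h5
  have h6 : Real.exp (-(m * ε ^ 2 / 2)) =
      Real.exp (m * (ε ^ 2 / 2)) / Real.exp (ε * (ε * m)) := by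
    rw [← Real.exp_sub]; congr 1; ring
  rw [h6, div_mul_eq_mul_div, le_div_iff₀ (Real.exp_pos _)]
  linarith

/-- Two-sided version of `card_tuples_ge_le`. -/
lemma card_tuples_abs_gt_le {ι : Type*} [DecidableEq ι] (A : Finset ι) (φ : ι → ℝ)
    (hφ : ∀ a ∈ A, |φ a| ≤ 1) (h0 : ∑ a ∈ A, φ a = 0) (m : ℕ) {ε : ℝ} (hε : 0 ≤ ε) :
    (#{u ∈ Fintype.piFinset (fun _ : Fin m => A) | ε * m < |∑ j, φ (u j)|} : ℝ) ≤
      2 * Real.exp (-(m * ε ^ 2 / 2)) * #A ^ m := by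
  have h1 := card_tuples_ge_le A φ hφ h0 m hε
  have h2 := card_tuples_ge_le A (fun a => -φ a) (by simpa using hφ) (by simp [h0]) m hε
  have h3 : #{u ∈ Fintype.piFinset (fun _ : Fin m => A) | ε * m < |∑ j, φ (u j)|} ≤
      #{u ∈ Fintype.piFinset (fun _ : Fin m => A) | ε * m ≤ ∑ j, φ (u j)} +
      #{u ∈ Fintype.piFinset (fun _ : Fin m => A) | ε * m ≤ ∑ j, -φ (u j)} := by
    refine (card_le_card fun u hu => ?_).trans (card_union_le _ _)
    simp only [mem_union, mem_filter, sum_neg_distrib] at hu ⊢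
    rcases lt_abs.1 hu.2 with h | h
    · exact Or.inl ⟨hu.1, h.le⟩
    · exact Or.inr ⟨hu.1, h.le⟩
  have h3' : (#{u ∈ Fintype.piFinset (fun _ : Fin m => A) | ε * m < |∑ j, φ (u j)|} : ℝ) ≤
      #{u ∈ Fintype.piFinset (fun _ : Fin m => A) | ε * m ≤ ∑ j, φ (u j)} +
      #{u ∈ Fintype.piFinset (fun _ : Fin m => A) | ε * m ≤ ∑ j, -φ (u j)} := by
    exact_mod_cast h3
  linarith

variable {G : Type*} [AddCommGroup G] [Fintype G] [DecidableEq G]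

/-- The density of `S - x` in `A`. -/
noncomputable def localDens (A S : Finset G) (x : G) : ℝ := (∑ u ∈ A, ind S (u + x)) / #A

lemma localDens_nonneg (A S : Finset G) (x : G) : 0 ≤ localDens A S x :=
  div_nonneg (sum_nonneg fun _ _ => ind_nonneg _ _) (by positivity)

lemma localDens_le_one (A S : Finset G) (x : G) : localDens A S x ≤ 1 := by
  refine div_le_one_of_le₀ ?_ (by positivity)
  calc _ ≤ ∑ u ∈ A, (1 : ℝ) := sum_le_sum fun _ _ => ind_le_one _ _
    _ = _ := by simp

/-- Croot–Sisask almost periodicity: many translates of `localDens A S` are close to a common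
function. -/
lemma exists_almost_periods {A H X S : Finset G} (hA : A.Nonempty) {m : ℕ} (hm0 : 0 < m) {ε : ℝ}
    (hε : 0 < ε) (hm : 4 * Real.exp (-(m * ε ^ 2 / 2)) * #X ≤ ε * #A) :
    ∃ T ⊆ H, (#A : ℝ) ^ m * #H ≤ 2 * #(A + H) ^ m * #T ∧ ∃ h : G → ℝ,
      ∀ t ∈ T, (#{x ∈ X | ε < |h (x - t) - localDens A S x|} : ℝ) ≤ ε * #A := by
  have hA' : (0 : ℝ) < #A := by exact_mod_cast hA.card_pos
  have hm' : (0 : ℝ) < m := by exact_mod_cast hm0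
  set P := Fintype.piFinset (fun _ : Fin m => A) with hP
  let gu (u : Fin m → G) (x : G) : ℝ := (∑ j, ind S (u j + x)) / m
  let bad (u : Fin m → G) : Finset G := {x ∈ X | ε < |gu u x - localDens A S x|}
  set good : Finset (Fin m → G) := {u ∈ P | (#(bad u) : ℝ) ≤ ε * #A} with hgood
  have hcardP : (#P : ℝ) = #A ^ m := by rw [hP, Fintype.card_piFinset_const]; push_cast; rfl
  have h1 : ∑ u ∈ P, (#(bad u) : ℝ) ≤ #X * (2 * Real.exp (-(m * ε ^ 2 / 2)) * #A ^ m) := by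
    have e : ∑ u ∈ P, (#(bad u) : ℝ) =
        ∑ x ∈ X, (#{u ∈ P | ε < |gu u x - localDens A S x|} : ℝ) := by
      exact_mod_cast sum_card_bipartiteAbove_eq_sum_card_bipartiteBelow
        (fun u x => ε < |gu u x - localDens A S x|)
    rw [e, ← nsmul_eq_mul]
    refine sum_le_card_nsmul _ _ _ fun x _ => ?_
    have h2 := card_tuples_abs_gt_le A (fun a => ind S (a + x) - localDens A S x) (by
      intro a _
      have := ind_nonneg S (a + x)
      have := ind_le_one S (a + x)
      have := localDens_nonneg A S x
      have := localDens_le_one A S x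
      rw [abs_le]
      constructor <;> linarith) (by
      rw [sum_sub_distrib, sum_const, nsmul_eq_mul, localDens, mul_div_cancel₀ _ hA'.ne', sub_self])
      m hε.le
    refine le_trans ?_ h2
    norm_cast
    refine card_le_card fun u hu => ?_
    simp only [mem_filter] at hu ⊢
    refine ⟨hu.1, ?_⟩
    rw [sum_sub_distrib, sum_const, card_univ, Fintype.card_fin, nsmul_eq_mul]
    have e2 : ∑ j, ind S (u j + x) - m * localDens A S x = (gu u x - localDens A S x) * m := by
      simp only [gu]
      rw [sub_mul, div_mul_cancel₀ _ hm'.ne', mul_comm]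
    rw [e2, abs_mul, abs_of_pos hm']
    exact mul_lt_mul_of_pos_right hu.2 hm'
  have h2 : (#A : ℝ) ^ m ≤ 2 * #good := by
    have e : #good + #{u ∈ P | ¬ (#(bad u) : ℝ) ≤ ε * #A} = #P :=
      card_filter_add_card_filter_not _
    have e' : (#good : ℝ) + #{u ∈ P | ¬ (#(bad u) : ℝ) ≤ ε * #A} = #A ^ m := by
      rw [← hcardP]; exact_mod_cast e
    have e2 : #{u ∈ P | ¬ (#(bad u) : ℝ) ≤ ε * #A} * (ε * #A) ≤ ∑ u ∈ P, (#(bad u) : ℝ) := by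
      rw [← nsmul_eq_mul]
      refine (card_nsmul_le_sum _ (fun u => (#(bad u) : ℝ)) _ fun u hu => ?_).trans
        (sum_le_sum_of_subset_of_nonneg (filter_subset _ _) fun _ _ _ => by positivity)
      exact (not_le.1 (mem_filter.1 hu).2).le
    have e3 : #{u ∈ P | ¬ (#(bad u) : ℝ) ≤ ε * #A} * (ε * #A) ≤ #A ^ m / 2 * (ε * #A) := by
      refine e2.trans (h1.trans ?_)
      have : (0 : ℝ) ≤ #A ^ m / 2 := by positivity
      nlinarith [mul_le_mul_of_nonneg_left hm this]
    have := le_of_mul_le_mul_right e3 (by positivity)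
    linarith
  -- pigeonhole over the translates of good tuples
  set Q := Fintype.piFinset (fun _ : Fin m => A + H) with hQ
  let T (w : Fin m → G) : Finset G := {t ∈ H | (fun j => w j - t) ∈ good}
  have h3 : ∑ w ∈ Q, #(T w) = ∑ t ∈ H, #{w ∈ Q | (fun j => w j - t) ∈ good} :=
    sum_card_bipartiteAbove_eq_sum_card_bipartiteBelow
      (fun (w : Fin m → G) t => (fun j => w j - t) ∈ good)
  have h4 : ∑ t ∈ H, #good ≤ ∑ t ∈ H, #{w ∈ Q | (fun j => w j - t) ∈ good} := by
    refine sum_le_sum fun t ht => ?_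
    refine card_le_card_of_injOn (fun u j => u j + t) ?_ ?_
    · intro u hu
      simp only [coe_filter, Set.mem_ofPred_eq, add_sub_cancel_right]
      refine ⟨?_, hu⟩
      rw [hQ, Fintype.mem_piFinset]
      intro j
      have := (mem_filter.1 hu).1
      rw [hP, Fintype.mem_piFinset] at this
      exact add_mem_add (this j) ht
    · intro u _ v _ huv
      funext j
      exact add_right_cancel (congrFun huv j)
  rcases H.eq_empty_or_nonempty with rfl | hH
  · exact ⟨∅, empty_subset _, by simp, 0, by simp⟩
  have hQne : Q.Nonempty := Fintype.piFinset_nonempty.2 fun _ => hA.add hH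
  obtain ⟨w, hw, h5⟩ : ∃ w ∈ Q, #H * #good ≤ #Q * #(T w) := by
    by_contra! hc
    have h6 := sum_lt_sum_of_nonempty hQne hc
    rw [← mul_sum, sum_const, smul_eq_mul, h3] at h6
    rw [sum_const, smul_eq_mul] at h4
    exact absurd (Nat.mul_le_mul_left #Q h4) (not_le.2 h6)
  refine ⟨T w, filter_subset _ _, ?_, fun x => (∑ j, ind S (w j + x)) / m, fun t ht => ?_⟩
  · have hQc : (#Q : ℝ) = #(A + H) ^ m := by
      rw [hQ, Fintype.card_piFinset_const]; push_cast; rfl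
    have h6 : (#H : ℝ) * #good ≤ #Q * #(T w) := by exact_mod_cast h5
    rw [← hQc]
    nlinarith [mul_le_mul_of_nonneg_right h2 (Nat.cast_nonneg (α := ℝ) #H)]
  · have h6 := (mem_filter.1 (mem_filter.1 ht).2).2
    refine le_trans (le_of_eq ?_) h6
    simp only [bad, gu]
    congr! 8 with x _ j
    exact congrArg (ind S) (by abel)

/-- Translating by sums of differences of almost periods changes `localDens` little in mean. -/
lemma sum_abs_localDens_le {A T V X S : Finset G} {ε : ℝ} (hε : 0 ≤ ε) (hV : #V = #A)
    {h : G → ℝ} (hh : ∀ t ∈ T, (#{x ∈ X | ε < |h (x - t) - localDens A S x|} : ℝ) ≤ ε * #A)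
    (k : ℕ) (t t' : Fin k → G) (ht : ∀ i, t i ∈ T) (ht' : ∀ i, t' i ∈ T)
    (hX : ∀ j ≤ k, ∀ s s' : Fin j → G, (∀ i, s i ∈ T) → (∀ i, s' i ∈ T) →
      ∀ v ∈ V, v + ∑ i, (s i - s' i) ∈ X) :
    ∑ v ∈ V, |localDens A S (v + ∑ i, (t i - t' i)) - localDens A S v| ≤ 4 * k * ε * #A := by
  induction k with
  | zero => simp
  | succ k ih =>
    have h1 := ih (fun i => t i.castSucc) (fun i => t' i.castSucc) (fun i => ht _)
      (fun i => ht' _) fun j hj => hX j (hj.trans k.le_succ)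
    set w := ∑ i : Fin k, (t i.castSucc - t' i.castSucc) with hw
    set p := t (Fin.last k) with hp
    set p' := t' (Fin.last k) with hp'
    have key : ∑ v ∈ V, |localDens A S (v + (w + (p - p'))) - localDens A S (v + w)| ≤
        4 * ε * #A := by
      have hb : ∀ v ∈ V, |localDens A S (v + (w + (p - p'))) - localDens A S (v + w)| ≤
          2 * ε + ((if v + (w + (p - p')) ∈ ({x ∈ X | ε < |h (x - p) - localDens A S x|} : Finset G)
            then (1 : ℝ) else 0) +
            if v + w ∈ ({x ∈ X | ε < |h (x - p') - localDens A S x|} : Finset G)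
            then (1 : ℝ) else 0) := by
        intro v hv
        have m1 : v + (w + (p - p')) ∈ X := by
          have := hX (k + 1) le_rfl t t' ht ht' v hv
          rwa [Fin.sum_univ_castSucc] at this
        have m2 : v + w ∈ X := hX k k.le_succ _ _ (fun i => ht _) (fun i => ht' _) v hv
        have a1 := localDens_nonneg A S (v + (w + (p - p')))
        have a2 := localDens_nonneg A S (v + w)
        have a3 := localDens_le_one A S (v + (w + (p - p')))
        have a4 := localDens_le_one A S (v + w)
        have e : v + (w + (p - p')) - p = v + w - p' := by abel
        have hle : |localDens A S (v + (w + (p - p'))) - localDens A S (v + w)| ≤ 1 := by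
          rw [abs_le]; constructor <;> linarith
        simp only [mem_filter, m1, m2, true_and, e]
        split_ifs with c1 c2 c2
        · linarith
        · linarith
        · linarith
        · rw [not_lt, abs_le] at c1 c2
          rw [abs_le]
          constructor <;> linarith [c1.1, c1.2, c2.1, c2.2]
      have hc : ∀ (f : G) (P : Finset G), (#P : ℝ) ≤ ε * #A →
          ∑ v ∈ V, (if v + f ∈ P then (1 : ℝ) else 0) ≤ ε * #A := by
        intro f P hP
        rw [sum_boole]
        refine le_trans ?_ hP
        norm_cast
        refine card_le_card_of_injOn (· + f) (fun v hv => ?_) (add_left_injective f).injOn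
        simp only [coe_filter, Set.mem_ofPred_eq] at hv
        exact hv.2
      refine (sum_le_sum hb).trans ?_
      rw [sum_add_distrib, sum_add_distrib, sum_const, nsmul_eq_mul, hV]
      have := hc (w + (p - p')) _ (hh p (ht _))
      have := hc w _ (hh p' (ht' _))
      have : 0 ≤ ε * #A := by positivity
      linarith
    rw [Fin.sum_univ_castSucc]
    push_cast
    calc _ ≤ ∑ v ∈ V, (|localDens A S (v + (w + (p - p'))) - localDens A S (v + w)| +
          |localDens A S (v + w) - localDens A S v|) := sum_le_sum fun v _ => abs_sub_le _ _ _
      _ ≤ 4 * ε * #A + 4 * k * ε * #A := by rw [sum_add_distrib]; exact add_le_add key h1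
      _ = _ := by ring

end AlmostPeriods

/-! ### Fourier analysis -/

section Fourier

variable {G : Type*} [AddCommGroup G] [Fintype G] [DecidableEq G]

/-- The unnormalised Fourier coefficient of a real function. -/
noncomputable def ft (F : G → ℝ) (χ : AddChar G ℂ) : ℂ := ∑ x, (F x : ℂ) * χ x

/-- The character sum over a finite set. -/
noncomputable def charSum (A : Finset G) (χ : AddChar G ℂ) : ℂ := ∑ a ∈ A, χ a

lemma ft_ind (A : Finset G) (χ : AddChar G ℂ) : ft (ind A) χ = charSum A χ := by
  simp [ft, charSum, ind, apply_ite]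

lemma norm_charSum_le (A : Finset G) (χ : AddChar G ℂ) : ‖charSum A χ‖ ≤ #A := by
  refine (norm_sum_le _ _).trans ?_
  simp [AddChar.norm_apply]

lemma addChar_sum {ι : Type*} (χ : AddChar G ℂ) (s : Finset ι) (f : ι → G) :
    χ (∑ i ∈ s, f i) = ∏ i ∈ s, χ (f i) := by
  classical
  induction s using Finset.induction_on with
  | empty => simp
  | insert a s ha ih => rw [sum_insert ha, prod_insert ha, AddChar.map_add_eq_mul, ih]

lemma fourier_inversion (F : G → ℝ) (y : G) :
    (Fintype.card G : ℂ) * F y = ∑ χ : AddChar G ℂ, ft F χ * conj (χ y) := by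
  have h (x : G) : ∑ χ : AddChar G ℂ, χ x * conj (χ y) = if x = y then (Fintype.card G : ℂ) else 0 := by
    simp_rw [← AddChar.map_neg_eq_conj, ← AddChar.map_add_eq_mul]
    rw [AddChar.sum_apply_eq_ite]
    simp [add_neg_eq_zero]
  simp_rw [ft, sum_mul, mul_assoc]
  rw [sum_comm]
  simp_rw [← mul_sum, h]
  simp [mul_comm]

lemma parseval (F : G → ℝ) :
    ∑ χ : AddChar G ℂ, ‖ft F χ‖ ^ 2 = Fintype.card G * ∑ x, F x ^ 2 := by
  have h : ((∑ χ : AddChar G ℂ, ‖ft F χ‖ ^ 2 : ℝ) : ℂ) =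
      ((Fintype.card G * ∑ x, F x ^ 2 : ℝ) : ℂ) := by
    push_cast
    simp_rw [mul_sum, sq, ← mul_assoc, fourier_inversion, sum_mul]
    rw [sum_comm]
    refine sum_congr rfl fun χ _ => ?_
    rw [← sq, ← Complex.mul_conj', ft, map_sum, mul_sum]
    refine sum_congr rfl fun x _ => ?_
    rw [map_mul, Complex.conj_ofReal]
    ring
  exact_mod_cast h

/-- Replacing `F` by a translate changes little an average over a set with a high power of the
Fourier coefficients of `T`. -/
lemma norm_sum_translate_sub_le {F : G → ℝ} {V T X : Finset G} (hF : ∀ x, |F x| ≤ ind X x) (k : ℕ)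
    (b : G) {M : ℝ} (hM : 0 ≤ M)
    (h : ∀ χ : AddChar G ℂ, ‖charSum T χ‖ ^ (2 * k) * ‖1 - χ b‖ ≤ M * #T ^ (2 * k)) :
    |∑ v ∈ V, ∑ t ∈ Fintype.piFinset (fun _ : Fin k => T),
      ∑ t' ∈ Fintype.piFinset (fun _ : Fin k => T),
        (F (v + ∑ i, (t i - t' i) + b) - F (v + ∑ i, (t i - t' i)))| ≤
      M * #T ^ (2 * k) * √(#X * #V) := by
  set P := Fintype.piFinset (fun _ : Fin k => T)
  have hN : (0 : ℝ) < Fintype.card G := by exact_mod_cast Fintype.card_pos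
  have hpow (χ : AddChar G ℂ) : ∑ t ∈ P, ∏ i, χ (t i) = charSum T χ ^ k := by
    have := prod_univ_sum (fun _ : Fin k => T) (fun _ a => χ a)
    rw [prod_const, card_univ, Fintype.card_fin] at this
    exact this.symm
  have h1 : (Fintype.card G : ℂ) * ((∑ v ∈ V, ∑ t ∈ P, ∑ t' ∈ P,
      (F (v + ∑ i, (t i - t' i) + b) - F (v + ∑ i, (t i - t' i))) : ℝ) : ℂ) =
      ∑ χ : AddChar G ℂ, ft F χ * (conj (charSum V χ) * conj (charSum T χ) ^ k * charSum T χ ^ k *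
        (conj (χ b) - 1)) := by
    push_cast
    simp_rw [mul_sum, mul_sub, fourier_inversion, ← sum_sub_distrib]
    have e (v : G) (t t' : Fin k → G) (χ : AddChar G ℂ) :
        ft F χ * conj (χ (v + ∑ i, (t i - t' i) + b)) - ft F χ * conj (χ (v + ∑ i, (t i - t' i))) =
        ft F χ * (conj (χ v) * conj (∏ i, χ (t i)) * ∏ i, χ (t' i)) * (conj (χ b) - 1) := by
      have : conj (χ (v + ∑ i, (t i - t' i))) =
          conj (χ v) * conj (∏ i, χ (t i)) * ∏ i, χ (t' i) := by
        rw [sum_sub_distrib, AddChar.map_add_eq_mul, sub_eq_add_neg, AddChar.map_add_eq_mul,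
          AddChar.map_neg_eq_conj, addChar_sum, addChar_sum]
        simp [mul_assoc]
      rw [AddChar.map_add_eq_mul _ _ b, map_mul, this]
      ring
    simp_rw [e]
    have sw (v : G) : ∑ t ∈ P, ∑ t' ∈ P, ∑ χ : AddChar G ℂ, ft F χ *
        (conj (χ v) * conj (∏ i, χ (t i)) * ∏ i, χ (t' i)) * (conj (χ b) - 1) =
        ∑ χ : AddChar G ℂ, ft F χ * (conj (χ v) * conj (charSum T χ ^ k) * charSum T χ ^ k) *
          (conj (χ b) - 1) := by
      rw [sum_congr rfl fun t _ => sum_comm, sum_comm]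
      refine sum_congr rfl fun χ _ => ?_
      simp_rw [← sum_mul, ← mul_sum, hpow, ← sum_mul, ← mul_sum, ← map_sum, hpow]
    rw [sum_congr rfl fun v _ => sw v, sum_comm]
    refine sum_congr rfl fun χ _ => ?_
    simp_rw [← sum_mul, ← mul_sum, ← sum_mul, ← map_sum, map_pow]
    rw [charSum, charSum]
    ring
  have h2 : ‖(Fintype.card G : ℂ) * ((∑ v ∈ V, ∑ t ∈ P, ∑ t' ∈ P,
      (F (v + ∑ i, (t i - t' i) + b) - F (v + ∑ i, (t i - t' i))) : ℝ) : ℂ)‖ ≤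
      ∑ χ : AddChar G ℂ, (M * #T ^ (2 * k)) * (‖ft F χ‖ * ‖charSum V χ‖) := by
    rw [h1]
    refine (norm_sum_le _ _).trans (sum_le_sum fun χ _ => ?_)
    have e : ‖conj (χ b) - 1‖ = ‖1 - χ b‖ := by
      rw [← norm_sub_rev, ← Complex.norm_conj]
      simp
    rw [norm_mul, norm_mul, norm_mul, norm_mul, norm_pow, norm_pow, Complex.norm_conj,
      Complex.norm_conj, e]
    calc _ = ‖charSum T χ‖ ^ (2 * k) * ‖1 - χ b‖ * (‖ft F χ‖ * ‖charSum V χ‖) := by ring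
      _ ≤ _ := by exact mul_le_mul_of_nonneg_right (h χ) (by positivity)
  have h3 : ∑ χ : AddChar G ℂ, ‖ft F χ‖ * ‖charSum V χ‖ ≤ Fintype.card G * √(#X * #V) := by
    refine (pow_le_pow_iff_left₀ (by positivity) (by positivity) two_ne_zero).1 ?_
    refine (sum_mul_sq_le_sq_mul_sq _ _ _).trans ?_
    simp_rw [← ft_ind]
    rw [parseval, parseval, mul_pow, Real.sq_sqrt (by positivity)]
    have e1 : ∑ x, F x ^ 2 ≤ #X := by
      rw [← sum_ind]
      refine sum_le_sum fun x _ => ?_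
      rw [← sq_abs]
      have := hF x
      have := ind_le_one X x
      have := ind_nonneg X x
      nlinarith [abs_nonneg (F x)]
    have e2 : ∑ x, ind V x ^ 2 = #V := by
      rw [← sum_ind]
      refine sum_congr rfl fun x _ => ?_
      simp [ind]
    rw [e2]
    have : 0 ≤ ∑ x, F x ^ 2 := sum_nonneg fun _ _ => sq_nonneg _
    calc _ = (Fintype.card G : ℝ) ^ 2 * ((∑ x, F x ^ 2) * #V) := by ring
      _ ≤ _ := by gcongr
  rw [norm_mul, Complex.norm_natCast, Complex.norm_real, Real.norm_eq_abs, ← mul_sum] at h2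
  refine le_of_mul_le_mul_left (h2.trans ?_) hN
  calc _ ≤ M * #T ^ (2 * k) * (Fintype.card G * √(#X * #V)) := by gcongr
    _ = _ := by ring

end Fourier

/-! ### Dissociated characters and the large spectrum -/

section Spectrum

variable {G : Type*} [AddCommGroup G] [Fintype G] [DecidableEq G]

/-- The coefficients `-1, 0, 1`. -/
def signs : Finset ℤ := {-1, 0, 1}

/-- A tuple of characters is dissociated relative to `Q` if no nontrivial combination of its
members with coefficients in `{-1, 0, 1}` has a large Fourier coefficient on `Q`. -/
def Dissoc (Q : Finset G) {n : ℕ} (Λ : Fin n → AddChar G ℂ) : Prop :=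
  ∀ e : Fin n → ℤ, (∀ i, e i ∈ signs) → e ≠ 0 → ‖charSum Q (∏ i, Λ i ^ e i)‖ ≤ #Q / 2

lemma zpow_apply (χ : AddChar G ℂ) (e : ℤ) (x : G) : (χ ^ e) x = χ x ^ e := by
  cases e with
  | ofNat n => simp [AddChar.pow_apply]
  | negSucc n => simp [AddChar.pow_apply, AddChar.map_neg_eq_inv]

lemma charSum_piFinset (Q : Finset G) (l : ℕ) (χ : AddChar G ℂ) :
    ∑ q ∈ Fintype.piFinset (fun _ : Fin l => Q), χ (∑ i, q i) = charSum Q χ ^ l := by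
  have := prod_univ_sum (fun _ : Fin l => Q) (fun _ a => χ a)
  rw [prod_const, card_univ, Fintype.card_fin] at this
  simp_rw [addChar_sum]
  exact this.symm

/-- The total mass of a Riesz product over dissociated characters. -/
lemma sum_riesz_le {H Y Q : Finset G} (hQ : Q.Nonempty) {n l : ℕ} (hnl : n ≤ l)
    (hY : ∀ x ∈ H, ∀ q ∈ Fintype.piFinset (fun _ : Fin l => Q), x + ∑ i, q i ∈ Y)
    {Λ : Fin n → AddChar G ℂ} (hΛ : Dissoc Q Λ) {c : Fin n → ℂ} (hc : ∀ i, ‖c i‖ ≤ 1) :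
    ∑ x ∈ H, ∏ i, (1 + (c i * Λ i x).re / 2) ≤ 2 * #Y := by
  set R : G → ℝ := fun x => ∏ i, (1 + (c i * Λ i x).re / 2) with hR
  set W := Fintype.piFinset (fun _ : Fin l => Q) with hW
  have hQ0 : (0 : ℝ) < #Q := by exact_mod_cast hQ.card_pos
  have hR0 (x : G) : 0 ≤ R x := by
    refine prod_nonneg fun i _ => ?_
    have h1 : ‖c i * Λ i x‖ ≤ 1 := by rw [norm_mul, AddChar.norm_apply, mul_one]; exact hc i
    have := (abs_le.1 ((Complex.abs_re_le_norm _).trans h1)).1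
    linarith
  let w (i : Fin n) (e : ℤ) : ℂ := if e = 1 then c i / 4 else if e = 0 then 1 else conj (c i) / 4
  have hRe (x : G) : (R x : ℂ) = ∑ e ∈ Fintype.piFinset (fun _ : Fin n => signs),
      (∏ i, w i (e i)) * (∏ i, Λ i ^ e i) x := by
    have := prod_univ_sum (fun _ : Fin n => signs) (fun i e => w i e * (Λ i x) ^ e)
    simp_rw [AddChar.prod_apply, zpow_apply, ← prod_mul_distrib, ← this, hR]
    rw [Complex.ofReal_prod]
    refine prod_congr rfl fun i _ => ?_
    have hinv : (Λ i x)⁻¹ = conj (Λ i x) := by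
      rw [← AddChar.map_neg_eq_inv, AddChar.map_neg_eq_conj]
    have hre : (((c i * Λ i x).re : ℝ) : ℂ) = (c i * Λ i x + conj (c i) * conj (Λ i x)) / 2 := by
      rw [Complex.re_eq_add_conj, map_mul]
    simp only [signs, w]
    rw [sum_insert (by decide), sum_insert (by decide), sum_singleton]
    rw [Complex.ofReal_add, Complex.ofReal_div, hre]
    norm_num [hinv]
    ring
  have h1 : #Q ^ l * ∑ x ∈ H, R x ≤ ∑ q ∈ W, ∑ y ∈ Y, R (y - ∑ i, q i) := by
    have hWc : (#W : ℝ) = #Q ^ l := by rw [hW, Fintype.card_piFinset_const]; push_cast; rfl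
    rw [← hWc, ← nsmul_eq_mul, ← sum_const]
    refine sum_le_sum fun q hq => ?_
    calc ∑ x ∈ H, R x = ∑ y ∈ H.image (· + ∑ i, q i), R (y - ∑ i, q i) := by
          rw [sum_image (add_left_injective _).injOn]; simp
      _ ≤ _ := by
          refine sum_le_sum_of_subset_of_nonneg (fun y hy => ?_) fun _ _ _ => hR0 _
          obtain ⟨x, hx, rfl⟩ := mem_image.1 hy
          exact hY x hx q hq
  have h2 : ((∑ q ∈ W, ∑ y ∈ Y, R (y - ∑ i, q i) : ℝ) : ℂ) =
      ∑ e ∈ Fintype.piFinset (fun _ : Fin n => signs), (∏ i, w i (e i)) *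
        (charSum Y (∏ i, Λ i ^ e i) * conj (charSum Q (∏ i, Λ i ^ e i)) ^ l) := by
    push_cast
    simp_rw [hRe, sub_eq_add_neg, AddChar.map_add_eq_mul, AddChar.map_neg_eq_conj]
    rw [sum_congr rfl fun q _ => sum_comm, sum_comm]
    refine sum_congr rfl fun e _ => ?_
    simp_rw [← mul_sum, ← sum_mul, ← mul_sum, ← map_sum]
    rw [charSum_piFinset, map_pow]
    rfl
  have h3 : ∑ q ∈ W, ∑ y ∈ Y, R (y - ∑ i, q i) ≤ 2 * #Y * #Q ^ l := by
    have hw : ∑ e ∈ Fintype.piFinset (fun _ : Fin n => signs), ∏ i, ‖w i (e i)‖ ≤ (3 / 2) ^ n := by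
      rw [← prod_univ_sum (fun _ : Fin n => signs) (fun i e => ‖w i e‖)]
      refine (prod_le_prod (fun _ _ => sum_nonneg fun _ _ => norm_nonneg _)
        (fun i _ => (?_ : _ ≤ (3 / 2 : ℝ)))).trans (by simp [div_pow])
      simp only [signs, w]
      rw [sum_insert (by decide), sum_insert (by decide), sum_singleton]
      have := hc i
      norm_num
      linarith
    have h4 : ‖((∑ q ∈ W, ∑ y ∈ Y, R (y - ∑ i, q i) : ℝ) : ℂ)‖ ≤
        ∑ e ∈ Fintype.piFinset (fun _ : Fin n => signs), ((if e = 0 then (#Y : ℝ) * #Q ^ l else 0) +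
          (∏ i, ‖w i (e i)‖) * (#Y * (#Q / 2) ^ l)) := by
      rw [h2]
      refine (norm_sum_le _ _).trans (sum_le_sum fun e he => ?_)
      rw [norm_mul, norm_mul, norm_pow, Complex.norm_conj, norm_prod]
      split_ifs with h0
      · have : ∏ i, ‖w i (e i)‖ = 1 := by simp [h0, w]
        rw [this, one_mul, one_mul]
        refine le_add_of_le_of_nonneg ?_ (by positivity)
        gcongr <;> exact norm_charSum_le _ _
      · rw [zero_add]
        gcongr
        · exact norm_charSum_le _ _
        · exact hΛ e (fun i => Fintype.mem_piFinset.1 he i) h0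
    rw [Complex.norm_real] at h4
    refine (le_abs_self _).trans (h4.trans ?_)
    rw [sum_add_distrib, sum_ite_eq', ← sum_mul]
    have h5 : (3 / 2 : ℝ) ^ n * (1 / 2) ^ l ≤ 1 := by
      calc (3 / 2 : ℝ) ^ n * (1 / 2) ^ l ≤ 2 ^ n * (1 / 2) ^ l := by gcongr; norm_num
        _ ≤ 2 ^ l * (1 / 2) ^ l := by gcongr; norm_num
        _ = 1 := by rw [← mul_pow]; norm_num
    have h6 : (if (0 : Fin n → ℤ) ∈ Fintype.piFinset (fun _ : Fin n => signs) then
        (#Y : ℝ) * #Q ^ l else 0) ≤ #Y * #Q ^ l := by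
      split_ifs
      · exact le_rfl
      · positivity
    have h7 : (∑ e ∈ Fintype.piFinset (fun _ : Fin n => signs), ∏ i, ‖w i (e i)‖) *
        (#Y * (#Q / 2) ^ l) ≤ #Y * #Q ^ l := by
      calc _ ≤ (3 / 2 : ℝ) ^ n * (#Y * (#Q / 2) ^ l) := by gcongr
        _ = (3 / 2 : ℝ) ^ n * (1 / 2) ^ l * (#Y * #Q ^ l) := by ring
        _ ≤ 1 * (#Y * #Q ^ l) := by gcongr
        _ = _ := one_mul _
    linarith
  have h8 := h1.trans h3
  refine le_of_mul_le_mul_left (h8.trans (le_of_eq ?_)) (pow_pos hQ0 l)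
  ring

lemma exp_le_one_add_half {y : ℝ} (h : |y| ≤ 1) :
    Real.exp ((1 + y) / 2 * Real.log (3 / 2) + (1 - y) / 2 * Real.log (1 / 2)) ≤ 1 + y / 2 := by
  obtain ⟨h1, h2⟩ := abs_le.1 h
  have := convexOn_exp.2 (Set.mem_univ (Real.log (3 / 2))) (Set.mem_univ (Real.log (1 / 2)))
    (by linarith : 0 ≤ (1 + y) / 2) (by linarith : 0 ≤ (1 - y) / 2) (by ring)
  rw [Real.exp_log (by norm_num), Real.exp_log (by norm_num)] at this
  simp only [smul_eq_mul] at this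
  linarith

/-- A local form of Chang's inequality. -/
lemma dissoc_card_bound {T H Y Q : Finset G} (hTH : T ⊆ H) (hQ : Q.Nonempty) {n l : ℕ} (hnl : n ≤ l)
    (hY : ∀ x ∈ H, ∀ q ∈ Fintype.piFinset (fun _ : Fin l => Q), x + ∑ i, q i ∈ Y)
    {Λ : Fin n → AddChar G ℂ} (hΛ : Dissoc Q Λ) (hT : ∀ i, (#T : ℝ) / 2 ≤ ‖charSum T (Λ i)‖) :
    #T * Real.exp (n * (Real.log 2 / 8)) ≤ 2 * #Y := by
  let c (i : Fin n) : ℂ := conj (charSum T (Λ i)) / ‖charSum T (Λ i)‖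
  have hc (i : Fin n) : ‖c i‖ ≤ 1 := by
    simp only [c]
    rw [norm_div, Complex.norm_conj, Complex.norm_real, norm_norm]
    exact div_self_le_one _
  have hc' (i : Fin n) : ∑ x ∈ T, (c i * Λ i x).re = ‖charSum T (Λ i)‖ := by
    rw [← Complex.re_sum, ← mul_sum]
    change (c i * charSum T (Λ i)).re = _
    simp only [c]
    rw [div_mul_eq_mul_div, Complex.conj_mul']
    norm_cast
    rw [sq, mul_self_div_self]
  have hb (i : Fin n) (x : G) : |(c i * Λ i x).re| ≤ 1 := by
    refine (Complex.abs_re_le_norm _).trans ?_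
    rw [norm_mul, AddChar.norm_apply, mul_one]; exact hc i
  set a := Real.log (3 / 2)
  set b := Real.log (1 / 2)
  let z (x : G) : ℝ := ∑ i, ((1 + (c i * Λ i x).re) / 2 * a + (1 - (c i * Λ i x).re) / 2 * b)
  set z0 : ℝ := n * (Real.log 2 / 8)
  have h1 : ∀ x ∈ T, Real.exp z0 * (1 + (z x - z0)) ≤ ∏ i, (1 + (c i * Λ i x).re / 2) := by
    intro x _
    calc Real.exp z0 * (1 + (z x - z0)) ≤ Real.exp z0 * Real.exp (z x - z0) := by
          gcongr; linarith [Real.add_one_le_exp (z x - z0)]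
      _ = Real.exp (z x) := by rw [← Real.exp_add]; congr 1; ring
      _ = ∏ i, Real.exp ((1 + (c i * Λ i x).re) / 2 * a + (1 - (c i * Λ i x).re) / 2 * b) :=
          Real.exp_sum _ _
      _ ≤ _ := prod_le_prod (fun _ _ => (Real.exp_pos _).le) fun i _ =>
          exp_le_one_add_half (hb i x)
  have h2 : (#T : ℝ) * z0 ≤ ∑ x ∈ T, z x := by
    have e : ∑ x ∈ T, z x = ∑ i, ((#T + ‖charSum T (Λ i)‖) / 2 * a +
        (#T - ‖charSum T (Λ i)‖) / 2 * b) := by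
      simp only [z]
      rw [sum_comm]
      refine sum_congr rfl fun i _ => ?_
      rw [sum_add_distrib, ← sum_mul, ← sum_mul, ← sum_div, ← sum_div, sum_add_distrib,
        sum_sub_distrib, hc']
      simp
    have hab : Real.log 2 / 8 ≤ 3 / 4 * a + 1 / 4 * b := by
      have : Real.log 2 ≤ 2 * (3 * a + b) := by
        have e3 : 2 * (3 * a + b) = Real.log (((3 / 2) ^ 3 * (1 / 2)) ^ 2) := by
          rw [Real.log_pow, Real.log_mul (by norm_num) (by norm_num), Real.log_pow]
          push_cast; ring
        rw [e3]
        exact Real.log_le_log (by norm_num) (by norm_num)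
      linarith
    have hba : b ≤ a := Real.log_le_log (by norm_num) (by norm_num)
    rw [e]
    calc (#T : ℝ) * z0 = ∑ i : Fin n, (#T : ℝ) * (Real.log 2 / 8) := by
          simp only [z0, sum_const, card_univ, Fintype.card_fin, nsmul_eq_mul]; ring
      _ ≤ _ := by
          refine sum_le_sum fun i _ => ?_
          have := hT i
          nlinarith [mul_le_mul_of_nonneg_left hab (Nat.cast_nonneg (α := ℝ) #T),
            mul_nonneg (sub_nonneg.2 this) (sub_nonneg.2 hba)]
  have h3 : (#T : ℝ) * Real.exp z0 ≤ ∑ x ∈ T, ∏ i, (1 + (c i * Λ i x).re / 2) := by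
    refine le_trans ?_ (sum_le_sum h1)
    rw [← mul_sum, sum_add_distrib, sum_sub_distrib, sum_const, sum_const, nsmul_eq_mul,
      nsmul_eq_mul, mul_comm]
    have := Real.exp_pos z0
    gcongr
    linarith
  refine h3.trans (le_trans ?_ (sum_riesz_le hQ hnl hY hΛ hc))
  refine sum_le_sum_of_subset_of_nonneg hTH fun x _ _ => prod_nonneg fun i _ => ?_
  linarith [(abs_le.1 (hb i x)).1]

lemma norm_one_sub_mul_le {z w : ℂ} (hz : ‖z‖ = 1) : ‖1 - z * w‖ ≤ ‖1 - z‖ + ‖1 - w‖ := by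
  calc ‖1 - z * w‖ = ‖(1 - z) + z * (1 - w)‖ := by ring_nf
    _ ≤ ‖1 - z‖ + ‖z * (1 - w)‖ := norm_add_le _ _
    _ = _ := by rw [norm_mul, hz, one_mul]

lemma norm_one_sub_inv {z : ℂ} (hz : ‖z‖ = 1) : ‖1 - z⁻¹‖ = ‖1 - z‖ := by
  have h0 : z ≠ 0 := by rintro rfl; simp at hz
  rw [show 1 - z⁻¹ = -(1 - z) * z⁻¹ by field_simp; ring, norm_mul, norm_neg, norm_inv, hz]
  simp

lemma norm_one_sub_prod_le (x : G) {n : ℕ} (Λ : Fin n → AddChar G ℂ) {e : Fin n → ℤ}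
    (he : ∀ i, e i ∈ signs) {ρ : ℝ} (h : ∀ i, ‖1 - Λ i x‖ ≤ ρ) :
    ‖1 - (∏ i, Λ i ^ e i) x‖ ≤ n * ρ := by
  rw [AddChar.prod_apply]
  have h1 (i : Fin n) : ‖1 - (Λ i ^ e i) x‖ ≤ ρ := by
    rw [zpow_apply]
    have h2 := he i
    simp only [signs, mem_insert, mem_singleton] at h2
    rcases h2 with h2 | h2 | h2
    · rw [h2, zpow_neg_one, norm_one_sub_inv (AddChar.norm_apply _ _)]; exact h i
    · rw [h2]; simpa using (norm_nonneg _).trans (h i)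
    · rw [h2, zpow_one]; exact h i
  have h2 (s : Finset (Fin n)) : ‖1 - ∏ i ∈ s, (Λ i ^ e i) x‖ ≤ #s * ρ := by
    induction s using Finset.induction_on with
    | empty => simp
    | insert a s ha ih =>
      rw [prod_insert ha, card_insert_of_notMem ha]
      refine (norm_one_sub_mul_le (AddChar.norm_apply _ _)).trans ?_
      push_cast
      linarith [h1 a]
  simpa using h2 univ

/-- The large spectrum of a dense subset of `H` is controlled by few characters together with
the large spectrum of `Q`. -/
theorem exists_spectrum_control {T H Y Q : Finset G} (hTH : T ⊆ H) (hT : T.Nonempty)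
    (hQ : Q.Nonempty) {L : ℕ} (hL : (#H : ℝ) ≤ 2 ^ L * #T)
    (hY : ∀ x ∈ H, ∀ q ∈ Fintype.piFinset (fun _ : Fin (8 * (L + 2) + 1) => Q), x + ∑ i, q i ∈ Y)
    (hYH : (#Y : ℝ) ≤ 2 * #H) :
    ∃ Λ : Finset (AddChar G ℂ), #Λ ≤ 8 * (L + 2) ∧ ∀ (b : G) (ρ τ : ℝ),
      0 ≤ ρ → (∀ χ ∈ Λ, ‖1 - χ b‖ ≤ ρ) →
      (∀ χ : AddChar G ℂ, (#Q : ℝ) / 2 < ‖charSum Q χ‖ → ‖1 - χ b‖ ≤ τ) →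
      ∀ χ : AddChar G ℂ, (#T : ℝ) / 2 ≤ ‖charSum T χ‖ → ‖1 - χ b‖ ≤ 8 * (L + 2) * ρ + τ := by
  have hT0 : (0 : ℝ) < #T := by exact_mod_cast hT.card_pos
  let P (n : ℕ) : Prop := ∃ Λ : Fin n → AddChar G ℂ,
    Dissoc Q Λ ∧ ∀ i, (#T : ℝ) / 2 ≤ ‖charSum T (Λ i)‖
  have hP0 : P 0 := ⟨Fin.elim0, fun e _ he => absurd (Subsingleton.elim e 0) he, fun i => i.elim0⟩
  have hbound : ¬ P (8 * (L + 2) + 1) := by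
    rintro ⟨Λ, h1, h2⟩
    have h3 := dissoc_card_bound hTH hQ le_rfl hY h1 h2
    have h4 : #T * Real.exp ((8 * (L + 2) + 1 : ℕ) * (Real.log 2 / 8)) ≤
        #T * Real.exp ((L + 2) * Real.log 2) := by
      refine h3.trans ?_
      rw [show ((L : ℝ) + 2) = ((L + 2 : ℕ) : ℝ) by push_cast; ring, Real.exp_nat_mul,
        Real.exp_log two_pos, pow_add]
      linarith
    have h5 := Real.exp_le_exp.1 (le_of_mul_le_mul_left h4 hT0)
    push_cast at h5
    have := Real.log_pos (one_lt_two)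
    linarith
  classical
  have hex : ∃ n, ¬ P n := ⟨_, hbound⟩
  obtain ⟨n, hn⟩ : ∃ n, Nat.find hex = n + 1 := by
    refine Nat.exists_eq_succ_of_ne_zero fun h0 => ?_
    have := Nat.find_spec hex
    rw [h0] at this
    exact this hP0
  have hnP : P n := not_not.1 (Nat.find_min hex (by omega))
  have hnP' : ¬ P (n + 1) := hn ▸ Nat.find_spec hex
  have hnL : n ≤ 8 * (L + 2) := by
    have := Nat.find_min' hex hbound
    omega
  obtain ⟨Λ, h1, h2⟩ := hnP
  refine ⟨univ.image Λ, card_image_le.trans (by simpa using hnL), ?_⟩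
  intro b ρ τ hρ hΛ hψ χ hχ
  have h3 : ¬ Dissoc Q (Fin.cons χ Λ : Fin (n + 1) → AddChar G ℂ) := fun h =>
    hnP' ⟨_, h, fun i => by refine Fin.cases ?_ (fun j => ?_) i <;> simp [hχ, h2]⟩
  simp only [Dissoc, not_forall, not_le] at h3
  obtain ⟨e, he, he0, h4⟩ := h3
  rw [Fin.prod_univ_succ] at h4
  simp only [Fin.cons_zero, Fin.cons_succ] at h4
  set ξ : AddChar G ℂ := ∏ i : Fin n, Λ i ^ e i.succ with hξ
  have h5 := hψ _ h4
  have h6 : ‖1 - ξ b‖ ≤ n * ρ :=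
    norm_one_sub_prod_le b Λ (fun i => he _) fun i => hΛ _ (mem_image_of_mem _ (mem_univ i))
  have h7 : (n : ℝ) * ρ ≤ 8 * (L + 2) * ρ := by
    have : (n : ℝ) ≤ 8 * (L + 2) := by exact_mod_cast hnL
    gcongr
  have h8 : ‖1 - (χ ^ e 0) b‖ ≤ 8 * (L + 2) * ρ + τ := by
    have e1 : (χ ^ e 0) b = (ξ b)⁻¹ * (χ ^ e 0 * ξ) b := by
      rw [AddChar.mul_apply, mul_comm, mul_assoc, mul_inv_cancel₀, mul_one]
      exact fun h => by simpa [h] using AddChar.norm_apply ξ b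
    rw [e1]
    refine (norm_one_sub_mul_le (by rw [norm_inv, AddChar.norm_apply, inv_one])).trans ?_
    rw [norm_one_sub_inv (AddChar.norm_apply _ _)]
    linarith
  have h9 := he 0
  simp only [signs, mem_insert, mem_singleton] at h9
  rcases h9 with h9 | h9 | h9
  · rw [h9, zpow_apply, zpow_neg_one, norm_one_sub_inv (AddChar.norm_apply _ _)] at h8
    exact h8
  · exfalso
    refine not_le.2 h4 ?_
    rw [h9, zpow_zero, one_mul]
    refine h1 _ (fun i => he _) fun h => he0 ?_
    funext i
    refine Fin.cases h9 (fun j => congrFun h j) i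
  · rwa [h9, zpow_one] at h8

/-- A character with a large Fourier coefficient on `Q` is nearly trivial on almost periods of
`Q`. -/
lemma norm_one_sub_le_of_charSum {Q D : Finset G} (hQ : Q.Nonempty) (h0 : (0 : G) ∈ D) {κ : ℝ}
    (h : (#(Q + D) : ℝ) ≤ (1 + κ) * #Q) {b : G} (hb : b ∈ D) {χ : AddChar G ℂ}
    (hχ : (#Q : ℝ) / 2 < ‖charSum Q χ‖) : ‖1 - χ b‖ ≤ 4 * κ := by
  have hQ0 : (0 : ℝ) < #Q := by exact_mod_cast hQ.card_pos
  have hc := card_filter_add_notMem_le h0 h hb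
  set Q' := Q.image (· + b) with hQ'
  have hQ'c : #Q' = #Q := card_image_of_injective _ (add_left_injective b)
  have hd1 : (#(Q' \ Q) : ℝ) ≤ κ * #Q := by
    refine le_trans ?_ hc
    norm_cast
    have : Q' \ Q ⊆ ({q ∈ Q | q + b ∉ Q} : Finset G).image (· + b) := by
      intro x hx
      obtain ⟨hx1, hx2⟩ := mem_sdiff.1 hx
      obtain ⟨q, hq, rfl⟩ := mem_image.1 hx1
      exact mem_image_of_mem _ (mem_filter.2 ⟨hq, hx2⟩)
    exact (card_le_card this).trans card_image_le
  have hd2 : (#(Q \ Q') : ℝ) ≤ κ * #Q := by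
    have e : #(Q \ Q') = #(Q' \ Q) := card_sdiff_comm hQ'c.symm
    rw [e]; exact hd1
  have h1 : charSum Q χ * (1 - χ b) = charSum (Q \ Q') χ - charSum (Q' \ Q) χ := by
    have e1 : charSum Q χ * χ b = charSum Q' χ := by
      rw [charSum, charSum, hQ', sum_image (add_left_injective b).injOn, sum_mul]
      simp_rw [AddChar.map_add_eq_mul]
    rw [mul_sub, mul_one, e1]
    simp only [charSum]
    rw [← sum_sdiff_sub_sum_sdiff]
  have h2 : ‖charSum Q χ‖ * ‖1 - χ b‖ ≤ 2 * κ * #Q := by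
    rw [← norm_mul, h1]
    refine (norm_sub_le _ _).trans ?_
    linarith [norm_charSum_le (Q \ Q') χ, norm_charSum_le (Q' \ Q) χ]
  have h3 : (#Q : ℝ) / 2 * ‖1 - χ b‖ ≤ (#Q : ℝ) / 2 * (4 * κ) := by
    calc _ ≤ ‖charSum Q χ‖ * ‖1 - χ b‖ := by gcongr
      _ ≤ _ := by linarith
  exact le_of_mul_le_mul_left h3 (by positivity)

end Spectrum

/-! ### Bohr sets -/

section Bohr

variable {G : Type*} [AddCommGroup G] [Fintype G] [DecidableEq G]

open Classical in
/-- The Bohr set of width `ρ` with frequencies `Γ`. -/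
noncomputable def bohr (Γ : Finset (AddChar G ℂ)) (ρ : ℝ) : Finset G :=
  {x | ∀ χ ∈ Γ, ‖1 - χ x‖ ≤ ρ}

variable {Γ Γ' : Finset (AddChar G ℂ)} {ρ ρ' : ℝ} {x y : G}

lemma mem_bohr : x ∈ bohr Γ ρ ↔ ∀ χ ∈ Γ, ‖1 - χ x‖ ≤ ρ := by simp [bohr]

lemma bohr_mono (h : ρ ≤ ρ') : bohr Γ ρ ⊆ bohr Γ ρ' := fun _ hx =>
  mem_bohr.2 fun χ hχ => (mem_bohr.1 hx χ hχ).trans h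

lemma bohr_anti (h : Γ ⊆ Γ') : bohr Γ' ρ ⊆ bohr Γ ρ := fun _ hx =>
  mem_bohr.2 fun χ hχ => mem_bohr.1 hx χ (h hχ)

lemma zero_mem_bohr (hρ : 0 ≤ ρ) : (0 : G) ∈ bohr Γ ρ := mem_bohr.2 fun χ _ => by simpa

lemma bohr_nonempty (hρ : 0 ≤ ρ) : (bohr Γ ρ).Nonempty := ⟨0, zero_mem_bohr hρ⟩

lemma neg_mem_bohr (hx : x ∈ bohr Γ ρ) : -x ∈ bohr Γ ρ := mem_bohr.2 fun χ hχ => by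
  rw [AddChar.map_neg_eq_inv, norm_one_sub_inv (AddChar.norm_apply _ _)]
  exact mem_bohr.1 hx χ hχ

lemma add_mem_bohr (hx : x ∈ bohr Γ ρ) (hy : y ∈ bohr Γ ρ') : x + y ∈ bohr Γ (ρ + ρ') :=
  mem_bohr.2 fun χ hχ => by
    rw [AddChar.map_add_eq_mul]
    exact (norm_one_sub_mul_le (AddChar.norm_apply _ _)).trans
      (add_le_add (mem_bohr.1 hx χ hχ) (mem_bohr.1 hy χ hχ))

lemma bohr_add_subset : bohr Γ ρ + bohr Γ ρ' ⊆ bohr Γ (ρ + ρ') := fun _ hz => by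
  obtain ⟨x, hx, y, hy, rfl⟩ := mem_add.1 hz
  exact add_mem_bohr hx hy

lemma sum_mem_bohr (n : ℕ) {f : Fin n → G} (hf : ∀ i, f i ∈ bohr Γ ρ) :
    ∑ i, f i ∈ bohr Γ (n * ρ) := by
  induction n with
  | zero => simpa using zero_mem_bohr le_rfl
  | succ n ih =>
    rw [Fin.sum_univ_castSucc]
    convert add_mem_bohr (ih fun i => hf i.castSucc) (hf (Fin.last n)) using 1
    push_cast
    ring_nf

lemma card_bohr_two_mul_le (hρ : 0 < ρ) : #(bohr Γ (2 * ρ)) ≤ 2 ^ (6 * #Γ) * #(bohr Γ ρ) := by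
  set s := 2 * ρ / 3 with hs
  have hs0 : 0 < s := by positivity
  let f (x : G) (χ : Γ) : ℤ × ℤ := (⌊(1 - χ.1 x).re / s⌋, ⌊(1 - χ.1 x).im / s⌋)
  have himg : (bohr Γ (2 * ρ)).image f ⊆
      Fintype.piFinset fun _ : Γ => Icc (-3 : ℤ) 3 ×ˢ Icc (-3 : ℤ) 3 := by
    intro y hy
    obtain ⟨x, hx, rfl⟩ := mem_image.1 hy
    rw [Fintype.mem_piFinset]
    intro χ
    have h1 := mem_bohr.1 hx χ.1 χ.2
    have key (t : ℝ) (ht : |t| ≤ ‖1 - χ.1 x‖) : -3 ≤ ⌊t / s⌋ ∧ ⌊t / s⌋ ≤ 3 := by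
      have h2 := abs_le.1 (ht.trans h1)
      have h3 : 2 * ρ = 3 * s := by rw [hs]; ring
      constructor
      · rw [Int.le_floor, le_div_iff₀ hs0]; push_cast; linarith
      · have : t / s ≤ 3 := by rw [div_le_iff₀ hs0]; linarith
        exact_mod_cast (Int.floor_le _).trans this
    simp only [f, mem_product, mem_Icc]
    exact ⟨key _ (Complex.abs_re_le_norm _), key _ (Complex.abs_im_le_norm _)⟩
  have hfib : ∀ y ∈ (bohr Γ (2 * ρ)).image f, #{x ∈ bohr Γ (2 * ρ) | f x = y} ≤ #(bohr Γ ρ) := by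
    intro y hy
    obtain ⟨x0, _, rfl⟩ := mem_image.1 hy
    refine card_le_card_of_injOn (· - x0) (fun x hx => ?_) (sub_left_injective).injOn
    simp only [coe_filter, Set.mem_ofPred_eq] at hx
    refine mem_coe.2 (mem_bohr.2 fun χ hχ => ?_)
    have h1 := congrFun hx.2 ⟨χ, hχ⟩
    simp only [f, Prod.mk.injEq] at h1
    have h2 := Int.abs_sub_lt_one_of_floor_eq_floor h1.1
    have h3 := Int.abs_sub_lt_one_of_floor_eq_floor h1.2
    rw [← sub_div, abs_div, abs_of_pos hs0, div_lt_one hs0, ← Complex.sub_re, ← sq_lt_sq₀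
      (abs_nonneg _) hs0.le, sq_abs] at h2
    rw [← sub_div, abs_div, abs_of_pos hs0, div_lt_one hs0, ← Complex.sub_im, ← sq_lt_sq₀
      (abs_nonneg _) hs0.le, sq_abs] at h3
    have h4 : ‖1 - χ (x - x0)‖ = ‖(1 - χ x) - (1 - χ x0)‖ := by
      rw [AddChar.map_sub_eq_div]
      have h0 : χ x0 ≠ 0 := fun h => by simpa [h] using AddChar.norm_apply χ x0
      rw [show 1 - χ x / χ x0 = ((1 - χ x) - (1 - χ x0)) * (χ x0)⁻¹ by field_simp; ring, norm_mul,
        norm_inv, AddChar.norm_apply]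
      simp
    rw [h4, ← sq_le_sq₀ (norm_nonneg _) hρ.le, Complex.sq_norm, Complex.normSq_apply]
    rw [hs] at h2 h3
    nlinarith
  have h5 := card_le_mul_card_image (bohr Γ (2 * ρ)) _ hfib
  refine h5.trans ?_
  rw [mul_comm]
  refine Nat.mul_le_mul_right _ ((card_le_card himg).trans ?_)
  rw [Fintype.card_piFinset, prod_const, card_univ, pow_mul, Fintype.card_coe]
  exact Nat.pow_le_pow_left (by decide) _

lemma card_le_card_bohr (Γ : Finset (AddChar G ℂ)) (j : ℕ) :
    Fintype.card G ≤ 2 ^ (6 * #Γ * (j + 1)) * #(bohr Γ (1 / 2 ^ j)) := by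
  induction j with
  | zero =>
    have h := card_bohr_two_mul_le (Γ := Γ) one_pos
    have e : bohr Γ (2 * 1) = univ := by
      refine eq_univ_of_forall fun x => mem_bohr.2 fun χ _ => (norm_sub_le _ _).trans ?_
      rw [AddChar.norm_apply]; norm_num
    rw [e] at h
    simpa using h
  | succ j ih =>
    have h := card_bohr_two_mul_le (Γ := Γ) (ρ := 1 / 2 ^ (j + 1)) (by positivity)
    rw [show (2 : ℝ) * (1 / 2 ^ (j + 1)) = 1 / 2 ^ j by field_simp; ring] at h
    calc _ ≤ _ := ih
      _ ≤ 2 ^ (6 * #Γ * (j + 1)) * (2 ^ (6 * #Γ) * #(bohr Γ (1 / 2 ^ (j + 1)))) := by gcongr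
      _ = _ := by ring

/-- Every scale contains a radius at which the Bohr set is stable. -/
lemma exists_stable_radius {d : ℕ} (hΓ : #Γ ≤ d) (hρ : 0 < ρ) {K : ℕ} (hK : 0 < K) :
    ∃ r, ρ / 2 ≤ r ∧ r ≤ ρ ∧
      (#(bohr Γ (r + ρ / (12 * (d + 1) * K))) : ℝ) ≤ (1 + 1 / K) * #(bohr Γ r) := by
  by_contra! h
  have hK' : (0 : ℝ) < K := by exact_mod_cast hK
  set M : ℕ := 6 * (d + 1) * K with hM
  have hM' : (M : ℝ) = 6 * (d + 1) * K := by rw [hM]; push_cast; ring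
  have hstep : ρ / (12 * (d + 1) * K) = ρ / (2 * M) := by rw [hM']; congr 1; ring
  have hM0 : (0 : ℝ) < M := by rw [hM']; positivity
  have key (i : ℕ) (hi : i ≤ M) : (1 + 1 / (K : ℝ)) ^ i * #(bohr Γ (ρ / 2)) ≤
      #(bohr Γ (ρ / 2 + i * (ρ / (2 * M)))) := by
    induction i with
    | zero => simp
    | succ i ih =>
      have h1 := ih (by omega)
      have hi' : (i : ℝ) ≤ M := by exact_mod_cast (by omega : i ≤ M)
      have h2 := h (ρ / 2 + i * (ρ / (2 * M))) (le_add_of_nonneg_right (by positivity)) (by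
        have : (i : ℝ) * (ρ / (2 * M)) ≤ M * (ρ / (2 * M)) := by gcongr
        have e : (M : ℝ) * (ρ / (2 * M)) = ρ / 2 := by field_simp
        linarith)
      rw [hstep] at h2
      rw [show ρ / 2 + ((i + 1 : ℕ) : ℝ) * (ρ / (2 * M)) =
        ρ / 2 + i * (ρ / (2 * M)) + ρ / (2 * M) by push_cast; ring]
      refine le_trans ?_ h2.le
      rw [pow_succ']
      calc _ = (1 + 1 / (K : ℝ)) * ((1 + 1 / (K : ℝ)) ^ i * #(bohr Γ (ρ / 2))) := by ring
        _ ≤ _ := by gcongr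
  have h1 := key M le_rfl
  rw [show ρ / 2 + M * (ρ / (2 * M)) = 2 * (ρ / 2) by field_simp; ring] at h1
  have h2 : (#(bohr Γ (2 * (ρ / 2))) : ℝ) ≤ 2 ^ (6 * #Γ) * #(bohr Γ (ρ / 2)) := by
    exact_mod_cast card_bohr_two_mul_le (half_pos hρ)
  have hB : (0 : ℝ) < #(bohr Γ (ρ / 2)) := by
    exact_mod_cast (bohr_nonempty (half_pos hρ).le).card_pos
  have h3 := le_of_mul_le_mul_right (h1.trans h2) hB
  have h4 : (2 : ℝ) ≤ (1 + 1 / (K : ℝ)) ^ K := by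
    have h5 := one_add_mul_le_pow (a := 1 / (K : ℝ)) (by
      have : (0 : ℝ) ≤ 1 / K := by positivity
      linarith) K
    rw [mul_one_div_cancel hK'.ne'] at h5
    linarith
  have h5 : (2 : ℝ) ^ (6 * (d + 1)) ≤ (1 + 1 / (K : ℝ)) ^ M := by
    rw [hM, mul_comm _ K, pow_mul (1 + 1 / (K : ℝ))]
    exact pow_le_pow_left₀ two_pos.le h4 _
  have h6 : (2 : ℝ) ^ (6 * #Γ) < 2 ^ (6 * (d + 1)) := by
    gcongr
    · norm_num
    · omega
  linarith

end Bohr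

/-! ### Dense translates -/

section Translate

variable {G : Type*} [AddCommGroup G] [Fintype G] [DecidableEq G]

lemma sampling_bound {a : ℕ} (ha : 1 ≤ a) {x y : ℝ} (hy : 0 ≤ y) (h : x ≤ 2 ^ (a + 1) * y) :
    4 * Real.exp (-((2 ^ 30 * a ^ 3 : ℕ) * (1 / (4096 * a : ℝ)) ^ 2 / 2)) * x ≤
      1 / (4096 * a) * y := by
  have ha' : (1 : ℝ) ≤ a := by exact_mod_cast ha
  have e : ((2 ^ 30 * a ^ 3 : ℕ) : ℝ) * (1 / (4096 * a : ℝ)) ^ 2 / 2 = (32 * a : ℕ) * 1 := by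
    push_cast
    field_simp
    norm_num
  have h1 : (2 : ℝ) ^ (32 * a) ≤ Real.exp ((32 * a : ℕ) * 1) := by
    rw [Real.exp_nat_mul]
    have := Real.exp_one_gt_d9
    gcongr
    linarith
  have h2 : (4096 * a) * (4 * 2 ^ (a + 1)) ≤ (2 : ℝ) ^ (32 * a) := by
    have h3 : (a : ℝ) ≤ 2 ^ a := by exact_mod_cast (Nat.lt_two_pow_self).le
    calc (4096 * a) * (4 * 2 ^ (a + 1)) ≤ (4096 * 2 ^ a) * (4 * (2 : ℝ) ^ (a + 1)) := by gcongr
      _ = 2 ^ (2 * a + 15) := by ring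
      _ ≤ 2 ^ (32 * a) := pow_le_pow_right₀ (by norm_num) (by omega)
  rw [e, Real.exp_neg]
  have h4 := Real.exp_pos ((32 * a : ℕ) * 1)
  have h5 : (4096 * a) * (4 * 2 ^ (a + 1)) ≤ Real.exp ((32 * a : ℕ) * 1) := h2.trans h1
  rw [div_mul_eq_mul_div, one_mul, le_div_iff₀ (by positivity)]
  calc 4 * (Real.exp ((32 * a : ℕ) * 1))⁻¹ * x * (4096 * a)
      = (Real.exp ((32 * a : ℕ) * 1))⁻¹ * (4096 * a * 4 * x) := by ring
    _ ≤ (Real.exp ((32 * a : ℕ) * 1))⁻¹ * (4096 * a * 4 * (2 ^ (a + 1) * y)) := by gcongr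
    _ = (Real.exp ((32 * a : ℕ) * 1))⁻¹ * ((4096 * a) * (4 * 2 ^ (a + 1))) * y := by ring
    _ ≤ (Real.exp ((32 * a : ℕ) * 1))⁻¹ * Real.exp ((32 * a : ℕ) * 1) * y := by gcongr
    _ = y := by rw [inv_mul_cancel₀ h4.ne', one_mul]

lemma sum_localDens_neg (A S : Finset G) :
    (∑ v ∈ A, localDens A S (-v)) * #A + #{x ∈ A ×ˢ A | x.1 - x.2 ∉ S} = (#A : ℝ) ^ 2 := by
  rcases A.eq_empty_or_nonempty with rfl | hA
  · simp
  have hA' : (0 : ℝ) < #A := by exact_mod_cast hA.card_pos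
  have h1 : (∑ v ∈ A, localDens A S (-v)) * #A = #{x ∈ A ×ˢ A | x.1 - x.2 ∈ S} := by
    rw [sum_mul]
    simp_rw [localDens, div_mul_cancel₀ _ hA'.ne']
    rw [sum_comm, ← sum_product']
    simp [ind, sub_eq_add_neg]
  rw [h1, sq]
  have := card_filter_add_card_filter_not (s := A ×ˢ A) (fun x => x.1 - x.2 ∈ S)
  rw [card_product] at this
  exact_mod_cast this

lemma sum_localDens_add (A S Bt : Finset G) (hA : A.Nonempty) (y : G) {c : ℝ}
    (h : c ≤ ∑ b ∈ Bt, localDens A S (y + b)) : ∃ x, c ≤ #{b ∈ Bt | x + b ∈ S} := by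
  have hA' : (0 : ℝ) < #A := by exact_mod_cast hA.card_pos
  have h1 : ∑ u ∈ A, c ≤ ∑ u ∈ A, (#{b ∈ Bt | u + y + b ∈ S} : ℝ) := by
    rw [sum_const, nsmul_eq_mul, mul_comm, ← le_div_iff₀ hA']
    refine h.trans (le_of_eq ?_)
    simp_rw [localDens]
    rw [← sum_div, sum_comm]
    simp [ind, add_assoc]
  obtain ⟨u, _, hu⟩ := exists_le_of_sum_le hA h1
  exact ⟨u + y, hu⟩

/-- A set `S` containing most differences of a large subset of `E` has density close to one on a
translate of any set nearly annihilated by a bounded number of characters. -/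
theorem exists_dense_translate {A E H X Q Y S : Finset G} {a : ℕ} (ha : 11 ≤ a) (hAE : A ⊆ E)
    (hE : ∀ x ∈ E, -x ∈ E) (hA : A.Nonempty) (hEA : (#E : ℝ) ≤ 2 ^ a * #A)
    (hS : 1024 * (#{x ∈ A ×ˢ A | x.1 - x.2 ∉ S} : ℝ) ≤ (#A : ℝ) ^ 2)
    (hH : H.Nonempty) (hEH : (#(E + H) : ℝ) ≤ 2 * #E)
    (hX : ∀ j ≤ a, ∀ s s' : Fin j → G, (∀ i, s i ∈ H) → (∀ i, s' i ∈ H) →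
      ∀ v ∈ E, v + ∑ i, (s i - s' i) ∈ X)
    (hXE : (#X : ℝ) ≤ 2 * #E) (hQ : Q.Nonempty) {L : ℕ}
    (hL : L = (a + 1) * (2 ^ 30 * a ^ 3) + 1)
    (hY : ∀ x ∈ H, ∀ q ∈ Fintype.piFinset (fun _ : Fin (8 * (L + 2) + 1) => Q), x + ∑ i, q i ∈ Y)
    (hYH : (#Y : ℝ) ≤ 2 * #H) :
    ∃ Λ : Finset (AddChar G ℂ), #Λ ≤ 8 * (L + 2) ∧ ∀ (Bt : Finset G) (ρ τ : ℝ),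
      Bt.Nonempty → 0 ≤ ρ → 8 * (L + 2) * ρ + τ ≤ 1 / 2 ^ (a + 10) →
      (∀ b ∈ Bt, ∀ χ ∈ Λ, ‖1 - χ b‖ ≤ ρ) →
      (∀ b ∈ Bt, ∀ χ : AddChar G ℂ, (#Q : ℝ) / 2 < ‖charSum Q χ‖ → ‖1 - χ b‖ ≤ τ) →
      ∃ x, (1 - 3 / 1024) * (#Bt : ℝ) ≤ #{b ∈ Bt | x + b ∈ S} := by
  have hA0 : (0 : ℝ) < #A := by exact_mod_cast hA.card_pos
  have hH0 : (0 : ℝ) < #H := by exact_mod_cast hH.card_pos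
  have ha0 : (0 : ℝ) < a := by exact_mod_cast (by omega : 0 < a)
  set m := 2 ^ 30 * a ^ 3 with hm
  set ε : ℝ := 1 / (4096 * a) with hε
  have hε0 : 0 < ε := by positivity
  have hXA : (#X : ℝ) ≤ 2 ^ (a + 1) * #A := by rw [pow_succ]; linarith
  obtain ⟨T, hTH, hTc, h, hh⟩ := exists_almost_periods (H := H) (X := X) (S := S) hA
    (m := m) (by positivity) hε0 (sampling_bound (by omega) hA0.le hXA)
  have hTL : (#H : ℝ) ≤ 2 ^ L * #T := by
    have h1 : (#(A + H) : ℝ) ≤ 2 ^ (a + 1) * #A := by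
      have : (#(A + H) : ℝ) ≤ #(E + H) := by
        exact_mod_cast card_le_card (add_subset_add_right hAE)
      rw [pow_succ]; linarith
    have h2 : (#A : ℝ) ^ m * #H ≤ #A ^ m * (2 ^ L * #T) := by
      calc _ ≤ _ := hTc
        _ ≤ 2 * (2 ^ (a + 1) * (#A : ℝ)) ^ m * #T := by gcongr
        _ = _ := by rw [hL, pow_succ (2 : ℝ) ((a + 1) * m), mul_pow, ← pow_mul]; ring
    exact le_of_mul_le_mul_left h2 (by positivity)
  have hT : T.Nonempty := by
    rw [nonempty_iff_ne_empty]
    rintro rfl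
    rw [card_empty, Nat.cast_zero, mul_zero] at hTL
    linarith
  have hT0 : (0 : ℝ) < #T := by exact_mod_cast hT.card_pos
  obtain ⟨Λ, hΛ, hspec⟩ := exists_spectrum_control hTH hT hQ hTL hY hYH
  refine ⟨Λ, hΛ, fun Bt ρ τ hBt hρ hρτ hb1 hb2 => ?_⟩
  set V := A.image (fun v => -v) with hV
  have hVc : #V = #A := card_image_of_injective _ neg_injective
  have hVE : ∀ v ∈ V, v ∈ E := fun v hv => by
    obtain ⟨u, hu, rfl⟩ := mem_image.1 hv
    exact hE _ (hAE hu)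
  set P := Fintype.piFinset (fun _ : Fin a => T) with hP
  have hPc : (#P : ℝ) = #T ^ a := by rw [hP, Fintype.card_piFinset_const]; push_cast; rfl
  have hPT : ∀ t ∈ P, ∀ i, t i ∈ T := fun t ht => Fintype.mem_piFinset.1 ht
  have hgV : (1 - 1 / 1024) * (#A : ℝ) ≤ ∑ v ∈ V, localDens A S v := by
    rw [hV, sum_image neg_injective.injOn]
    have h1 := sum_localDens_neg A S
    refine le_of_mul_le_mul_right ?_ hA0
    nlinarith
  let F (x : G) : ℝ := ind X x * localDens A S x
  have hF (x : G) : |F x| ≤ ind X x := by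
    have h1 := ind_nonneg X x
    have h2 := localDens_nonneg A S x
    have h3 := localDens_le_one A S x
    rw [abs_of_nonneg (mul_nonneg h1 h2)]
    exact mul_le_of_le_one_right h1 h3
  have hFle (x : G) : F x ≤ localDens A S x :=
    mul_le_of_le_one_left (localDens_nonneg A S x) (ind_le_one X x)
  have hF1 : ∀ t ∈ P, ∀ t' ∈ P,
      (1 - 2 / 1024) * (#A : ℝ) ≤ ∑ v ∈ V, F (v + ∑ i, (t i - t' i)) := by
    intro t ht t' ht'
    have h1 := sum_abs_localDens_le hε0.le hVc hh a t t' (hPT t ht) (hPT t' ht')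
      fun j hj s s' hs hs' v hv => hX j hj s s' (fun i => hTH (hs i)) (fun i => hTH (hs' i)) v
        (hVE v hv)
    have h2 : 4 * a * ε * #A = 1 / 1024 * (#A : ℝ) := by rw [hε]; field_simp; norm_num
    have h3 : ∑ v ∈ V, localDens A S v - ∑ v ∈ V, F (v + ∑ i, (t i - t' i)) ≤
        ∑ v ∈ V, |localDens A S (v + ∑ i, (t i - t' i)) - localDens A S v| := by
      rw [← sum_sub_distrib]
      refine sum_le_sum fun v hv => ?_
      have h4 : F (v + ∑ i, (t i - t' i)) = localDens A S (v + ∑ i, (t i - t' i)) := by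
        have := hX a le_rfl t t' (fun i => hTH (hPT t ht i)) (fun i => hTH (hPT t' ht' i)) v
          (hVE v hv)
        simp only [F, ind, if_pos this, one_mul]
      rw [h4, abs_sub_comm]
      exact le_abs_self _
    linarith
  have hF2 : (1 - 2 / 1024) * (#A : ℝ) * #T ^ (2 * a) ≤
      ∑ v ∈ V, ∑ t ∈ P, ∑ t' ∈ P, F (v + ∑ i, (t i - t' i)) := by
    rw [sum_comm, sum_congr rfl fun t _ => sum_comm]
    calc _ = ∑ t ∈ P, ∑ t' ∈ P, (1 - 2 / 1024) * (#A : ℝ) := by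
          rw [sum_const, sum_const, nsmul_eq_mul, nsmul_eq_mul, hPc]; ring
      _ ≤ _ := sum_le_sum fun t ht => sum_le_sum fun t' ht' => hF1 t ht t' ht'
  have hF3 : ∀ b ∈ Bt, (1 - 3 / 1024) * (#A : ℝ) * #T ^ (2 * a) ≤
      ∑ v ∈ V, ∑ t ∈ P, ∑ t' ∈ P, F (v + ∑ i, (t i - t' i) + b) := by
    intro b hb
    have h1 := norm_sum_translate_sub_le (V := V) (T := T) hF a b
      (M := 1 / 2 ^ (a + 10)) (by positivity) (fun χ => by
        rcases lt_or_ge ‖charSum T χ‖ (#T / 2) with h2 | h2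
        · have h3 : ‖1 - χ b‖ ≤ 2 := (norm_sub_le _ _).trans (by
            rw [AddChar.norm_apply]; norm_num)
          calc ‖charSum T χ‖ ^ (2 * a) * ‖1 - χ b‖ ≤ ((#T : ℝ) / 2) ^ (2 * a) * 2 := by gcongr
            _ = 2 / 2 ^ (2 * a) * #T ^ (2 * a) := by rw [div_pow]; ring
            _ ≤ _ := by
              gcongr ?_ * _
              rw [div_le_div_iff₀ (by positivity) (by positivity), ← pow_succ', one_mul]
              exact pow_le_pow_right₀ (by norm_num) (by omega)
        · have h3 := (hspec b ρ τ hρ (hb1 b hb) (hb2 b hb) χ h2).trans hρτ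
          rw [mul_comm]
          gcongr
          exact norm_charSum_le _ _)
    have h2 : √((#X : ℝ) * #V) ≤ 2 ^ a * #A := by
      rw [Real.sqrt_le_left (by positivity), hVc]
      calc (#X : ℝ) * #A ≤ (2 ^ (a + 1) * #A) * #A := by gcongr
        _ = 2 ^ (a + 1) * (#A : ℝ) ^ 2 := by ring
        _ ≤ 2 ^ (a * 2) * (#A : ℝ) ^ 2 := by
          gcongr
          · norm_num
          · omega
        _ = _ := by rw [mul_pow, ← pow_mul]
    have h3 : 1 / 2 ^ (a + 10) * (#T : ℝ) ^ (2 * a) * √(#X * #V) ≤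
        1 / 1024 * #A * #T ^ (2 * a) := by
      calc _ ≤ 1 / 2 ^ (a + 10) * (#T : ℝ) ^ (2 * a) * (2 ^ a * #A) := by gcongr
        _ = _ := by rw [pow_add]; field_simp; norm_num
    have h4 := (abs_le.1 (h1.trans h3)).1
    have e : ∑ v ∈ V, ∑ t ∈ P, ∑ t' ∈ P,
        (F (v + ∑ i, (t i - t' i) + b) - F (v + ∑ i, (t i - t' i))) =
        ∑ v ∈ V, ∑ t ∈ P, ∑ t' ∈ P, F (v + ∑ i, (t i - t' i) + b) -
          ∑ v ∈ V, ∑ t ∈ P, ∑ t' ∈ P, F (v + ∑ i, (t i - t' i)) := by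
      simp only [← Finset.sum_sub_distrib]
    rw [e] at h4
    linarith
  have hsum : ∑ x ∈ V ×ˢ (P ×ˢ P), (1 - 3 / 1024) * (#Bt : ℝ) ≤
      ∑ x ∈ V ×ˢ (P ×ˢ P), ∑ b ∈ Bt, F (x.1 + ∑ i, (x.2.1 i - x.2.2 i) + b) := by
    rw [sum_comm]
    simp_rw [sum_product]
    calc _ = ∑ b ∈ Bt, (1 - 3 / 1024) * (#A : ℝ) * #T ^ (2 * a) := by
          simp only [sum_const, nsmul_eq_mul, hPc, hVc]; ring
      _ ≤ _ := sum_le_sum hF3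
  have hP0 : P.Nonempty := Fintype.piFinset_nonempty.2 fun _ => hT
  obtain ⟨x, _, hx⟩ := exists_le_of_sum_le
    ((hA.image _).product (hP0.product hP0)) hsum
  exact sum_localDens_add A S Bt hA _ (hx.trans (sum_le_sum fun b _ => hFle _))

end Translate

/-! ### The density increment for abstract sets -/

section Increment

variable {G : Type*} [AddCommGroup G] [Fintype G] [DecidableEq G]

lemma sum_card_translate_ge {A B B' : Finset G} (hAB : A ⊆ B) (h0 : (0 : G) ∈ B')
    (hneg : ∀ x ∈ B', -x ∈ B') {κ : ℝ} (h : (#(B + B') : ℝ) ≤ (1 + κ) * #B) :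
    #B' * (#A - κ * #B) ≤ ∑ x ∈ B, (#{b ∈ B' | x + b ∈ A} : ℝ) := by
  have h1 : ∑ x ∈ B, (#{b ∈ B' | x + b ∈ A} : ℝ) = ∑ b ∈ B', (#{x ∈ B | x + b ∈ A} : ℝ) := by
    simp_rw [card_filter]
    push_cast
    exact sum_comm
  rw [h1, ← nsmul_eq_mul, ← sum_const]
  refine sum_le_sum fun b hb => ?_
  have h2 := card_filter_add_notMem_le h0 h (hneg b hb)
  have h3 : #A ≤ #{x ∈ B | x + b ∈ A} + #{x ∈ B | x + -b ∉ B} := by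
    rw [← card_filter_add_card_filter_not (s := A) (fun a => a + -b ∈ B)]
    refine add_le_add ?_ (card_le_card (filter_subset_filter _ hAB))
    refine card_le_card_of_injOn (fun a => a + -b) (fun a ha => ?_) (by simp)
    have ha' := mem_filter.1 ha
    exact mem_filter.2 ⟨ha'.2, by simpa using ha'.1⟩
  have h3' : (#A : ℝ) ≤ #{x ∈ B | x + b ∈ A} + #{x ∈ B | x + -b ∉ B} := by exact_mod_cast h3
  linarith

/-- Either `A` has increased density on a translate of `B₁` or `B₂`, or there is a single
translation for which it is nearly as dense as before on both. -/
lemma exists_translate_dense {A B B₁ B₂ : Finset G} (hAB : A ⊆ B) (hB : B.Nonempty)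
    (h0₁ : (0 : G) ∈ B₁) (hneg₁ : ∀ x ∈ B₁, -x ∈ B₁)
    (h0₂ : (0 : G) ∈ B₂) (hneg₂ : ∀ x ∈ B₂, -x ∈ B₂) {α κ : ℝ} (hκ : κ ≤ α / 512)
    (h₁ : (#(B + B₁) : ℝ) ≤ (1 + κ) * #B) (h₂ : (#(B + B₂) : ℝ) ≤ (1 + κ) * #B)
    (hA : α * #B ≤ #A) :
    (∃ x, 257 / 256 * α * #B₁ ≤ #{b ∈ B₁ | x + b ∈ A}) ∨
    (∃ x, 257 / 256 * α * #B₂ ≤ #{b ∈ B₂ | x + b ∈ A}) ∨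
    ∃ x, 127 / 128 * α * #B₁ ≤ #{b ∈ B₁ | x + b ∈ A} ∧
      127 / 128 * α * #B₂ ≤ #{b ∈ B₂ | x + b ∈ A} := by
  by_contra! ⟨hn₁, hn₂, hn⟩
  have p₁ : (0 : ℝ) < #B₁ := by exact_mod_cast card_pos.2 ⟨0, h0₁⟩
  have p₂ : (0 : ℝ) < #B₂ := by exact_mod_cast card_pos.2 ⟨0, h0₂⟩
  have p : (0 : ℝ) < #B := by exact_mod_cast card_pos.2 hB
  have s₁ := sum_card_translate_ge hAB h0₁ hneg₁ h₁
  have s₂ := sum_card_translate_ge hAB h0₂ hneg₂ h₂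
  have e : ∑ x ∈ B, (2 * α - α / 256) ≤
      ∑ x ∈ B, ((#{b ∈ B₁ | x + b ∈ A} : ℝ) / #B₁ + #{b ∈ B₂ | x + b ∈ A} / #B₂) := by
    rw [sum_add_distrib, ← sum_div, ← sum_div, sum_const, nsmul_eq_mul]
    have t₁ : (#A - κ * #B : ℝ) ≤ (∑ x ∈ B, (#{b ∈ B₁ | x + b ∈ A} : ℝ)) / #B₁ := by
      rw [le_div_iff₀ p₁, mul_comm]; exact s₁
    have t₂ : (#A - κ * #B : ℝ) ≤ (∑ x ∈ B, (#{b ∈ B₂ | x + b ∈ A} : ℝ)) / #B₂ := by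
      rw [le_div_iff₀ p₂, mul_comm]; exact s₂
    nlinarith
  obtain ⟨x, -, hx⟩ := exists_le_of_sum_le hB e
  have u₁ : (#{b ∈ B₁ | x + b ∈ A} : ℝ) / #B₁ < 257 / 256 * α := (div_lt_iff₀ p₁).2 (hn₁ x)
  have u₂ : (#{b ∈ B₂ | x + b ∈ A} : ℝ) / #B₂ < 257 / 256 * α := (div_lt_iff₀ p₂).2 (hn₂ x)
  have v₁ : 127 / 128 * α ≤ (#{b ∈ B₁ | x + b ∈ A} : ℝ) / #B₁ := by linarith
  have v₂ : 127 / 128 * α ≤ (#{b ∈ B₂ | x + b ∈ A} : ℝ) / #B₂ := by linarith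
  exact absurd ((le_div_iff₀ p₂).1 v₂) (not_le.2 (hn x ((le_div_iff₀ p₁).1 v₁)))

lemma conv_ind_add_self_le {A : Finset G} (hA : ThreeAPFree (A : Set G)) {a : G} (ha : a ∈ A) :
    conv (ind A) (a + a) ≤ 1 := by
  have h (s : G) : ind A (a + a - s) * ind A s ≤ if s = a then 1 else 0 := by
    split_ifs with hs
    · exact mul_le_one₀ (ind_le_one _ _) (ind_nonneg _ _) (ind_le_one _ _)
    · rw [ind, ind]
      split_ifs with h1 h2 <;> norm_num
      have := hA (a := a + a - s) h1 (b := a) ha (c := s) h2 (by abel)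
      exact hs (by rw [sub_eq_iff_eq_add] at this; exact (add_left_cancel this).symm)
  calc conv (ind A) (a + a) ≤ ∑ s, if s = a then (1 : ℝ) else 0 := sum_le_sum fun s _ => h s
    _ = 1 := by simp

lemma exists_card_ge_of_corr {A Bt : Finset G} (hA : A.Nonempty) {x : G} {c M : ℝ} (hM : 0 ≤ M)
    (h : c ≤ #{b ∈ Bt | M ≤ corr (ind A) (x + b)}) :
    ∃ s, c * M / #A ≤ #{b ∈ Bt | s + b ∈ A} := by
  have hA0 : (0 : ℝ) < #A := by exact_mod_cast hA.card_pos
  have h1 : c * M ≤ ∑ b ∈ Bt, corr (ind A) (x + b) := by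
    calc c * M ≤ #{b ∈ Bt | M ≤ corr (ind A) (x + b)} * M := by gcongr
      _ = ∑ b ∈ Bt with M ≤ corr (ind A) (x + b), M := by rw [sum_const, nsmul_eq_mul]
      _ ≤ ∑ b ∈ Bt with M ≤ corr (ind A) (x + b), corr (ind A) (x + b) :=
        sum_le_sum fun b hb => (mem_filter.1 hb).2
      _ ≤ _ := sum_le_sum_of_subset_of_nonneg (filter_subset _ _)
        fun b _ _ => corr_ind_nonneg _ _
  have h2 : ∑ b ∈ Bt, corr (ind A) (x + b) = ∑ s ∈ A, (#{b ∈ Bt | x + s + b ∈ A} : ℝ) := by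
    simp_rw [card_filter, corr]
    push_cast
    rw [sum_comm (s := A)]
    refine sum_congr rfl fun b _ => ?_
    simp only [ind, mul_ite, mul_one, mul_zero, ← sum_filter]
    rw [sum_filter, sum_filter]
    simp [add_right_comm]
  have h3 : ∑ s ∈ A, c * M / #A ≤ ∑ s ∈ A, (#{b ∈ Bt | x + s + b ∈ A} : ℝ) := by
    rw [sum_const, nsmul_eq_mul, mul_div_cancel₀ _ hA0.ne', ← h2]
    exact h1
  obtain ⟨s, _, hs⟩ := exists_le_of_sum_le hA h3
  exact ⟨x + s, hs⟩

/-- A set with few solutions to `x + y ∈ C` has increased density on a translate of any set nearly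
annihilated by a bounded number of characters. -/
theorem exists_translate_increment {A B C D E Z H X Q Y : Finset G} {α : ℝ} {n a L : ℕ}
    (hn : 1 ≤ n) (ha : a = 2000 * n ^ 3) (hAB : A ⊆ B)
    (hB : ∀ x ∈ B, -x ∈ B) (hE : ∀ x ∈ E, -x ∈ E) (hZ : ∀ x ∈ Z, -x ∈ Z) (hZ0 : (0 : G) ∈ Z)
    (hBZ : (#(B + Z) : ℝ) ≤ (1 + α / 128) * #B) (hDZ : D ⊆ Z) (hEZ : E + E ⊆ Z) (hEZ' : E ⊆ Z)
    (hDE : (#(D + E + E) : ℝ) ≤ 2 * #D) (hCD : C ⊆ D)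
    (hA : (#A : ℝ) = α * #B) (hα : 1 / 2 ^ n ≤ α) (hα1 : α ≤ 1) (hC : 1 / 2 ^ n * (#D : ℝ) ≤ #C)
    (hconv : ∀ c ∈ C, conv (ind A) c ≤ 1) (hlarge : 2 ≤ α ^ 2 * #B)
    (hD0 : D.Nonempty) (hE0 : E.Nonempty)
    (hH : H.Nonempty) (hEH : (#(E + H) : ℝ) ≤ 2 * #E)
    (hX : ∀ j ≤ a, ∀ s s' : Fin j → G, (∀ i, s i ∈ H) → (∀ i, s' i ∈ H) →
      ∀ v ∈ E, v + ∑ i, (s i - s' i) ∈ X)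
    (hXE : (#X : ℝ) ≤ 2 * #E) (hQ : Q.Nonempty)
    (hL : L = (a + 1) * (2 ^ 30 * a ^ 3) + 1)
    (hY : ∀ x ∈ H, ∀ q ∈ Fintype.piFinset (fun _ : Fin (8 * (L + 2) + 1) => Q), x + ∑ i, q i ∈ Y)
    (hYH : (#Y : ℝ) ≤ 2 * #H) :
    ∃ Λ : Finset (AddChar G ℂ), #Λ ≤ 8 * (L + 2) ∧ ∀ (Bt : Finset G) (ρ τ : ℝ),
      Bt.Nonempty → 0 ≤ ρ → 8 * (L + 2) * ρ + τ ≤ 1 / 2 ^ (a + 10) →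
      (∀ b ∈ Bt, ∀ χ ∈ Λ, ‖1 - χ b‖ ≤ ρ) →
      (∀ b ∈ Bt, ∀ χ : AddChar G ℂ, (#Q : ℝ) / 2 < ‖charSum Q χ‖ → ‖1 - χ b‖ ≤ τ) →
      ∃ s, (1 - 3 / 1024) * (65 / 64) * α * #Bt ≤ #{b ∈ Bt | s + b ∈ A} := by
  obtain ⟨A', hA'E, hEA', hsift⟩ := exists_sifted hn hAB hB hE hZ hZ0 hBZ hDZ hEZ hEZ' hDE hCD hA
    hα hα1 hC hconv hlarge hD0 hE0
  have hα0 : 0 < α := lt_of_lt_of_le (by positivity) hα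
  have hB0 : (0 : ℝ) < #B := by
    by_contra! h
    nlinarith [mul_nonneg (sq_nonneg α) (neg_nonneg.2 h)]
  have hA0 : (0 : ℝ) < #A := by rw [hA]; positivity
  have hE1 : (0 : ℝ) < #E := by exact_mod_cast hE0.card_pos
  have hA'0 : A'.Nonempty := by
    rw [nonempty_iff_ne_empty]
    rintro rfl
    rw [card_empty, Nat.cast_zero, mul_zero] at hEA'
    linarith
  have ha11 : 11 ≤ a := by
    have : 1 ≤ n ^ 3 := Nat.one_le_pow _ _ hn
    omega
  set M : ℝ := 65 / 64 * (α ^ 2 * #B) with hM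
  rw [← ha] at hEA'
  obtain ⟨Λ, hΛ, h⟩ := exists_dense_translate (S := {z | M ≤ corr (ind A) z}) ha11 hA'E hE hA'0 hEA'
    (by simpa using hsift) hH hEH hX hXE hQ hL hY hYH
  refine ⟨Λ, hΛ, fun Bt ρ τ h1 h2 h3 h4 h5 => ?_⟩
  obtain ⟨x, hx⟩ := h Bt ρ τ h1 h2 h3 h4 h5
  obtain ⟨s, hs⟩ := exists_card_ge_of_corr (card_pos.1 (by exact_mod_cast hA0)) (M := M)
    (by positivity) (by simpa using hx)
  refine ⟨s, le_of_eq_of_le ?_ hs⟩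
  rw [hM, hA]
  field_simp

end Increment

/-! ### The density increment for Bohr sets -/

section BohrIncrement

variable {G : Type*} [AddCommGroup G] [Fintype G] [DecidableEq G]

/-- The dilate of a finite set by two. -/
def dbl (A : Finset G) : Finset G := A.image fun x => x + x

lemma mem_dbl {A : Finset G} {z : G} : z ∈ dbl A ↔ ∃ x ∈ A, x + x = z := mem_image

lemma dbl_mono {A B : Finset G} (h : A ⊆ B) : dbl A ⊆ dbl B := image_subset_image h

lemma card_dbl (hG : Function.Injective fun x : G => x + x) (A : Finset G) : #(dbl A) = #A :=
  card_image_of_injective _ hG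

lemma dbl_add (A B : Finset G) : dbl (A + B) = dbl A + dbl B := by
  ext z
  simp only [mem_dbl, mem_add]
  constructor
  · rintro ⟨_, ⟨x, hx, y, hy, rfl⟩, rfl⟩
    exact ⟨x + x, ⟨x, hx, rfl⟩, y + y, ⟨y, hy, rfl⟩, by abel⟩
  · rintro ⟨_, ⟨x, hx, rfl⟩, _, ⟨y, hy, rfl⟩, rfl⟩
    exact ⟨x + y, ⟨x, hx, y, hy, rfl⟩, by abel⟩

lemma neg_mem_dbl {A : Finset G} (hA : ∀ x ∈ A, -x ∈ A) {z : G} (hz : z ∈ dbl A) : -z ∈ dbl A := by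
  obtain ⟨x, hx, rfl⟩ := mem_dbl.1 hz
  exact mem_dbl.2 ⟨-x, hA x hx, by abel⟩

variable {Γ : Finset (AddChar G ℂ)}

lemma dbl_bohr_subset {ρ : ℝ} : dbl (bohr Γ ρ) ⊆ bohr Γ (2 * ρ) := fun _ hz => by
  obtain ⟨x, hx, rfl⟩ := mem_dbl.1 hz
  rw [two_mul]
  exact add_mem_bohr hx hx

lemma dbl_bohr_add_subset {ρ ρ' : ℝ} :
    dbl (bohr Γ ρ) + dbl (bohr Γ ρ') ⊆ dbl (bohr Γ (ρ + ρ')) := by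
  rw [← dbl_add]
  exact dbl_mono bohr_add_subset

lemma exists_sum_dbl_bohr {ρ : ℝ} {k : ℕ} {f : Fin k → G} (hf : ∀ i, f i ∈ dbl (bohr Γ ρ)) :
    ∑ i, f i ∈ dbl (bohr Γ (k * ρ)) := by
  choose g hg hgf using fun i => mem_dbl.1 (hf i)
  exact mem_dbl.2 ⟨∑ i, g i, sum_mem_bohr k hg, by rw [← sum_add_distrib]; simp only [hgf]⟩

/-- There is a progression-free subset of density `α` in a regular Bohr set of rank at most `d`. -/
def HasDenseBohr (G : Type*) [AddCommGroup G] [Fintype G] [DecidableEq G] (κ : ℝ) (d : ℕ)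
    (α σ : ℝ) : Prop :=
  ∃ (Γ : Finset (AddChar G ℂ)) (ρ : ℝ) (A : Finset G), #Γ ≤ d ∧ 0 ≤ ρ ∧ 0 < σ ∧
    (#(bohr Γ (ρ + σ)) : ℝ) ≤ (1 + κ) * #(bohr Γ ρ) ∧ A ⊆ bohr Γ ρ ∧
    ThreeAPFree (A : Set G) ∧ α * #(bohr Γ ρ) ≤ #A

lemma HasDenseBohr.mono {κ α σ σ' : ℝ} {d d' : ℕ} (h : HasDenseBohr G κ d α σ) (hd : d ≤ d')
    (hσ' : 0 < σ') (hσ : σ' ≤ σ) : HasDenseBohr G κ d' α σ' := by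
  obtain ⟨Γ, ρ, A, h1, h2, -, h4, h5⟩ := h
  refine ⟨Γ, ρ, A, h1.trans hd, h2, hσ', le_trans ?_ h4, h5⟩
  exact_mod_cast card_le_card (bohr_mono (by linarith))

lemma HasDenseBohr.le_one {κ α σ : ℝ} {d : ℕ} (h : HasDenseBohr G κ d α σ) : α ≤ 1 := by
  obtain ⟨Γ, ρ, A, -, h2, -, -, h5, -, h7⟩ := h
  have : (0 : ℝ) < #(bohr Γ ρ) := by exact_mod_cast (bohr_nonempty h2).card_pos
  have h : (#A : ℝ) ≤ #(bohr Γ ρ) := by exact_mod_cast card_le_card h5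
  nlinarith

lemma threeAPFree_filter {A : Finset G} (hA : ThreeAPFree (A : Set G)) (B : Finset G) {f : G → G}
    (hf : Function.Injective f) (hf' : ∀ a b c, a + c = b + b → f a + f c = f b + f b) :
    ThreeAPFree ((B.filter fun b => f b ∈ A : Finset G) : Set G) := by
  intro a ha b hb c hc h
  have ha := (mem_filter.1 (mem_coe.1 ha)).2
  have hb := (mem_filter.1 (mem_coe.1 hb)).2
  have hc := (mem_filter.1 (mem_coe.1 hc)).2
  exact hf (hA ha hb hc (hf' a b c h))

lemma threeAPFree_filter_add {A : Finset G} (hA : ThreeAPFree (A : Set G)) (B : Finset G) (x : G) :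
    ThreeAPFree ((B.filter fun b => x + b ∈ A : Finset G) : Set G) :=
  threeAPFree_filter hA B (add_right_injective x) fun a b c h => by
    rw [add_add_add_comm, h]; abel

lemma exists_regular {d : ℕ} (hΓ : #Γ ≤ d) {K : ℕ} {c r : ℝ} (hK : 0 < K) (hr : 0 < r)
    (hc : c * (12 * (d + 1) * K) ≤ 1) :
    ∃ ρ, r / 2 ≤ ρ ∧ ρ ≤ r ∧ (#(bohr Γ (ρ + c * r)) : ℝ) ≤ (1 + 1 / K) * #(bohr Γ ρ) := by
  obtain ⟨ρ, h1, h2, h3⟩ := exists_stable_radius hΓ hr hK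
  refine ⟨ρ, h1, h2, le_trans ?_ h3⟩
  have hK' : (0 : ℝ) < K := by exact_mod_cast hK
  have : c * r ≤ r / (12 * (d + 1) * K) := by
    rw [le_div_iff₀ (by positivity)]
    nlinarith
  exact Nat.cast_le.2 (card_le_card (bohr_mono (by linarith)))

lemma card_dbl_bohr_add_le (hG : Function.Injective fun x : G => x + x) {ρ ρ' σ κ : ℝ}
    (hκ : κ ≤ 1) (h : (#(bohr Γ (ρ + σ)) : ℝ) ≤ (1 + κ) * #(bohr Γ ρ)) (hρ : ρ' ≤ σ) :
    (#(dbl (bohr Γ (ρ + ρ'))) : ℝ) ≤ 2 * #(dbl (bohr Γ ρ)) := by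
  rw [card_dbl hG, card_dbl hG]
  have h1 : (#(bohr Γ (ρ + ρ')) : ℝ) ≤ #(bohr Γ (ρ + σ)) := by
    exact_mod_cast card_le_card (bohr_mono (by linarith))
  nlinarith [Nat.cast_nonneg (α := ℝ) #(bohr Γ ρ)]

set_option maxHeartbeats 2000000 in
lemma exists_bohr_increment (hG : Function.Injective fun x : G => x + x) {n a L D : ℕ} {c s α : ℝ}
    {A A₂ : Finset G} {ρ₁ : ℝ} (hn : 1 ≤ n) (ha : a = 2000 * n ^ 3)
    (hL : L = (a + 1) * (2 ^ 30 * a ^ 3) + 1) (hD : #Γ + 8 * (L + 2) ≤ D) (hc0 : 0 < c)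
    (hc : c * (12 * (D + 1) * 2 ^ (a + 14)) ≤ 1) (hs : 0 < s) (hsc : s ≤ c)
    (hst₁ : (#(bohr Γ (ρ₁ + s)) : ℝ) ≤ (1 + 1 / 2 ^ (a + 14)) * #(bohr Γ ρ₁))
    (hAB : A ⊆ bohr Γ ρ₁) (hfree : ThreeAPFree (A : Set G))
    (hA : (#A : ℝ) = α * #(bohr Γ ρ₁)) (hα : 1 / 2 ^ n ≤ α) (hα1 : α ≤ 1)
    {ρ₂ : ℝ} (hρ₂0 : 0 ≤ ρ₂) (hρ₂ : ρ₂ ≤ c * s)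
    (hst₂ : (#(bohr Γ (ρ₂ + c * (c * s))) : ℝ) ≤ (1 + 1 / 2 ^ (a + 14)) * #(bohr Γ ρ₂))
    (hA₂A : A₂ ⊆ A) (hA₂B : A₂ ⊆ bohr Γ ρ₂) (hA₂ : 1 / 2 ^ n * (#(bohr Γ ρ₂) : ℝ) ≤ #A₂)
    (hlarge : 2 ≤ α ^ 2 * #(bohr Γ ρ₁)) :
    HasDenseBohr G (1 / 2 ^ (a + 14)) (#Γ + 8 * (L + 2)) (81 / 80 * α) (c ^ 9 * s) := by
  have ha1 : 2000 ≤ a := by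
    have : 1 ≤ n ^ 3 := Nat.one_le_pow _ _ hn
    omega
  set l := 8 * (L + 2) + 1 with hl
  have hDl : (l : ℝ) ≤ D + 1 := by exact_mod_cast (by omega : l ≤ D + 1)
  have hD0 : (1 : ℝ) ≤ D + 1 := by linarith [Nat.cast_nonneg (α := ℝ) D]
  have hP : 2 * (a : ℝ) + 2 ≤ 2 ^ (a + 14) := by
    have : (a : ℝ) ≤ 2 ^ a := by exact_mod_cast (Nat.lt_two_pow_self).le
    have : (1 : ℝ) ≤ 2 ^ a := one_le_pow₀ (by norm_num)
    rw [pow_add]; linarith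
  have hP1 : (1 : ℝ) ≤ 2 ^ (a + 14) := one_le_pow₀ (by norm_num)
  set κ : ℝ := 1 / 2 ^ (a + 14) with hκ
  have hκ0 : 0 < κ := by positivity
  have hκ1 : κ ≤ 1 := by rw [hκ]; exact div_le_one_of_le₀ hP1 (by positivity)
  have hcκ : c * (12 * (D + 1)) ≤ κ := by
    rw [hκ, le_div_iff₀ (by positivity)]; linarith
  have hcD : c ≤ c * (D + 1) := le_mul_of_one_le_right hc0.le hD0
  have hc12 : c ≤ 1 / 12 := by linarith
  have hca : c * (2 * a + 2) ≤ 1 := by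
    refine (mul_le_mul_of_nonneg_left (hP.trans ?_) hc0.le).trans hc
    exact le_mul_of_one_le_left (by positivity) (by linarith)
  have hcl : c * l ≤ κ / 12 := by
    have := mul_le_mul_of_nonneg_left hDl hc0.le
    linarith
  have hcs {t : ℝ} (ht : 0 < t) : c * t ≤ t / 12 := by
    have := mul_le_mul_of_nonneg_right hc12 ht.le
    linarith
  have hnα : κ ≤ α / 128 := by
    refine le_trans ?_ (div_le_div_of_nonneg_right hα (by norm_num))
    rw [hκ, div_div]
    refine one_div_le_one_div_of_le (by positivity) ?_
    rw [show (128 : ℝ) = 2 ^ 7 by norm_num, ← pow_add]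
    have : n ≤ n ^ 3 := Nat.le_self_pow (by norm_num) n
    exact pow_le_pow_right₀ (by norm_num) (by omega)
  have hreg (Γ' : Finset (AddChar G ℂ)) (hΓ' : #Γ' ≤ D) (r : ℝ) (hr : 0 < r) :
      ∃ ρ, r / 2 ≤ ρ ∧ ρ ≤ r ∧ (#(bohr Γ' (ρ + c * r)) : ℝ) ≤ (1 + κ) * #(bohr Γ' ρ) := by
    have := exists_regular hΓ' (K := 2 ^ (a + 14)) (c := c) (by positivity) hr
      (by push_cast; exact hc)
    push_cast at this
    exact this
  set s₂ := c * (c * s) with hs₂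
  have hs₂0 : 0 < s₂ := by positivity
  have hs₂s : s₂ ≤ s / 144 := by
    have := hcs (mul_pos hc0 hs)
    have := hcs hs
    linarith
  have hρ₂s : ρ₂ ≤ s / 12 := hρ₂.trans (hcs hs)
  obtain ⟨ρ₃, h₃, h₃', hst₃⟩ := hreg Γ (by omega) (c * s₂) (by positivity)
  set s₃ := c * (c * s₂) with hs₃
  have hs₃0 : 0 < s₃ := by positivity
  have hρ₃0 : 0 < ρ₃ := lt_of_lt_of_le (by positivity) h₃
  have hρ₃s : ρ₃ ≤ s₂ / 12 := h₃'.trans (hcs hs₂0)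
  obtain ⟨ρ₄, h₄, h₄', hst₄⟩ := hreg Γ (by omega) (c * s₃) (by positivity)
  set s₄ := c * (c * s₃) with hs₄
  have hs₄0 : 0 < s₄ := by positivity
  have hρ₄0 : 0 < ρ₄ := lt_of_lt_of_le (by positivity) h₄
  have hρ₄s : ρ₄ * (2 * a + 2) ≤ s₃ := by
    have h1 := mul_le_mul_of_nonneg_right h₄' (by positivity : (0 : ℝ) ≤ 2 * a + 2)
    have h2 := mul_le_mul_of_nonneg_right hca hs₃0.le
    linarith
  obtain ⟨ρ₅, h₅, h₅', hst₅⟩ := hreg Γ (by omega) (c * s₄) (by positivity)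
  set s₅ := c * (c * s₄) with hs₅
  have hs₅0 : 0 < s₅ := by positivity
  have hρ₅0 : 0 < ρ₅ := lt_of_lt_of_le (by positivity) h₅
  have hρ₅s : l * ρ₅ ≤ s₄ := by
    have h1 := mul_le_mul_of_nonneg_left h₅' (Nat.cast_nonneg (α := ℝ) l)
    have h2 := mul_le_mul_of_nonneg_right (hcl.trans (by linarith : κ / 12 ≤ 1)) hs₄0.le
    linarith
  have hsub (s t : G) (x y : ℝ) (hs : s ∈ dbl (bohr Γ x)) (ht : t ∈ dbl (bohr Γ y)) :
      s + t ∈ dbl (bohr Γ (x + y)) := dbl_bohr_add_subset (add_mem_add hs ht)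
  have hneg (x : ℝ) : ∀ z ∈ dbl (bohr Γ x), -z ∈ dbl (bohr Γ x) :=
    fun z hz => neg_mem_dbl (fun y hy => neg_mem_bohr hy) hz
  have hne (x : ℝ) (hx : 0 ≤ x) : (dbl (bohr Γ x)).Nonempty := (bohr_nonempty hx).image _
  have hρ₁ne : (bohr Γ ρ₁).Nonempty := by
    rw [nonempty_iff_ne_empty]
    intro h
    rw [h] at hlarge
    norm_num at hlarge
  have hcast {S T : Finset G} (h : S ⊆ T) : (#S : ℝ) ≤ #T := by exact_mod_cast card_le_card h
  obtain ⟨Λ, hΛ, h⟩ := exists_translate_increment (A := A) (B := bohr Γ ρ₁) (C := dbl A₂)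
    (D := dbl (bohr Γ ρ₂)) (E := dbl (bohr Γ ρ₃)) (Z := bohr Γ s) (H := dbl (bohr Γ ρ₄))
    (X := dbl (bohr Γ (ρ₃ + s₃))) (Q := dbl (bohr Γ ρ₅)) (Y := dbl (bohr Γ (ρ₄ + s₄)))
    (α := α) hn ha hAB (fun x hx => neg_mem_bohr hx) (hneg ρ₃) (fun x hx => neg_mem_bohr hx)
    (zero_mem_bohr hs.le)
    (by
      refine (hcast bohr_add_subset).trans (hst₁.trans ?_)
      gcongr)
    (dbl_bohr_subset.trans (bohr_mono (by linarith)))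
    (dbl_bohr_add_subset.trans (dbl_bohr_subset.trans (bohr_mono (by linarith))))
    (dbl_bohr_subset.trans (bohr_mono (by linarith)))
    (by
      refine le_trans ?_ (card_dbl_bohr_add_le hG (ρ := ρ₂) (ρ' := ρ₃ + ρ₃) hκ1 hst₂ (by linarith))
      refine hcast ?_
      rw [← add_assoc]
      exact (add_subset_add_right dbl_bohr_add_subset).trans dbl_bohr_add_subset)
    (dbl_mono hA₂B) hA hα hα1 (by rw [card_dbl hG, card_dbl hG]; exact hA₂)
    (by
      intro z hz
      obtain ⟨x, hx, rfl⟩ := mem_dbl.1 hz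
      exact conv_ind_add_self_le hfree (hA₂A hx))
    hlarge (hne _ hρ₂0) (hne _ hρ₃0.le) (hne _ hρ₄0.le)
    ((hcast dbl_bohr_add_subset).trans
      (card_dbl_bohr_add_le hG (ρ := ρ₃) (ρ' := ρ₄) hκ1 hst₃ (by
        have := mul_nonneg hρ₄0.le (Nat.cast_nonneg (α := ℝ) a)
        linarith)))
    (by
      intro j hj s s' hs hs' v hv
      have h1 (i) : s i - s' i ∈ dbl (bohr Γ (ρ₄ + ρ₄)) := by
        rw [sub_eq_add_neg]
        exact hsub _ _ _ _ (hs i) (hneg _ _ (hs' i))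
      refine dbl_mono (bohr_mono ?_) (hsub _ _ _ _ hv (exists_sum_dbl_bohr h1))
      have : (j : ℝ) ≤ a := by exact_mod_cast hj
      have := mul_le_mul_of_nonneg_left this hρ₄0.le
      linarith)
    (card_dbl_bohr_add_le hG (ρ := ρ₃) (ρ' := s₃) hκ1 hst₃ le_rfl)
    (hne _ hρ₅0.le) hL
    (by
      intro x hx q hq
      refine dbl_mono (bohr_mono ?_)
        (hsub _ _ _ _ hx (exists_sum_dbl_bohr (Fintype.mem_piFinset.1 hq)))
      linarith)
    (card_dbl_bohr_add_le hG (ρ := ρ₄) (ρ' := s₄) hκ1 hst₄ le_rfl)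
  classical
  set Γ' := Γ ∪ Λ.image (fun χ => χ * χ) with hΓ'
  have hΓ'c : #Γ' ≤ #Γ + 8 * (L + 2) :=
    (card_union_le _ _).trans (Nat.add_le_add_left (card_image_le.trans hΛ) _)
  obtain ⟨ρ₆, h₆, h₆', hst₆⟩ := hreg Γ' (hΓ'c.trans hD) s₅ hs₅0
  have hρ₆0 : 0 < ρ₆ := lt_of_lt_of_le (by positivity) h₆
  have hs₅c : s₅ ≤ c := by
    have h1 := hcs (mul_pos hc0 hs₄0)
    have h2 := hcs hs₄0
    have h3 := hcs (mul_pos hc0 hs₃0)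
    have h4 := hcs hs₃0
    have h5 := hcs (mul_pos hc0 hs₂0)
    have h6 := hcs hs₂0
    linarith
  obtain ⟨x, hx⟩ := h (dbl (bohr Γ' ρ₆)) ρ₆ (4 * κ) ((bohr_nonempty hρ₆0.le).image _) hρ₆0.le
    (by
      have h1 : 8 * ((L : ℝ) + 2) * ρ₆ ≤ c * l := by
        have : (l : ℝ) = 8 * (L + 2) + 1 := by rw [hl]; push_cast; ring
        have h2 := mul_le_mul_of_nonneg_left (h₆'.trans hs₅c)
          (by positivity : 0 ≤ 8 * ((L : ℝ) + 2))
        rw [this]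
        linarith
      have h2 : (1 : ℝ) / 2 ^ (a + 10) = 16 * κ := by
        rw [hκ, pow_add, pow_add]; field_simp; norm_num
      rw [h2]
      linarith)
    (by
      intro b hb χ hχ
      obtain ⟨y, hy, rfl⟩ := mem_dbl.1 hb
      have := mem_bohr.1 hy (χ * χ) (mem_union_right _ (mem_image_of_mem _ hχ))
      rwa [AddChar.map_add_eq_mul, ← AddChar.mul_apply])
    (by
      intro b hb χ hχ
      refine norm_one_sub_le_of_charSum (hne _ hρ₅0.le) (D := dbl (bohr Γ' ρ₆)) ?_ ?_ hb hχ
      · exact mem_dbl.2 ⟨0, zero_mem_bohr hρ₆0.le, add_zero 0⟩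
      · have h1 : dbl (bohr Γ ρ₅) + dbl (bohr Γ' ρ₆) ⊆ dbl (bohr Γ (ρ₅ + s₅)) :=
          (add_subset_add_left (dbl_mono ((bohr_anti subset_union_left).trans
            (bohr_mono h₆')))).trans dbl_bohr_add_subset
        refine (hcast h1).trans ?_
        rw [card_dbl hG, card_dbl hG]
        exact hst₅)
  have hinj : Function.Injective fun y : G => x + (y + y) := fun y z h => hG (add_left_cancel h)
  refine ⟨Γ', ρ₆, {y ∈ bohr Γ' ρ₆ | x + (y + y) ∈ A}, hΓ'c, hρ₆0.le, by positivity, ?_,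
    filter_subset _ _, ?_, ?_⟩
  · convert hst₆ using 4
    rw [hs₅, hs₄, hs₃, hs₂]; ring
  · refine threeAPFree_filter hfree _ hinj fun u v w h => ?_
    calc x + (u + u) + (x + (w + w)) = x + x + (u + w) + (u + w) := by abel
      _ = _ := by rw [h]; abel
  · have h1 : #{b ∈ dbl (bohr Γ' ρ₆) | x + b ∈ A} =
        #{y ∈ bohr Γ' ρ₆ | x + (y + y) ∈ A} := by
      rw [dbl, filter_image, card_image_of_injective _ hG]
    rw [h1, card_dbl hG] at hx
    refine le_trans ?_ hx
    have hα0 : 0 ≤ α := le_trans (by positivity) hα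
    gcongr
    norm_num

end BohrIncrement

/-! ### Iteration -/

section Iteration

variable {G : Type*} [AddCommGroup G] [Fintype G] [DecidableEq G]

lemma HasDenseBohr.increment (hG : Function.Injective fun x : G => x + x) {n a L D d : ℕ}
    {c α σ : ℝ} (ha : a = 2000 * (n + 1) ^ 3) (hL : L = (a + 1) * (2 ^ 30 * a ^ 3) + 1)
    (hD : d + 8 * (L + 2) ≤ D) (hc0 : 0 < c) (hc : c * (12 * (D + 1) * 2 ^ (a + 14)) ≤ 1)
    (hσc : σ ≤ c) (hα : 1 / 2 ^ n ≤ α)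
    (hsize : ∀ Γ : Finset (AddChar G ℂ), #Γ ≤ D → (2 : ℝ) ^ (2 * n + 3) ≤ #(bohr Γ (σ / 2)))
    (h : HasDenseBohr G (1 / 2 ^ (a + 14)) d α σ) :
    HasDenseBohr G (1 / 2 ^ (a + 14)) (d + 8 * (L + 2)) (257 / 256 * α) (c ^ 10 * σ) := by
  have hα1 := h.le_one
  obtain ⟨Γ, ρ, A, hΓ, hρ, hσ, hst, hAB, hfree, hA⟩ := h
  have hna : n + 10 ≤ a + 14 := by
    have : n + 1 ≤ (n + 1) ^ 3 := Nat.le_self_pow (by norm_num) _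
    omega
  have hα0 : 0 < α := lt_of_lt_of_le (by positivity) hα
  have hκα : (1 : ℝ) / 2 ^ (a + 14) ≤ α / 512 := by
    refine le_trans ?_ (div_le_div_of_nonneg_right hα (by norm_num))
    rw [div_div]
    refine one_div_le_one_div_of_le (by positivity) ?_
    rw [show (512 : ℝ) = 2 ^ 9 by norm_num, ← pow_add]
    exact pow_le_pow_right₀ (by norm_num) (by omega)
  have hc12 : c ≤ 1 / 12 := by
    have h1 : (1 : ℝ) ≤ (D + 1) * 2 ^ (a + 14) :=
      one_le_mul_of_one_le_of_one_le (by linarith [Nat.cast_nonneg (α := ℝ) D])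
        (one_le_pow₀ (by norm_num))
    have h2 := mul_le_mul_of_nonneg_left h1 hc0.le
    linarith
  have hcσ : c * σ ≤ σ / 12 := by
    have := mul_le_mul_of_nonneg_right hc12 hσ.le
    linarith
  have hreg (r : ℝ) (hr : 0 < r) : ∃ ρ, r / 2 ≤ ρ ∧ ρ ≤ r ∧
      (#(bohr Γ (ρ + c * r)) : ℝ) ≤ (1 + 1 / 2 ^ (a + 14)) * #(bohr Γ ρ) := by
    have := exists_regular (hΓ.trans (by omega : d ≤ D)) (K := 2 ^ (a + 14)) (c := c)
      (by positivity) hr (by push_cast; exact hc)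
    push_cast at this
    exact this
  obtain ⟨ρ₁, h₁, h₁', hst₁⟩ := hreg σ hσ
  obtain ⟨ρ₂, h₂, h₂', hst₂⟩ := hreg (c * (c * σ)) (by positivity)
  have hρ₁0 : 0 < ρ₁ := by linarith
  have hρ₂0 : 0 < ρ₂ := lt_of_lt_of_le (by positivity) h₂
  have hccσ : c * (c * σ) ≤ c * σ := mul_le_of_le_one_left (by positivity) (by linarith)
  have hB₁ : (0 : ℝ) < #(bohr Γ ρ₁) := by exact_mod_cast (bohr_nonempty hρ₁0.le).card_pos
  have hstable {ρ' : ℝ} (h : ρ' ≤ σ) : (#(bohr Γ ρ + bohr Γ ρ') : ℝ) ≤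
      (1 + 1 / 2 ^ (a + 14)) * #(bohr Γ ρ) := by
    refine le_trans ?_ hst
    exact Nat.cast_le.2 (card_le_card (bohr_add_subset.trans (bohr_mono (by linarith))))
  have hpow {k : ℕ} (hk : k ≤ 10) : c ^ 10 ≤ c ^ k :=
    pow_le_pow_of_le_one hc0.le (by linarith) hk
  rcases exists_translate_dense hAB (bohr_nonempty hρ) (zero_mem_bohr hρ₁0.le)
    (fun x hx => neg_mem_bohr hx) (zero_mem_bohr hρ₂0.le) (fun x hx => neg_mem_bohr hx) hκα
    (hstable h₁') (hstable (by linarith)) hA with ⟨x, hx⟩ | ⟨x, hx⟩ | ⟨x, hx₁, hx₂⟩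
  · refine HasDenseBohr.mono (d := d) (σ := c * σ) ?_ (by omega) (by positivity) ?_
    · exact ⟨Γ, ρ₁, _, hΓ, hρ₁0.le, by positivity, hst₁, filter_subset _ _,
        threeAPFree_filter_add hfree _ x, hx⟩
    · have := hpow (k := 1) (by norm_num)
      rw [pow_one] at this
      gcongr
  · refine HasDenseBohr.mono (d := d) (σ := c * (c * (c * σ))) ?_ (by omega) (by positivity) ?_
    · exact ⟨Γ, ρ₂, _, hΓ, hρ₂0.le, by positivity, hst₂, filter_subset _ _,
        threeAPFree_filter_add hfree _ x, hx⟩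
    · calc c ^ 10 * σ ≤ c ^ 3 * σ := by gcongr ?_ * σ; exact hpow (by norm_num)
        _ = _ := by ring
  · set A₁ := {b ∈ bohr Γ ρ₁ | x + b ∈ A} with hA₁
    set β : ℝ := #A₁ / #(bohr Γ ρ₁) with hβ
    have hβα : 127 / 128 * α ≤ β := (le_div_iff₀ hB₁).2 hx₁
    have hβn : 1 / 2 ^ (n + 1) ≤ 127 / 128 * α := by
      rw [pow_succ, ← div_div]; linarith
    have hβ1 : β ≤ 1 := div_le_one_of_le₀
      (Nat.cast_le.2 (card_le_card (filter_subset _ _))) hB₁.le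
    have hinc := exists_bohr_increment (Γ := Γ) hG (n := n + 1) (a := a) (L := L) (D := D) (c := c)
      (s := c * σ) (α := β) (A := A₁) (A₂ := {b ∈ bohr Γ ρ₂ | x + b ∈ A}) (ρ₁ := ρ₁) (by omega) ha
      hL (by omega) hc0 hc (by positivity) (by linarith) hst₁ (filter_subset _ _)
      (threeAPFree_filter_add hfree _ x) (by rw [hβ, div_mul_cancel₀ _ hB₁.ne'])
      (hβn.trans hβα) hβ1 hρ₂0.le h₂' hst₂
      (filter_subset_filter _ (bohr_mono (by linarith))) (filter_subset _ _)
      ((mul_le_mul_of_nonneg_right hβn (Nat.cast_nonneg _)).trans hx₂)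
      (by
        have h1 : (2 : ℝ) ^ (2 * n + 3) ≤ #(bohr Γ ρ₁) :=
          (hsize Γ (by omega)).trans (Nat.cast_le.2 (card_le_card (bohr_mono h₁)))
        calc (2 : ℝ) = (1 / 2 ^ (n + 1)) ^ 2 * 2 ^ (2 * n + 3) := by
              rw [div_pow, ← pow_mul, one_pow, show 2 * n + 3 = (n + 1) * 2 + 1 by ring, pow_succ]
              field_simp
          _ ≤ β ^ 2 * #(bohr Γ ρ₁) := by
            gcongr
            exact hβn.trans hβα)
    have hd : HasDenseBohr G (1 / 2 ^ (a + 14)) (d + 8 * (L + 2)) (81 / 80 * β) (c ^ 10 * σ) :=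
      hinc.mono (by omega) (by positivity) (by rw [pow_succ]; linarith)
    obtain ⟨Γ', ρ', A', p1, p2, p3, p4, p5, p6, p7⟩ := hd
    exact ⟨Γ', ρ', A', p1, p2, p3, p4, p5, p6,
      (mul_le_mul_of_nonneg_right (by linarith) (Nat.cast_nonneg _)).trans p7⟩

/-- A group of odd order containing a progression-free set of density `2⁻ⁿ` has order less than
`2 ^ boundExponent n`. Here `N` is the number of density increments, and `D` bounds the rank. -/
def boundExponent (n : ℕ) : ℕ :=
  let a := 2000 * (n + 1) ^ 3
  let L := (a + 1) * (2 ^ 30 * a ^ 3) + 1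
  let N := 256 * n + 1
  let D := N * (8 * (L + 2))
  2 * n + 3 + 6 * D * ((D + a + 18) * (10 * N + 1) + 2)

lemma two_pow_lt_pow (n : ℕ) : (1 : ℝ) < (257 / 256) ^ (256 * n + 1) * (1 / 2 ^ n) := by
  have h : (2 : ℝ) ≤ (257 / 256) ^ 256 := by
    have := one_add_mul_le_pow (a := (1 / 256 : ℝ)) (by norm_num) 256
    norm_num at this ⊢
  calc (1 : ℝ) < 257 / 256 := by norm_num
    _ = 2 ^ n * (257 / 256) * (1 / 2 ^ n) := by field_simp
    _ ≤ ((257 / 256) ^ 256) ^ n * (257 / 256) * (1 / 2 ^ n) := by gcongr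
    _ = _ := by rw [← pow_mul, ← pow_succ]

/-- **The Kelley–Meka theorem**, with an unspecified exponent. -/
theorem card_lt_of_threeAPFree (hG : Function.Injective fun x : G => x + x) {A : Finset G}
    (hA : ThreeAPFree (A : Set G)) {n : ℕ} (h : Fintype.card G ≤ 2 ^ n * #A) :
    Fintype.card G < 2 ^ boundExponent n := by
  by_contra! hcard
  obtain ⟨a, ha⟩ : ∃ a, a = 2000 * (n + 1) ^ 3 := ⟨_, rfl⟩
  obtain ⟨L, hL⟩ : ∃ L, L = (a + 1) * (2 ^ 30 * a ^ 3) + 1 := ⟨_, rfl⟩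
  obtain ⟨N, hN⟩ : ∃ N, N = 256 * n + 1 := ⟨_, rfl⟩
  obtain ⟨D, hD⟩ : ∃ D, D = N * (8 * (L + 2)) := ⟨_, rfl⟩
  obtain ⟨e, he⟩ : ∃ e, e = D + a + 18 := ⟨_, rfl⟩
  have hF : boundExponent n = 2 * n + 3 + 6 * D * (e * (10 * N + 1) + 2) := by
    rw [he, hD, hN, hL, ha]; rfl
  rw [hF] at hcard
  set c : ℝ := 1 / 2 ^ e with hc
  have hc0 : 0 < c := by positivity
  have hcD : c * (12 * (D + 1) * 2 ^ (a + 14)) ≤ 1 := by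
    rw [hc, div_mul_eq_mul_div, one_mul]
    refine div_le_one_of_le₀ ?_ (by positivity)
    have h1 : (D : ℝ) + 1 ≤ 2 ^ D := by exact_mod_cast Nat.lt_two_pow_self
    calc (12 : ℝ) * (D + 1) * 2 ^ (a + 14) ≤ 2 ^ 4 * 2 ^ D * 2 ^ (a + 14) := by
          gcongr; norm_num
      _ = 2 ^ e := by rw [he]; ring
  have hc1 : c ≤ 1 := div_le_one_of_le₀ (one_le_pow₀ (by norm_num)) (by positivity)
  have hsize {i : ℕ} (hi : i ≤ N) (Γ : Finset (AddChar G ℂ)) (hΓ : #Γ ≤ D) :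
      (2 : ℝ) ^ (2 * n + 3) ≤ #(bohr Γ (c ^ (10 * i) * c / 2)) := by
    have h1 : 1 / 2 ^ (e * (10 * N + 1) + 1) ≤ c ^ (10 * i) * c / 2 := by
      calc 1 / 2 ^ (e * (10 * N + 1) + 1) = c ^ (10 * N + 1) / 2 := by
            rw [hc, div_pow, one_pow, ← pow_mul, div_div, ← pow_succ]
        _ ≤ _ := by
          rw [← pow_succ]
          gcongr ?_ / 2
          exact pow_le_pow_of_le_one hc0.le hc1 (by omega)
    have h2 := card_le_card_bohr Γ (e * (10 * N + 1) + 1)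
    have h3 : 2 ^ (2 * n + 3) * 2 ^ (6 * D * (e * (10 * N + 1) + 2)) ≤
        2 ^ (6 * D * (e * (10 * N + 1) + 2)) * #(bohr Γ (1 / 2 ^ (e * (10 * N + 1) + 1))) := by
      rw [← pow_add]
      refine hcard.trans (h2.trans ?_)
      gcongr
      norm_num
    rw [mul_comm] at h3
    have h4 := Nat.le_of_mul_le_mul_left h3 (by positivity)
    exact_mod_cast h4.trans (card_le_card (bohr_mono h1))
  have main : ∀ i ≤ N, HasDenseBohr G (1 / 2 ^ (a + 14)) (i * (8 * (L + 2)))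
      ((257 / 256) ^ i * (1 / 2 ^ n)) (c ^ (10 * i) * c) := by
    intro i
    induction i with
    | zero =>
      intro _
      have hb (ρ : ℝ) : bohr (∅ : Finset (AddChar G ℂ)) ρ = univ := by ext; simp [mem_bohr]
      refine ⟨∅, 0, A, by simp, le_rfl, by positivity, ?_, by simp [hb], hA, ?_⟩
      · rw [hb, hb]
        exact le_mul_of_one_le_left (Nat.cast_nonneg _) (by simp)
      · rw [hb, card_univ, pow_zero, one_mul, div_mul_eq_mul_div, one_mul,
          div_le_iff₀' (by positivity)]
        exact_mod_cast h
    | succ i ih =>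
      intro hi
      have h1 := (ih (by omega)).increment hG ha hL (D := D)
        (by rw [hD, ← Nat.succ_mul]; exact Nat.mul_le_mul_right _ hi) hc0 hcD
        (mul_le_of_le_one_left hc0.le (pow_le_one₀ hc0.le hc1))
        (le_mul_of_one_le_left (by positivity) (one_le_pow₀ (by norm_num)))
        (hsize (by omega))
      convert h1 using 1 <;> ring
  have h1 := (main N le_rfl).le_one
  rw [hN] at h1
  exact absurd h1 (not_le.2 (two_pow_lt_pow n))

end Iteration

/-! ### Sets of natural numbers -/

section Final

open Filter

/-- Functions of at most polynomial growth. -/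
def PolyBounded (f : ℕ → ℕ) : Prop := ∃ C k : ℕ, ∀ n, f n ≤ C * (n + 1) ^ k

lemma PolyBounded.const (c : ℕ) : PolyBounded fun _ => c := ⟨c, 0, fun n => by simp⟩

lemma PolyBounded.id : PolyBounded fun n => n := ⟨1, 1, fun n => by simp⟩

lemma PolyBounded.add {f g : ℕ → ℕ} (hf : PolyBounded f) (hg : PolyBounded g) :
    PolyBounded fun n => f n + g n := by
  obtain ⟨C, k, hf⟩ := hf
  obtain ⟨C', k', hg⟩ := hg
  refine ⟨C + C', k + k', fun n => ?_⟩
  rw [add_mul]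
  refine add_le_add ((hf n).trans ?_) ((hg n).trans ?_) <;>
  · gcongr <;> omega

lemma PolyBounded.mul {f g : ℕ → ℕ} (hf : PolyBounded f) (hg : PolyBounded g) :
    PolyBounded fun n => f n * g n := by
  obtain ⟨C, k, hf⟩ := hf
  obtain ⟨C', k', hg⟩ := hg
  refine ⟨C * C', k + k', fun n => ?_⟩
  calc f n * g n ≤ (C * (n + 1) ^ k) * (C' * (n + 1) ^ k') := Nat.mul_le_mul (hf n) (hg n)
    _ = _ := by ring

lemma PolyBounded.pow {f : ℕ → ℕ} (hf : PolyBounded f) (k : ℕ) : PolyBounded fun n => f n ^ k := by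
  induction k with
  | zero => simpa using PolyBounded.const 1
  | succ k ih => simpa only [pow_succ] using ih.mul hf

lemma polyBounded_boundExponent : PolyBounded boundExponent := by
  have ha : PolyBounded fun n => 2000 * (n + 1) ^ 3 :=
    (PolyBounded.const _).mul ((PolyBounded.id.add (.const _)).pow _)
  have hL : PolyBounded fun n => (2000 * (n + 1) ^ 3 + 1) * (2 ^ 30 * (2000 * (n + 1) ^ 3) ^ 3) + 1 :=
    ((ha.add (.const _)).mul ((PolyBounded.const _).mul (ha.pow _))).add (.const _)
  have hN : PolyBounded fun n => 256 * n + 1 :=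
    ((PolyBounded.const _).mul .id).add (.const _)
  have hD := hN.mul ((PolyBounded.const 8).mul (hL.add (.const 2)))
  exact (((PolyBounded.const _).mul .id).add (.const _)).add
    (((PolyBounded.const _).mul hD).mul
      ((((hD.add ha).add (.const _)).mul (((PolyBounded.const _).mul hN).add (.const _))).add
        (.const _)))

lemma PolyBounded.eventually_le {f : ℕ → ℕ} (hf : PolyBounded f) :
    ∀ᶠ j in atTop, f (2 * Nat.log 2 (j + 2) + 2) ≤ j + 2 := by
  obtain ⟨C, k, hf⟩ := hf
  have h1 : Tendsto (fun t : ℕ => (t : ℝ) ^ k / 2 ^ t) atTop (nhds 0) :=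
    tendsto_pow_const_div_const_pow_of_one_lt k (by norm_num)
  have h0 : (0 : ℝ) < 1 / (C * 5 ^ k + 1) := by positivity
  have h2 : ∀ᶠ t : ℕ in atTop, C * (2 * t + 2 + 1) ^ k ≤ 2 ^ t := by
    filter_upwards [h1.eventually_lt_const h0,
      eventually_ge_atTop 1] with t ht ht1
    rw [div_lt_div_iff₀ (by positivity) (by positivity), one_mul] at ht
    have h3 : t ^ k * (C * 5 ^ k + 1) ≤ 2 ^ t := by exact_mod_cast ht.le
    calc C * (2 * t + 2 + 1) ^ k ≤ C * (5 * t) ^ k := by gcongr; omega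
      _ ≤ t ^ k * (C * 5 ^ k + 1) := by rw [mul_pow]; nlinarith [Nat.zero_le (t ^ k)]
      _ ≤ 2 ^ t := h3
  have h3 : Tendsto (fun j => Nat.log 2 (j + 2)) atTop atTop := by
    refine tendsto_atTop.2 fun b => ?_
    filter_upwards [eventually_ge_atTop (2 ^ b)] with j hj
    exact (Nat.le_log_iff_pow_le (by norm_num) (by omega)).2 (by omega)
  filter_upwards [h3.eventually h2] with j hj
  exact (hf _).trans (hj.trans (Nat.pow_log_le_self 2 (by omega)))

lemma injective_add_self_zmod (m : ℕ) : Function.Injective fun x : ZMod (2 * m + 1) => x + x := by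
  have h : ((2 : ℕ) : ZMod (2 * m + 1)) * ((m + 1 : ℕ) : ZMod (2 * m + 1)) = 1 := by
    have : ((2 * m + 1 : ℕ) : ZMod (2 * m + 1)) = 0 := ZMod.natCast_self _
    push_cast at this ⊢
    linear_combination this
  intro x y hxy
  push_cast at h
  simp only at hxy
  linear_combination (m + 1 : ZMod (2 * m + 1)) * hxy - (x - y) * h

open Classical in
/-- A set of natural numbers less than `2 ^ (j + 1)` without three-term progressions has at most
`8 * 2 ^ j / j ^ 2` elements, once `j` is large. -/
lemma eventually_card_block_le :
    ∀ᶠ j : ℕ in atTop, ∀ S : Finset ℕ, (∀ m ∈ S, m < 2 ^ (j + 1)) → ThreeAPFree (S : Set ℕ) →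
      (#S : ℝ) / 2 ^ j ≤ 8 * (1 / (j : ℝ) ^ 2) := by
  filter_upwards [polyBounded_boundExponent.eventually_le, eventually_ge_atTop 1]
    with j hj hj1 S hS hfree
  set n := 2 * Nat.log 2 (j + 2) + 2 with hn
  set M := 2 * 2 ^ (j + 1) + 1 with hM
  have hinj : Set.InjOn (Nat.cast : ℕ → ZMod M) S := by
    intro x hx y hy h
    rw [ZMod.natCast_eq_natCast_iff] at h
    exact Nat.ModEq.eq_of_lt_of_lt h (by have := hS x hx; omega) (by have := hS y hy; omega)
  have hcard : #(S.image (Nat.cast : ℕ → ZMod M)) = #S := card_image_of_injOn hinj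
  have hfree' : ThreeAPFree ((S.image (Nat.cast : ℕ → ZMod M) : Finset (ZMod M)) : Set (ZMod M)) := by
    intro a ha b hb c hc h
    obtain ⟨x, hx, rfl⟩ := mem_image.1 (mem_coe.1 ha)
    obtain ⟨y, hy, rfl⟩ := mem_image.1 (mem_coe.1 hb)
    obtain ⟨z, hz, rfl⟩ := mem_image.1 (mem_coe.1 hc)
    have hx' := hS x hx
    have hy' := hS y hy
    have hz' := hS z hz
    norm_cast at h
    rw [ZMod.natCast_eq_natCast_iff] at h
    exact congrArg _ (hfree hx hy hz (Nat.ModEq.eq_of_lt_of_lt h (by omega) (by omega)))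
  have hlt : 2 ^ n * #S < M := by
    by_contra! h
    have h1 := card_lt_of_threeAPFree (injective_add_self_zmod (2 ^ (j + 1))) hfree' (n := n)
      (by rw [hcard, ZMod.card]; exact h)
    rw [ZMod.card] at h1
    have h2 : 2 ^ boundExponent n ≤ 2 ^ (j + 2) := Nat.pow_le_pow_right (by norm_num) hj
    rw [pow_succ] at h2
    omega
  have hlog : (j + 2) ^ 2 < 2 ^ n := by
    have := Nat.lt_pow_succ_log_self (b := 2) (by norm_num) (j + 2)
    calc (j + 2) ^ 2 < (2 ^ (Nat.log 2 (j + 2) + 1)) ^ 2 := by gcongr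
      _ = 2 ^ n := by rw [← pow_mul, hn]; ring
  have h1 : j ^ 2 * #S ≤ 8 * 2 ^ j := by
    have h2 : j ^ 2 * #S ≤ 2 ^ n * #S := by
      refine Nat.mul_le_mul_right _ (le_trans ?_ hlog.le)
      gcongr
      omega
    rw [hM, pow_succ 2 j] at hlt
    have := Nat.one_le_two_pow (n := j)
    omega
  have h2 : (j : ℝ) ^ 2 * #S ≤ 8 * 2 ^ j := by exact_mod_cast h1
  have hj0 : (0 : ℝ) < j := by exact_mod_cast hj1
  rw [div_le_iff₀ (by positivity), mul_one_div, div_mul_eq_mul_div, le_div_iff₀ (by positivity)]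
  linarith

open Classical in
/-- The sum of the reciprocals of the members of a progression-free set of natural numbers converges. -/
theorem summable_of_threeAPFree {S : Set ℕ} (hS : ThreeAPFree S) :
    Summable (S.indicator fun m => 1 / (m : ℝ)) := by
  set f := S.indicator fun m : ℕ => 1 / (m : ℝ) with hf
  have hf0 (m : ℕ) : 0 ≤ f m := Set.indicator_nonneg (fun _ _ => by positivity) m
  let B (j : ℕ) : Finset ℕ := {m ∈ Ico (2 ^ j) (2 ^ (j + 1)) | m ∈ S}
  have hB (j : ℕ) : ∑ m ∈ Ico (2 ^ j) (2 ^ (j + 1)), f m ≤ (#(B j) : ℝ) / 2 ^ j := by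
    calc ∑ m ∈ Ico (2 ^ j) (2 ^ (j + 1)), f m = ∑ m ∈ B j, 1 / (m : ℝ) := by
          rw [sum_filter]
          exact sum_congr rfl fun m _ => Set.indicator_apply _ _ _
      _ ≤ ∑ m ∈ B j, 1 / (2 : ℝ) ^ j := by
        refine sum_le_sum fun m hm => one_div_le_one_div_of_le (by positivity) ?_
        exact_mod_cast (mem_Ico.1 (mem_filter.1 hm).1).1
      _ = _ := by rw [sum_const, nsmul_eq_mul, mul_one_div]
  have hsum : Summable fun j => (#(B j) : ℝ) / 2 ^ j := by
    refine Summable.of_norm_bounded_eventually_nat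
      ((Real.summable_one_div_nat_pow.2 one_lt_two).mul_left 8) ?_
    filter_upwards [eventually_card_block_le] with j hj
    rw [Real.norm_of_nonneg (by positivity)]
    exact hj (B j) (fun m hm => (mem_Ico.1 (mem_filter.1 hm).1).2)
      (hS.mono fun m hm => (mem_filter.1 (mem_coe.1 hm)).2)
  have hrange (J : ℕ) : ∑ m ∈ range (2 ^ J), f m ≤
      f 0 + ∑ j ∈ range J, (#(B j) : ℝ) / 2 ^ j := by
    induction J with
    | zero => simp
    | succ J ih =>
      rw [← sum_range_add_sum_Ico f (Nat.pow_le_pow_right two_pos J.le_succ), sum_range_succ,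
        ← add_assoc]
      exact add_le_add ih (hB J)
  refine summable_of_sum_range_le (c := f 0 + ∑' j, (#(B j) : ℝ) / 2 ^ j) hf0 fun n => ?_
  calc ∑ m ∈ range n, f m ≤ ∑ m ∈ range (2 ^ n), f m :=
        sum_le_sum_of_subset_of_nonneg (range_subset_range.2 Nat.lt_two_pow_self.le)
          fun m _ _ => hf0 m
    _ ≤ _ := hrange n
    _ ≤ _ := by
      gcongr
      exact hsum.sum_le_tsum _ fun j _ => by positivity

end Final

end KelleyMeka

/-- If a set of positive integers has divergent sum of reciprocals, then it contains a
nontrivial three-term arithmetic progression. -/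
theorem erdos_conjecture_3ap (S : Set ℤ) (hpos : ∀ n ∈ S, 0 < n)
    (hdiv : ¬ Summable fun n : S => (1 : ℝ) / (n : ℤ)) :
    ∃ x y : ℤ, y ≠ 0 ∧ x ∈ S ∧ x + y ∈ S ∧ x + 2 * y ∈ S := by
  by_contra! h
  refine hdiv ?_
  have hfree : ThreeAPFree {m : ℕ | (m : ℤ) ∈ S} := by
    intro a ha b hb c hc habc
    by_contra hab
    have habc' : (a : ℤ) + c = b + b := by exact_mod_cast habc
    refine h a (b - a) (sub_ne_zero.2 fun e => hab (by exact_mod_cast e.symm)) ha ?_ ?_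
    · simpa using hb
    · rw [show (a : ℤ) + 2 * (b - a) = c by linarith]
      exact hc
  have hinj : Function.Injective fun n : S => (n : ℤ).toNat := by
    intro x y hxy
    have hx := hpos x x.2
    have hy := hpos y y.2
    simp only at hxy
    exact Subtype.ext (by omega)
  refine (summable_congr fun n => ?_).1
    ((KelleyMeka.summable_of_threeAPFree hfree).comp_injective hinj)
  have hn : (((n : ℤ).toNat : ℕ) : ℤ) = n := Int.toNat_of_nonneg (hpos n n.2).le
  rw [Function.comp_apply, Set.indicator_of_mem]
  · congr 1
    exact_mod_cast congrArg (Int.cast : ℤ → ℝ) hn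
  · rw [Set.mem_ofPred_eq, hn]
    exact n.2
end

section
/- There exists an absolute constant C > 0 such that for every n ≥ 1, every cap-set A ⊆ 𝔽_3^n satisfies |A| ≤ C·3^n/n; that is, r_3(𝔽_3^n) = O(3^n/n). -/
open Finset Module

section CharacterSums

variable {V : Type*} [AddCommGroup V] [Module (ZMod 3) V]

theorem add_self_add_self_eq_zero (x : V) : x + x + x = 0 := by
  have h : ((1 + 1 + 1 : ZMod 3)) • x = 0 := by
    rw [show (1 + 1 + 1 : ZMod 3) = 0 by decide, zero_smul]
  simpa [add_smul] using h

/-- The Fourier coefficient of the indicator of `A` at the linear form `f`. -/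
noncomputable def dualCoeff (A : Finset V) (f : Dual (ZMod 3) V) : ℂ :=
  ∑ x ∈ A, ZMod.stdAddChar (f x)

theorem dualCoeff_zero (A : Finset V) : dualCoeff A 0 = #A := by
  simp [dualCoeff]

/-- If every fibre of `f` on `A` has at most `m` elements, the Fourier coefficient is at most
`3 * m - #A`. -/
theorem norm_dualCoeff_le (A : Finset V) (f : Dual (ZMod 3) V) (m : ℝ)
    (hm : ∀ c, (#{x ∈ A | f x = c} : ℝ) ≤ m) : ‖dualCoeff A f‖ ≤ 3 * m - #A := by
  classical
  have hfib : dualCoeff A f =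
      ∑ c : ZMod 3, (#{x ∈ A | f x = c} : ℂ) * ZMod.stdAddChar c := by
    rw [dualCoeff, ← sum_fiberwise A f]
    refine sum_congr rfl fun c _ => ?_
    rw [sum_congr rfl (g := fun _ => ZMod.stdAddChar c), sum_const, nsmul_eq_mul]
    intro x hx
    rw [(mem_filter.1 hx).2]
  have hψ : ∑ c : ZMod 3, (ZMod.stdAddChar c : ℂ) = 0 := by
    apply AddChar.sum_eq_zero_iff_ne_zero.2
    intro h
    have h1 : (ZMod.stdAddChar (1 : ZMod 3) : ℂ) = ZMod.stdAddChar (0 : ZMod 3) := by simp [h]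
    exact absurd (ZMod.injective_stdAddChar h1) (by decide)
  have hcard : ∑ c : ZMod 3, (#{x ∈ A | f x = c} : ℝ) = #A := by
    exact_mod_cast (card_eq_sum_card_fiberwise (f := f) (t := univ) (by simp)).symm
  have hneg : dualCoeff A f =
      -∑ c : ZMod 3, ((m - #{x ∈ A | f x = c} : ℝ) : ℂ) * ZMod.stdAddChar c := by
    push_cast
    simp only [sub_mul, sum_sub_distrib]
    rw [← mul_sum, hψ, hfib]
    ring
  rw [hneg, norm_neg]
  calc _ ≤ ∑ c : ZMod 3, ‖((m - #{x ∈ A | f x = c} : ℝ) : ℂ) * ZMod.stdAddChar c‖ :=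
        norm_sum_le _ _
    _ = ∑ c : ZMod 3, (m - #{x ∈ A | f x = c} : ℝ) := by
        refine sum_congr rfl fun c _ => ?_
        rw [norm_mul, AddChar.norm_apply, mul_one, Complex.norm_real, Real.norm_eq_abs,
          abs_of_nonneg (sub_nonneg.2 (hm c))]
    _ = 3 * m - #A := by
        rw [sum_sub_distrib, hcard]
        simp

variable [Fintype V]

theorem card_eq_three_pow_finrank : Fintype.card V = 3 ^ finrank (ZMod 3) V := by
  rw [Module.card_eq_pow_finrank (K := ZMod 3), ZMod.card]

/-- Orthogonality of characters, summed over the dual space. -/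
theorem sum_dual_stdAddChar [Fintype (Dual (ZMod 3) V)] [DecidableEq V] (v : V) :
    ∑ f : Dual (ZMod 3) V, ZMod.stdAddChar (f v) = if v = 0 then (Fintype.card V : ℂ) else 0 := by
  have hcard : Fintype.card (Dual (ZMod 3) V) = Fintype.card V := by
    rw [card_eq_three_pow_finrank, card_eq_three_pow_finrank, Subspace.dual_finrank_eq]
  split_ifs with hv
  · simp [hv, hcard]
  · let e : AddChar (Dual (ZMod 3) V) ℂ :=
      (ZMod.stdAddChar (N := 3)).compAddMonoidHom (Dual.eval (ZMod 3) V v).toAddMonoidHom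
    have he : e ≠ 0 := by
      intro h0
      obtain ⟨f, hf⟩ : ∃ f : Dual (ZMod 3) V, f v ≠ 0 := by
        by_contra! h
        exact hv ((Module.forall_dual_apply_eq_zero_iff (ZMod 3) v).1 h)
      apply hf
      apply ZMod.injective_stdAddChar
      have := DFunLike.congr_fun h0 f
      simpa [e] using this
    exact AddChar.sum_eq_zero_iff_ne_zero.2 he

theorem sum_dualCoeff_cube [Fintype (Dual (ZMod 3) V)] {A : Finset V}
    (hA : ∀ x ∈ A, ∀ y ∈ A, ∀ z ∈ A, x + y + z = 0 → x = y) :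
    ∑ f, dualCoeff A f ^ 3 = Fintype.card V * #A := by
  classical
  have h1 : ∀ f, dualCoeff A f ^ 3 =
      ∑ x ∈ A, ∑ y ∈ A, ∑ z ∈ A, ZMod.stdAddChar (f (x + y + z)) := by
    intro f
    rw [dualCoeff, pow_three', sum_mul_sum]
    simp only [map_add, AddChar.map_add_eq_mul, sum_mul]
    simp only [mul_sum]
  have h2 : ∀ x ∈ A, ∑ y ∈ A, ∑ z ∈ A,
      (if x + y + z = 0 then (Fintype.card V : ℂ) else 0) = Fintype.card V := by
    intro x hx
    rw [sum_eq_single_of_mem x hx, sum_eq_single_of_mem x hx, if_pos (add_self_add_self_eq_zero x)]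
    · intro z _ hzx
      rw [if_neg]
      intro h
      exact hzx (add_left_cancel (h.trans (add_self_add_self_eq_zero x).symm))
    · intro y hy hyx
      refine sum_eq_zero fun z hz => if_neg fun h => hyx (hA x hx y hy z hz h).symm
  simp only [h1]
  rw [sum_comm]
  calc _ = ∑ x ∈ A, ∑ y ∈ A, ∑ z ∈ A,
        (if x + y + z = 0 then (Fintype.card V : ℂ) else 0) := by
        refine sum_congr rfl fun x _ => ?_
        rw [sum_comm]
        refine sum_congr rfl fun y _ => ?_
        rw [sum_comm]
        exact sum_congr rfl fun z _ => sum_dual_stdAddChar _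
    _ = _ := by rw [sum_congr rfl h2, sum_const, nsmul_eq_mul, mul_comm]

theorem sum_norm_dualCoeff_sq [Fintype (Dual (ZMod 3) V)] (A : Finset V) :
    ∑ f, ‖dualCoeff A f‖ ^ 2 = (Fintype.card V * #A : ℝ) := by
  classical
  have h1 : ∀ f, ((‖dualCoeff A f‖ ^ 2 : ℝ) : ℂ) =
      ∑ x ∈ A, ∑ y ∈ A, ZMod.stdAddChar (f (x - y)) := by
    intro f
    push_cast
    rw [← Complex.mul_conj']
    simp only [dualCoeff, map_sum, sum_mul_sum, sub_eq_add_neg, map_add, map_neg,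
      AddChar.map_add_eq_mul, AddChar.map_neg_eq_conj]
  have h2 : ((∑ f, ‖dualCoeff A f‖ ^ 2 : ℝ) : ℂ) = ((Fintype.card V * #A : ℝ) : ℂ) := by
    rw [Complex.ofReal_sum]
    simp only [h1]
    rw [sum_comm]
    calc _ = ∑ x ∈ A, ∑ y ∈ A, (if x = y then (Fintype.card V : ℂ) else 0) := by
          refine sum_congr rfl fun x _ => ?_
          rw [sum_comm]
          refine sum_congr rfl fun y _ => ?_
          simp only [sum_dual_stdAddChar, sub_eq_zero]
      _ = _ := by simp [mul_comm]
  exact_mod_cast h2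

/-- The density increment inequality for a cap set whose hyperplane sections are all of size
at most `m`. -/
theorem card_sq_sub_le {A : Finset V}
    (hA : ∀ x ∈ A, ∀ y ∈ A, ∀ z ∈ A, x + y + z = 0 → x = y) (m : ℝ)
    (hm : ∀ f : Dual (ZMod 3) V, f ≠ 0 → ∀ c, (#{x ∈ A | f x = c} : ℝ) ≤ m) :
    (#A : ℝ) ^ 3 - (3 * m - #A) * (Fintype.card V * #A - (#A : ℝ) ^ 2)
      ≤ Fintype.card V * #A := by
  classical
  have : Finite (Dual (ZMod 3) V) := Finite.of_injective _ DFunLike.coe_injective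
  let _ := Fintype.ofFinite (Dual (ZMod 3) V)
  have hcube := sum_dualCoeff_cube hA
  have hsq := sum_norm_dualCoeff_sq A
  rw [← add_sum_erase _ _ (mem_univ 0), dualCoeff_zero] at hcube hsq
  rw [Complex.norm_natCast] at hsq
  have hbound : ‖∑ f ∈ univ.erase (0 : Dual (ZMod 3) V), dualCoeff A f ^ 3‖
      ≤ (3 * m - #A) * ∑ f ∈ univ.erase (0 : Dual (ZMod 3) V), ‖dualCoeff A f‖ ^ 2 := by
    rw [mul_sum]
    refine (norm_sum_le _ _).trans (sum_le_sum fun f hf => ?_)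
    rw [norm_pow, pow_succ' _ 2]
    exact mul_le_mul_of_nonneg_right
      (norm_dualCoeff_le A f m (hm f (ne_of_mem_erase hf))) (by positivity)
  have hrest : ∑ f ∈ univ.erase (0 : Dual (ZMod 3) V), dualCoeff A f ^ 3 =
      ((Fintype.card V * #A - (#A : ℝ) ^ 3 : ℝ) : ℂ) := by
    push_cast
    linear_combination hcube
  rw [hrest, Complex.norm_real, Real.norm_eq_abs] at hbound
  have hneg := (neg_le_abs _).trans hbound
  rw [show ∑ f ∈ univ.erase (0 : Dual (ZMod 3) V), ‖dualCoeff A f‖ ^ 2 =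
    Fintype.card V * #A - (#A : ℝ) ^ 2 by linarith] at hneg
  linarith

end CharacterSums

theorem natCast_mul_add_one_le_three_pow (n : ℕ) : ((n : ℝ) + 1) * n ≤ 2 * 3 ^ (n + 1) := by
  induction n with
  | zero => norm_num
  | succ k ih =>
    have h : (k : ℝ) + 1 ≤ 3 ^ (k + 1) := by
      have := one_add_mul_le_pow (a := (2 : ℝ)) (by norm_num) (k + 1)
      norm_num at this
      have hk : (0 : ℝ) ≤ k := k.cast_nonneg
      linarith
    rw [pow_succ]
    push_cast
    nlinarith

/-- Meshulam's bound with explicit constant, for an arbitrary vector space over `𝔽₃`. -/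
theorem card_le_of_sum_eq_zero_imp_eq (n : ℕ) :
    ∀ (V : Type) [AddCommGroup V] [Module (ZMod 3) V] [Fintype V],
      finrank (ZMod 3) V = n + 1 → ∀ A : Finset V,
      (∀ x ∈ A, ∀ y ∈ A, ∀ z ∈ A, x + y + z = 0 → x = y) →
      (#A : ℝ) ≤ 2 * 3 ^ (n + 1) / (n + 1) := by
  induction n with
  | zero =>
    intro V _ _ _ hV A _
    have h : (#A : ℝ) ≤ Fintype.card V := by exact_mod_cast card_le_univ A
    rw [card_eq_three_pow_finrank, hV] at h
    norm_num at h ⊢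
    linarith
  | succ n ih =>
    intro V _ _ _ hV A hA
    classical
    set m : ℝ := 2 * 3 ^ (n + 1) / (n + 1) with hmdef
    have hm : ∀ f : Dual (ZMod 3) V, f ≠ 0 → ∀ c, (#{x ∈ A | f x = c} : ℝ) ≤ m := by
      intro f hf c
      obtain ⟨x₀, hx₀⟩ := LinearMap.surjective hf c
      have hker : finrank (ZMod 3) (LinearMap.ker f) = n + 1 := by
        have := Module.Dual.finrank_ker_add_one_of_ne_zero hf
        omega
      let B : Finset (LinearMap.ker f) := {k | x₀ + (k : V) ∈ A}
      have hB := ih (LinearMap.ker f) hker B (by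
        intro x hx y hy z hz h
        simp only [B, mem_filter, mem_univ, true_and] at hx hy hz
        have h' : (x : V) + y + z = 0 := by exact_mod_cast congrArg Subtype.val h
        have := hA _ hx _ hy _ hz (by
          rw [show x₀ + (x : V) + (x₀ + y) + (x₀ + z) = (x₀ + x₀ + x₀) + (x + y + z) by abel,
            h', add_self_add_self_eq_zero, add_zero])
        exact Subtype.ext (add_left_cancel this))
      refine le_trans ?_ hB
      have hsub : {x ∈ A | f x = c} ⊆ B.image fun k : LinearMap.ker f => x₀ + (k : V) := by
        intro x hx
        obtain ⟨hxA, hxc⟩ := mem_filter.1 hx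
        refine mem_image.2 ⟨⟨x - x₀, by simp [hxc, hx₀]⟩, ?_, by simp⟩
        simpa [B] using hxA
      exact_mod_cast (card_le_card hsub).trans card_image_le
    have key := card_sq_sub_le hA m hm
    rw [card_eq_three_pow_finrank, hV] at key
    push_cast at key ⊢
    rcases (Nat.cast_nonneg #A : (0 : ℝ) ≤ #A).eq_or_lt with h0 | hpos
    · rw [← h0]
      positivity
    have hpow := natCast_mul_add_one_le_three_pow (n + 1)
    push_cast at hpow
    have h3m : 3 * m * (n + 1) = 2 * 3 ^ (n + 1 + 1) := by
      rw [hmdef, pow_succ _ (n + 1)]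
      field_simp
    have hn : (0 : ℝ) ≤ n := n.cast_nonneg
    have hN : (0 : ℝ) < 3 ^ (n + 1 + 1) := by positivity
    generalize (3 : ℝ) ^ (n + 1 + 1) = N at *
    generalize (#A : ℝ) = a at *
    have key' : a ^ 2 - (3 * m - a) * (N - a) ≤ N := by
      refine le_of_mul_le_mul_right ?_ hpos
      linarith
    have key'' : N * a + 3 * m * a ≤ N + 3 * m * N := by linarith
    have hlin : N * (a * (n + 3)) ≤ N * ((n + 1) + 2 * N) := by
      have := mul_le_mul_of_nonneg_right key'' (by positivity : (0 : ℝ) ≤ n + 1)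
      linear_combination this + (N - a) * h3m
    have hlin' := le_of_mul_le_mul_left hlin hN
    rw [le_div_iff₀ (by positivity)]
    refine le_of_mul_le_mul_right ?_ (by positivity : (0 : ℝ) < n + 3)
    have := mul_le_mul_of_nonneg_right hlin' (by positivity : (0 : ℝ) ≤ n + 1 + 1)
    linear_combination this + hpow

/-- Meshulam's theorem: `r₃(𝔽₃ⁿ) = O(3ⁿ / n)`. -/
theorem meshulam :
    ∃ C : ℝ, 0 < C ∧ ∀ n : ℕ, 1 ≤ n → ∀ A : Finset (Fin n → ZMod 3),
      (¬ ∃ x y : Fin n → ZMod 3, y ≠ 0 ∧ x ∈ A ∧ x + y ∈ A ∧ x + 2 • y ∈ A) →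
      (A.card : ℝ) ≤ C * 3 ^ n / n := by
  refine ⟨2, two_pos, fun n hn A hA => ?_⟩
  obtain ⟨k, rfl⟩ := Nat.exists_eq_add_of_le' hn
  have h := card_le_of_sum_eq_zero_imp_eq k (Fin (k + 1) → ZMod 3) (by simp) A (by
    intro x hx y hy z hz h
    by_contra hxy
    refine hA ⟨x, y - x, sub_ne_zero.2 (Ne.symm hxy), hx, by simpa using hy, ?_⟩
    have hz' : x + 2 • (y - x) = z := by
      rw [← sub_eq_zero]
      calc x + 2 • (y - x) - z = (y + y + y) - (x + y + z) := by rw [two_nsmul]; abel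
        _ = 0 := by rw [h, add_self_add_self_eq_zero, sub_zero]
    rwa [hz'])
  exact_mod_cast h
end

section
/- There exists an absolute constant C > 0 such that for every n ≥ 1, every cap-set A ⊆ 𝔽_3^n satisfies |A| ≤ C·(2.756)^n; that is, r_3(𝔽_3^n) = O(2.756^n). -/
/-- A subspace of `T → K` contains a vector whose support is at least as large as the dimension. -/
theorem Submodule.exists_finrank_le_card_support {K T : Type*} [Field K] [DecidableEq K]
    [Fintype T] (W : Submodule K (T → K)) :
    ∃ v ∈ W, Module.finrank K W ≤ (Finset.univ.filter fun t => v t ≠ 0).card := by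
  classical
  obtain ⟨v, hv⟩ : ∃ v : W, ∀ w : W, (Finset.univ.filter fun t => (w : T → K) t ≠ 0).card ≤
      (Finset.univ.filter fun t => (v : T → K) t ≠ 0).card := by
    have hbdd : BddAbove (Set.range fun w : W =>
        (Finset.univ.filter fun t => (w : T → K) t ≠ 0).card) :=
      ⟨Fintype.card T, by rintro _ ⟨w, rfl⟩; exact Finset.card_le_univ _⟩
    obtain ⟨v, hv⟩ := Nat.sSup_mem (Set.range_nonempty _) hbdd
    exact ⟨v, fun w => (le_csSup hbdd ⟨w, rfl⟩).trans hv.ge⟩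
  refine ⟨v, v.2, ?_⟩
  by_contra! hlt
  let S := {t // (v : T → K) t ≠ 0}
  let res : W →ₗ[K] (S → K) := (LinearMap.funLeft K K ((↑) : S → T)).comp W.subtype
  have hker : LinearMap.ker res ≠ ⊥ := by
    apply LinearMap.ker_ne_bot_of_finrank_lt
    rwa [Module.finrank_fintype_fun_eq_card, Fintype.card_subtype]
  obtain ⟨w, hw, hw0⟩ := (Submodule.ne_bot_iff _).1 hker
  have hvan : ∀ t, (v : T → K) t ≠ 0 → (w : T → K) t = 0 := fun t ht =>
    congrFun (LinearMap.mem_ker.1 hw) ⟨t, ht⟩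
  obtain ⟨t₀, ht₀⟩ : ∃ t, (w : T → K) t ≠ 0 := by
    by_contra! h
    exact hw0 (Subtype.ext (funext h))
  refine (hv (v + w)).not_gt (Finset.card_lt_card ?_)
  rw [Finset.ssubset_iff_of_subset]
  · refine ⟨t₀, ?_, ?_⟩
    · have : (v : T → K) t₀ = 0 := by
        by_contra h
        exact ht₀ (hvan t₀ h)
      simp [this, ht₀]
    · simp only [Finset.mem_filter, Finset.mem_univ, true_and]
      exact fun h => ht₀ (hvan t₀ h)
  · intro t ht
    simp only [Finset.mem_filter, Finset.mem_univ, true_and] at ht ⊢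
    simp [hvan t ht, ht]

/-- A subspace on which the diagonal trilinear form vanishes has dimension at most two thirds of
the ambient dimension. -/
theorem Submodule.three_mul_finrank_le_of_sum_mul_mul_eq_zero {K T : Type*} [Field K] [Fintype T]
    (W : Submodule K (T → K))
    (h : ∀ u ∈ W, ∀ v ∈ W, ∀ w ∈ W, ∑ t, u t * v t * w t = 0) :
    3 * Module.finrank K W ≤ 2 * Fintype.card T := by
  classical
  obtain ⟨v, hvW, hv⟩ := W.exists_finrank_le_card_support
  let mul : W →ₗ[K] (T → K) := (LinearMap.mulLeft K v).comp W.subtype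
  let N := {t // v t = 0}
  have hker : Module.finrank K (LinearMap.ker mul) ≤ Fintype.card N := by
    let res : LinearMap.ker mul →ₗ[K] (N → K) :=
      (LinearMap.funLeft K K ((↑) : N → T)).comp (W.subtype.comp (LinearMap.ker mul).subtype)
    rw [← Module.finrank_fintype_fun_eq_card K (η := N)]
    refine LinearMap.finrank_le_finrank_of_injective (f := res) ?_
    rintro ⟨w, hw⟩ ⟨w', hw'⟩ heq
    refine Subtype.ext (Subtype.ext (funext fun t => ?_))
    by_cases ht : v t = 0
    · exact congrFun heq ⟨t, ht⟩
    · exact mul_left_cancel₀ ht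
        (congrFun ((LinearMap.mem_ker.1 hw).trans (LinearMap.mem_ker.1 hw').symm) t)
  have hrange : Module.finrank K (LinearMap.range mul) + Module.finrank K W ≤ Fintype.card T := by
    let pair : (T → K) →ₗ[K] Module.Dual K W :=
      (W.subtype.dualMap).comp (dotProductEquiv K T).toLinearMap
    have hle : LinearMap.range mul ≤ LinearMap.ker pair := by
      rintro _ ⟨w, rfl⟩
      rw [LinearMap.mem_ker]
      ext u
      exact h v hvW w w.2 u u.2
    have hsurj : Function.Surjective pair :=
      (LinearMap.dualMap_surjective_of_injective W.injective_subtype).comp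
        (dotProductEquiv K T).surjective
    have := LinearMap.finrank_range_add_finrank_ker pair
    rw [LinearMap.range_eq_top.2 hsurj, finrank_top, Subspace.dual_finrank_eq,
      Module.finrank_fintype_fun_eq_card] at this
    have := Submodule.finrank_mono hle
    omega
  have hrn := LinearMap.finrank_range_add_finrank_ker mul
  have hN : Fintype.card N + (Finset.univ.filter fun t => v t ≠ 0).card = Fintype.card T := by
    rw [Fintype.card_subtype]
    exact Finset.card_filter_add_card_filter_not _
  omega

/-- The slice rank bound for the diagonal tensor: if it is a sum of rank one tensors, each having a
factor in a family `f` indexed by `M`, then `card T ≤ 3 * card M`. -/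
theorem card_le_three_mul_card_of_diagonal_eq_sum {K T M Φ : Type*} [Field K] [Fintype T]
    [DecidableEq T] [Fintype M] [Fintype Φ] (f : M → T → K) (c : Φ → K) (p q r : Φ → T → K)
    (hslice : ∀ φ, c φ = 0 ∨ p φ ∈ Set.range f ∨ q φ ∈ Set.range f ∨ r φ ∈ Set.range f)
    (hdiag : ∀ x y z, ∑ φ, c φ * (p φ x * q φ y * r φ z) = if x = y ∧ x = z then 1 else 0) :
    Fintype.card T ≤ 3 * Fintype.card M := by
  let L : (T → K) →ₗ[K] (M → K) := Matrix.mulVecLin (Matrix.of f)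
  have hL : ∀ w ∈ LinearMap.ker L, ∀ g ∈ Set.range f, ∑ t, g t * w t = 0 := by
    rintro w hw _ ⟨m, rfl⟩
    exact congrFun (LinearMap.mem_ker.1 hw) m
  have hzero : ∀ u ∈ LinearMap.ker L, ∀ v ∈ LinearMap.ker L, ∀ w ∈ LinearMap.ker L,
      ∑ t, u t * v t * w t = 0 := by
    intro u hu v hv w hw
    calc ∑ t, u t * v t * w t
        = ∑ x, ∑ y, ∑ z, (if x = y ∧ x = z then 1 else 0) * (u x * v y * w z) := by
          simp [ite_and]
      _ = ∑ x, ∑ y, ∑ z, ∑ φ, c φ * ((p φ x * u x) * (q φ y * v y) * (r φ z * w z)) := by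
          refine Finset.sum_congr rfl fun x _ => Finset.sum_congr rfl fun y _ =>
            Finset.sum_congr rfl fun z _ => ?_
          rw [← hdiag, Finset.sum_mul]
          exact Finset.sum_congr rfl fun φ _ => by ring
      _ = ∑ φ, ∑ x, ∑ y, ∑ z, c φ * ((p φ x * u x) * (q φ y * v y) * (r φ z * w z)) := by
          symm
          refine Finset.sum_comm.trans (Finset.sum_congr rfl fun x _ => ?_)
          refine Finset.sum_comm.trans (Finset.sum_congr rfl fun y _ => ?_)
          exact Finset.sum_comm
      _ = ∑ φ, c φ * ((∑ x, p φ x * u x) * (∑ y, q φ y * v y) * (∑ z, r φ z * w z)) := by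
          refine Finset.sum_congr rfl fun φ _ => ?_
          rw [mul_assoc (∑ x, p φ x * u x), Finset.sum_mul]
          simp only [Finset.sum_mul]
          simp only [Finset.mul_sum, mul_assoc]
      _ = 0 := by
          refine Finset.sum_eq_zero fun φ _ => ?_
          rcases hslice φ with h | h | h | h
          · simp [h]
          · simp [hL u hu _ h]
          · simp [hL v hv _ h]
          · simp [hL w hw _ h]
  have h3 := (LinearMap.ker L).three_mul_finrank_le_of_sum_mul_mul_eq_zero hzero
  have hrn := LinearMap.finrank_range_add_finrank_ker L
  have hr := Submodule.finrank_le (LinearMap.range L)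
  rw [Module.finrank_fintype_fun_eq_card] at hrn hr
  omega

/-- The coefficient of `x ^ a * y ^ b * z ^ c` in `1 - (x + y + z) ^ 2` over `ZMod 3`. -/
def zeroSumCoeff (e : Fin 3 × Fin 3 × Fin 3) : ZMod 3 :=
  let d := (e.1 : ℕ) + e.2.1 + e.2.2
  if d = 0 then 1
  else if d = 2 then if e.1 = 2 ∨ e.2.1 = 2 ∨ e.2.2 = 2 then -1 else 1
  else 0

theorem sum_zeroSumCoeff (x y z : ZMod 3) :
    ∑ e, zeroSumCoeff e * (x ^ (e.1 : ℕ) * y ^ (e.2.1 : ℕ) * z ^ (e.2.2 : ℕ)) =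
      if x + y + z = 0 then 1 else 0 := by
  revert x y z
  decide

theorem le_two_of_zeroSumCoeff_ne_zero (e : Fin 3 × Fin 3 × Fin 3) (h : zeroSumCoeff e ≠ 0) :
    (e.1 : ℕ) + e.2.1 + e.2.2 ≤ 2 := by
  revert e
  decide

/-- Exponent vectors in `{0, 1, 2}ⁿ` of total degree at most `2n / 3`. -/
def lowDegreeExponents (n : ℕ) : Finset (Fin n → Fin 3) :=
  Finset.univ.filter fun e => 3 * ∑ i, (e i : ℕ) ≤ 2 * n

theorem card_lowDegreeExponents_mul_le (n : ℕ) {t : ℝ} (h0 : 0 ≤ t) (h1 : t ≤ 1) :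
    ((lowDegreeExponents n).card : ℝ) * (t ^ 2) ^ n ≤ (1 + t ^ 3 + t ^ 6) ^ n := by
  calc ((lowDegreeExponents n).card : ℝ) * (t ^ 2) ^ n
      = ∑ _e ∈ lowDegreeExponents n, (t ^ 2) ^ n := by simp
    _ ≤ ∑ e ∈ lowDegreeExponents n, ∏ i, (t ^ 3) ^ (e i : ℕ) := by
        refine Finset.sum_le_sum fun e he => ?_
        rw [Finset.prod_pow_eq_pow_sum, ← pow_mul, ← pow_mul]
        exact pow_le_pow_of_le_one h0 h1 (Finset.mem_filter.1 he).2
    _ ≤ ∑ e : Fin n → Fin 3, ∏ i, (t ^ 3) ^ (e i : ℕ) :=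
        Finset.sum_le_sum_of_subset_of_nonneg (Finset.subset_univ _)
          fun _ _ _ => Finset.prod_nonneg fun _ _ => by positivity
    _ = (1 + t ^ 3 + t ^ 6) ^ n := by
        rw [← Fintype.piFinset_univ, ← Finset.prod_univ_sum (fun _ => Finset.univ)
          (fun _ (a : Fin 3) => (t ^ 3) ^ (a : ℕ))]
        simp [Fin.sum_univ_three, ← pow_mul]

theorem card_le_three_mul_card_lowDegreeExponents {n : ℕ} (A : Finset (Fin n → ZMod 3))
    (hA : ¬ ∃ x y : Fin n → ZMod 3, y ≠ 0 ∧ x ∈ A ∧ x + y ∈ A ∧ x + 2 • y ∈ A) :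
    A.card ≤ 3 * (lowDegreeExponents n).card := by
  have hsum : ∀ x y z : A, (∀ i, x.1 i + y.1 i + z.1 i = 0) ↔ x = y ∧ x = z := by
    intro x y z
    constructor
    · intro h
      have hz : x.1 + 2 • (y.1 - x.1) = z.1 := by
        funext i
        have key : ∀ a b c : ZMod 3, a + b + c = 0 → a + 2 • (b - a) = c := by decide
        exact key _ _ _ (h i)
      have hxy : y.1 - x.1 = 0 := by
        by_contra hne
        exact hA ⟨x, y.1 - x.1, hne, x.2, by simp, by rw [hz]; exact z.2⟩
      rw [hxy] at hz
      exact ⟨Subtype.ext (sub_eq_zero.1 hxy).symm, Subtype.ext (by simpa using hz)⟩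
    · rintro ⟨rfl, rfl⟩ i
      have key : ∀ a : ZMod 3, a + a + a = 0 := by decide
      exact key _
  let mono : (Fin n → Fin 3) → A → ZMod 3 := fun e x => ∏ i, x.1 i ^ (e i : ℕ)
  have hbound := card_le_three_mul_card_of_diagonal_eq_sum (T := A)
    (M := lowDegreeExponents n) (Φ := Fin n → Fin 3 × Fin 3 × Fin 3)
    (fun e => mono e) (fun φ => ∏ i, zeroSumCoeff (φ i)) (fun φ => mono fun i => (φ i).1)
    (fun φ => mono fun i => (φ i).2.1) (fun φ => mono fun i => (φ i).2.2) ?_ ?_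
  · simpa using hbound
  · intro φ
    refine or_iff_not_imp_left.2 fun hne => ?_
    have hdeg : ∑ i, (((φ i).1 : ℕ) + (φ i).2.1 + (φ i).2.2) ≤ ∑ _i : Fin n, 2 :=
      Finset.sum_le_sum fun i _ => le_two_of_zeroSumCoeff_ne_zero _
        (Finset.prod_ne_zero_iff.1 hne i (Finset.mem_univ i))
    simp only [Finset.sum_add_distrib, Finset.sum_const, Finset.card_univ, Fintype.card_fin,
      smul_eq_mul] at hdeg
    have hmem : ∀ e : Fin n → Fin 3, 3 * ∑ i, (e i : ℕ) ≤ 2 * n →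
        mono e ∈ Set.range fun e : lowDegreeExponents n => mono e := fun e he =>
      ⟨⟨e, Finset.mem_filter.2 ⟨Finset.mem_univ e, he⟩⟩, rfl⟩
    by_cases h1 : 3 * ∑ i, ((φ i).1 : ℕ) ≤ 2 * n
    · exact Or.inl (hmem _ h1)
    by_cases h2 : 3 * ∑ i, ((φ i).2.1 : ℕ) ≤ 2 * n
    · exact Or.inr (Or.inl (hmem _ h2))
    · exact Or.inr (Or.inr (hmem _ (by omega)))
  · intro x y z
    calc _ = ∑ φ : Fin n → Fin 3 × Fin 3 × Fin 3, ∏ i, zeroSumCoeff (φ i) *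
          (x.1 i ^ ((φ i).1 : ℕ) * y.1 i ^ ((φ i).2.1 : ℕ) * z.1 i ^ ((φ i).2.2 : ℕ)) := by
          simp only [mono, Finset.prod_mul_distrib]
      _ = ∏ i, if x.1 i + y.1 i + z.1 i = 0 then 1 else 0 := by
          rw [← Fintype.piFinset_univ, ← Finset.prod_univ_sum (fun _ => Finset.univ)
            (fun i e => zeroSumCoeff e *
              (x.1 i ^ (e.1 : ℕ) * y.1 i ^ (e.2.1 : ℕ) * z.1 i ^ (e.2.2 : ℕ)))]
          simp only [sum_zeroSumCoeff]
      _ = _ := by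
          rw [Fintype.prod_boole]
          simp only [hsum]

/-- Ellenberg–Gijswijt: `r₃(𝔽₃ⁿ) = O(2.756ⁿ)`. -/
theorem ellenberg_gijswijt :
    ∃ C : ℝ, 0 < C ∧ ∀ n : ℕ, 1 ≤ n → ∀ A : Finset (Fin n → ZMod 3),
      (¬ ∃ x y : Fin n → ZMod 3, y ≠ 0 ∧ x ∈ A ∧ x + y ∈ A ∧ x + 2 • y ∈ A) →
      (A.card : ℝ) ≤ C * (2.756 : ℝ) ^ n := by
  refine ⟨3, by norm_num, fun n _ A hA => ?_⟩
  have hcard : (A.card : ℝ) ≤ 3 * (lowDegreeExponents n).card := by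
    exact_mod_cast card_le_three_mul_card_lowDegreeExponents A hA
  have hcount := card_lowDegreeExponents_mul_le n (t := 0.84) (by norm_num) (by norm_num)
  have hpow : (1 + (0.84 : ℝ) ^ 3 + 0.84 ^ 6) ^ n ≤ 2.756 ^ n * (0.84 ^ 2) ^ n := by
    rw [← mul_pow]
    exact pow_le_pow_left₀ (by norm_num) (by norm_num) n
  have := le_of_mul_le_mul_right (hcount.trans hpow) (by positivity)
  linarith
end

section
/- Let N = 3^n and let A ⊆ 𝔽_3^n be a cap-set of density α = |A|/3^n. Then either N < 2/α², or there exists an affine subspace H of 𝔽_3^n of codimension 1 (i.e., a coset of a codimension-1 linear subspace) such that |A ∩ H|/|H| ≥ α + α²/4. -/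
open scoped Classical

/-- The real function on `ZMod 3` given by the sum of its two nontrivial characters. -/
noncomputable def realChar (t : ZMod 3) : ℝ := if t = 0 then 2 else -1

lemma realChar_add_add (t : ZMod 3) :
    realChar t + realChar (t + 1) + realChar (t + 2) = 0 := by
  have h : ∀ t : ZMod 3, (t = 0 ∧ t + 1 ≠ 0 ∧ t + 2 ≠ 0) ∨ (t ≠ 0 ∧ t + 1 = 0 ∧ t + 2 ≠ 0) ∨
      (t ≠ 0 ∧ t + 1 ≠ 0 ∧ t + 2 = 0) := by decide
  unfold realChar
  rcases h t with ⟨h₁, h₂, h₃⟩ | ⟨h₁, h₂, h₃⟩ | ⟨h₁, h₂, h₃⟩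
  · rw [if_pos h₁, if_neg h₂, if_neg h₃]; norm_num
  · rw [if_neg h₁, if_pos h₂, if_neg h₃]; norm_num
  · rw [if_neg h₁, if_neg h₂, if_pos h₃]; norm_num

/-- Orthogonality: averaging `realChar` over all linear functionals detects zero. -/
lemma sum_realChar_dotProduct {n : ℕ} (s : Fin n → ZMod 3) :
    ∑ r : Fin n → ZMod 3, realChar (r ⬝ᵥ s) = if s = 0 then 2 * 3 ^ n else 0 := by
  split_ifs with hs
  · simp [hs, realChar, mul_comm]
  · obtain ⟨i, hi⟩ : ∃ i, s i ≠ 0 := by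
      by_contra! h
      exact hs (funext h)
    set e : Fin n → ZMod 3 := Pi.single i (s i)⁻¹
    have he : e ⬝ᵥ s = 1 := by simp [e, hi]
    have shift (v : Fin n → ZMod 3) :
        ∑ r : Fin n → ZMod 3, realChar (r ⬝ᵥ s + v ⬝ᵥ s) = ∑ r, realChar (r ⬝ᵥ s) := by
      simp only [← add_dotProduct]
      exact Equiv.sum_comp (Equiv.addRight v) fun r => realChar (r ⬝ᵥ s)
    have h₁ := shift e
    have h₂ := shift (2 • e)
    rw [he] at h₁
    rw [smul_dotProduct, he] at h₂
    have h : ∑ r : Fin n → ZMod 3, (realChar (r ⬝ᵥ s) + realChar (r ⬝ᵥ s + 1) +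
        realChar (r ⬝ᵥ s + 2)) = 0 := by simp [realChar_add_add]
    rw [Finset.sum_add_distrib, Finset.sum_add_distrib] at h
    simp only [nsmul_eq_mul, Nat.cast_ofNat, mul_one] at h₂
    linarith

/-- The number of points of `A` on the affine hyperplane `r ⬝ᵥ x = i`. -/
noncomputable def fiberCard {n : ℕ} (A : Finset (Fin n → ZMod 3)) (r : Fin n → ZMod 3)
    (i : ZMod 3) : ℝ := ((A.filter fun x => r ⬝ᵥ x = i).card : ℝ)

lemma sum_dotProduct_eq {n : ℕ} (A : Finset (Fin n → ZMod 3)) (r : Fin n → ZMod 3)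
    (g : ZMod 3 → ℝ) :
    ∑ x ∈ A, g (r ⬝ᵥ x) =
      fiberCard A r 0 * g 0 + fiberCard A r 1 * g 1 + fiberCard A r 2 * g 2 := by
  have h : ∑ x ∈ A, g (r ⬝ᵥ x) = ∑ i : ZMod 3, fiberCard A r i * g i := by
    rw [← Finset.sum_fiberwise A (fun x => r ⬝ᵥ x)]
    refine Finset.sum_congr rfl fun i _ => ?_
    rw [Finset.sum_congr rfl (g := fun _ => g i)
      (fun x hx => by rw [(Finset.mem_filter.1 hx).2])]
    simp [fiberCard]
  rw [h]
  exact Fin.sum_univ_three _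

lemma fiberCard_add_add {n : ℕ} (A : Finset (Fin n → ZMod 3)) (r : Fin n → ZMod 3) :
    fiberCard A r 0 + fiberCard A r 1 + fiberCard A r 2 = A.card := by
  simpa using (sum_dotProduct_eq A r fun _ => 1).symm

lemma sum_sum_realChar {n : ℕ} (A : Finset (Fin n → ZMod 3)) (r : Fin n → ZMod 3) :
    ∑ x ∈ A, ∑ y ∈ A, realChar (r ⬝ᵥ (x - y)) =
      3 * (fiberCard A r 0 ^ 2 + fiberCard A r 1 ^ 2 + fiberCard A r 2 ^ 2) - A.card ^ 2 := by
  simp only [dotProduct_sub]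
  have h (t : ZMod 3) := sum_dotProduct_eq A r fun j => realChar (t - j)
  simp only [h]
  rw [sum_dotProduct_eq A r fun i => fiberCard A r 0 * realChar (i - 0) +
    fiberCard A r 1 * realChar (i - 1) + fiberCard A r 2 * realChar (i - 2)]
  rw [← fiberCard_add_add A r]
  simp +decide [realChar]
  ring

lemma sum_sum_sum_realChar {n : ℕ} (A : Finset (Fin n → ZMod 3)) (r : Fin n → ZMod 3) :
    ∑ x ∈ A, ∑ y ∈ A, ∑ z ∈ A, realChar (r ⬝ᵥ (x + y + z)) =
      3 * (fiberCard A r 0 ^ 3 + fiberCard A r 1 ^ 3 + fiberCard A r 2 ^ 3 +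
        6 * (fiberCard A r 0 * fiberCard A r 1 * fiberCard A r 2)) - A.card ^ 3 := by
  simp only [dotProduct_add]
  have h (t : ZMod 3) := sum_dotProduct_eq A r fun j => realChar (t + j)
  simp only [h]
  have h' (t : ZMod 3) := sum_dotProduct_eq A r fun j => fiberCard A r 0 * realChar (t + j + 0) +
    fiberCard A r 1 * realChar (t + j + 1) + fiberCard A r 2 * realChar (t + j + 2)
  simp only [h']
  rw [sum_dotProduct_eq A r fun i =>
    fiberCard A r 0 * (fiberCard A r 0 * realChar (i + 0 + 0) +
      fiberCard A r 1 * realChar (i + 0 + 1) + fiberCard A r 2 * realChar (i + 0 + 2)) +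
    fiberCard A r 1 * (fiberCard A r 0 * realChar (i + 1 + 0) +
      fiberCard A r 1 * realChar (i + 1 + 1) + fiberCard A r 2 * realChar (i + 1 + 2)) +
    fiberCard A r 2 * (fiberCard A r 0 * realChar (i + 2 + 0) +
      fiberCard A r 1 * realChar (i + 2 + 1) + fiberCard A r 2 * realChar (i + 2 + 2))]
  rw [← fiberCard_add_add A r]
  simp +decide [realChar]
  ring

lemma sum_sum_sum_realChar_total {n : ℕ} (A : Finset (Fin n → ZMod 3))
    (hA : ¬ ∃ x y : Fin n → ZMod 3, y ≠ 0 ∧ x ∈ A ∧ x + y ∈ A ∧ x + 2 • y ∈ A) :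
    ∑ r : Fin n → ZMod 3, ∑ x ∈ A, ∑ y ∈ A, ∑ z ∈ A, realChar (r ⬝ᵥ (x + y + z)) =
      2 * 3 ^ n * A.card := by
  have three (w : Fin n → ZMod 3) : w + w + w = 0 := by
    ext i
    have : ∀ a : ZMod 3, a + a + a = 0 := by decide
    exact this _
  have key : ∀ x ∈ A, ∀ y ∈ A, ∀ z ∈ A, x + y + z = 0 → x = y ∧ x = z := by
    intro x hx y hy z hz h
    have hz' : x + 2 • (y - x) = z := by
      have := three y
      have e : x + 2 • (y - x) = y + y + y - (x + y + z) + z := by rw [two_nsmul]; abel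
      rw [e, this, h]; simp
    have hxy : y = x := by
      by_contra hne
      exact hA ⟨x, y - x, sub_ne_zero.2 hne, hx, by simpa using hy, by rwa [hz']⟩
    subst hxy
    exact ⟨rfl, by simpa using hz'⟩
  have swap : ∑ r : Fin n → ZMod 3, ∑ x ∈ A, ∑ y ∈ A, ∑ z ∈ A, realChar (r ⬝ᵥ (x + y + z)) =
      ∑ x ∈ A, ∑ y ∈ A, ∑ z ∈ A, ∑ r : Fin n → ZMod 3, realChar (r ⬝ᵥ (x + y + z)) := by
    rw [Finset.sum_comm]
    refine Finset.sum_congr rfl fun x _ => ?_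
    rw [Finset.sum_comm]
    refine Finset.sum_congr rfl fun y _ => ?_
    rw [Finset.sum_comm]
  rw [swap]
  have inner : ∀ x ∈ A, ∑ y ∈ A, ∑ z ∈ A, ∑ r : Fin n → ZMod 3, realChar (r ⬝ᵥ (x + y + z)) =
      2 * 3 ^ n := by
    intro x hx
    rw [Finset.sum_eq_single_of_mem x hx, Finset.sum_eq_single_of_mem x hx,
      sum_realChar_dotProduct, if_pos (three x)]
    · intro z hz hne
      rw [sum_realChar_dotProduct, if_neg fun h => hne (key x hx x hx z hz h).2.symm]
    · intro y hy hne
      refine Finset.sum_eq_zero fun z hz => ?_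
      rw [sum_realChar_dotProduct, if_neg fun h => hne (key x hx y hy z hz h).1.symm]
  rw [Finset.sum_congr rfl inner]
  simp [mul_comm]

lemma sum_sum_realChar_total {n : ℕ} (A : Finset (Fin n → ZMod 3)) :
    ∑ r : Fin n → ZMod 3, ∑ x ∈ A, ∑ y ∈ A, realChar (r ⬝ᵥ (x - y)) = 2 * 3 ^ n * A.card := by
  rw [Finset.sum_comm]
  have inner : ∀ x ∈ A, ∑ r : Fin n → ZMod 3, ∑ y ∈ A, realChar (r ⬝ᵥ (x - y)) =
      2 * 3 ^ n := by
    intro x hx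
    rw [Finset.sum_comm, Finset.sum_eq_single_of_mem x hx, sum_realChar_dotProduct,
      if_pos (sub_self x)]
    intro y _ hne
    rw [sum_realChar_dotProduct, if_neg fun h => hne (sub_eq_zero.1 h).symm]
  rw [Finset.sum_congr rfl inner]
  simp [mul_comm]

lemma neg_mul_mul_le_of_add_eq_zero {a b c t : ℝ} (h : a + b + c = 0) (ht : 0 ≤ t)
    (ha : a ≤ t) (hb : b ≤ t) (hc : c ≤ t) :
    -(3 * (a * b * c)) ≤ t * (a ^ 2 + b ^ 2 + c ^ 2) := by
  have aux : ∀ {x y z : ℝ}, x + y + z = 0 → x ≤ t → y ≤ t → 0 ≤ x * y →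
      -(3 * (x * y * z)) ≤ t * (x ^ 2 + y ^ 2 + z ^ 2) := by
    intro x y z h hx hy hxy
    obtain rfl : z = -(x + y) := by linarith
    nlinarith [mul_nonneg hxy (sub_nonneg.2 hx), mul_nonneg hxy (sub_nonneg.2 hy),
      mul_nonneg ht (sq_nonneg (x - y))]
  rcases le_total 0 (a * b) with hab | hab
  · exact aux h ha hb hab
  rcases le_total 0 (b * c) with hbc | hbc
  · linarith [aux (by linarith : b + c + a = 0) hb hc hbc]
  rcases le_total 0 (a * c) with hac | hac
  · linarith [aux (by linarith : a + c + b = 0) ha hc hac]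
  have h₀ : a * b * c = 0 := by
    have := mul_nonpos_of_nonneg_of_nonpos (mul_nonneg_of_nonpos_of_nonpos hab hbc) hac
    exact pow_eq_zero_iff two_ne_zero |>.1 (le_antisymm (by linarith) (sq_nonneg _))
  rw [h₀]
  simpa using by positivity

/-- If every affine hyperplane section of a cap-set has at most `|A| / 3 + t` points, then the
nontrivial part of its cubic moment is controlled by its quadratic moment. -/
lemma card_cube_le_of_fiberCard_le {n : ℕ} (A : Finset (Fin n → ZMod 3))
    (hA : ¬ ∃ x y : Fin n → ZMod 3, y ≠ 0 ∧ x ∈ A ∧ x + y ∈ A ∧ x + 2 • y ∈ A)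
    {t : ℝ} (ht : 0 ≤ t)
    (hfib : ∀ r : Fin n → ZMod 3, r ≠ 0 → ∀ i, fiberCard A r i ≤ A.card / 3 + t) :
    2 * (A.card : ℝ) ^ 3 - 2 * 3 ^ n * A.card ≤
      3 * t * (2 * 3 ^ n * A.card - 2 * (A.card : ℝ) ^ 2) := by
  have h₃ := sum_sum_sum_realChar_total A hA
  have h₂ := sum_sum_realChar_total A
  rw [← Finset.add_sum_erase _ _ (Finset.mem_univ 0)] at h₂ h₃
  have z₃ : ∑ x ∈ A, ∑ y ∈ A, ∑ z ∈ A, realChar (0 ⬝ᵥ (x + y + z)) = 2 * (A.card : ℝ) ^ 3 := by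
    simp [realChar]; ring
  have z₂ : ∑ x ∈ A, ∑ y ∈ A, realChar (0 ⬝ᵥ (x - y)) = 2 * (A.card : ℝ) ^ 2 := by
    simp [realChar]; ring
  rw [z₃] at h₃
  rw [z₂] at h₂
  have hle : -∑ r ∈ Finset.univ.erase (0 : Fin n → ZMod 3),
      ∑ x ∈ A, ∑ y ∈ A, ∑ z ∈ A, realChar (r ⬝ᵥ (x + y + z)) ≤
      3 * t * ∑ r ∈ Finset.univ.erase (0 : Fin n → ZMod 3),
        ∑ x ∈ A, ∑ y ∈ A, realChar (r ⬝ᵥ (x - y)) := by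
    rw [Finset.mul_sum, ← Finset.sum_neg_distrib]
    refine Finset.sum_le_sum fun r hr => ?_
    have hr := hfib r (Finset.ne_of_mem_erase hr)
    rw [sum_sum_sum_realChar, sum_sum_realChar]
    have hs := fiberCard_add_add A r
    have hb := neg_mul_mul_le_of_add_eq_zero (a := fiberCard A r 0 - A.card / 3)
      (b := fiberCard A r 1 - A.card / 3) (c := fiberCard A r 2 - A.card / 3) (t := t)
      (by linarith) ht (by linarith [hr 0]) (by linarith [hr 1]) (by linarith [hr 2])
    rw [← hs] at hb ⊢
    linarith
  rw [← eq_sub_iff_add_eq'] at h₂ h₃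
  rw [h₂, h₃] at hle
  linarith

/-- The linear functional `x ↦ r ⬝ᵥ x` with `r ≠ 0` takes every value. -/
lemma exists_dotProduct_eq {n : ℕ} {r : Fin n → ZMod 3} (hr : r ≠ 0) (i : ZMod 3) :
    ∃ v : Fin n → ZMod 3, r ⬝ᵥ v = i := by
  obtain ⟨j, hj⟩ := Function.ne_iff.1 hr
  refine ⟨Pi.single j ((r j)⁻¹ * i), ?_⟩
  rw [dotProduct_single, ← mul_assoc, mul_inv_cancel₀ hj, one_mul]

lemma exists_submodule_of_fiberCard {n : ℕ} (A : Finset (Fin n → ZMod 3))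
    {r : Fin n → ZMod 3} (hr : r ≠ 0) (i : ZMod 3) :
    ∃ (V : Submodule (ZMod 3) (Fin n → ZMod 3)) (v : Fin n → ZMod 3),
      Module.finrank (ZMod 3) V + 1 = n ∧
      ((A.filter fun a => a - v ∈ V).card : ℝ) / (Nat.card V) =
        3 * fiberCard A r i / 3 ^ n := by
  obtain ⟨v, hv⟩ := exists_dotProduct_eq hr i
  set f : (Fin n → ZMod 3) →ₗ[ZMod 3] ZMod 3 := dotProductBilin (ZMod 3) (ZMod 3) r
  have hf (x : Fin n → ZMod 3) : f x = r ⬝ᵥ x := rfl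
  have hsurj : Function.Surjective f := exists_dotProduct_eq hr
  have hrank : Module.finrank (ZMod 3) (LinearMap.ker f) + 1 = n := by
    have h := f.finrank_range_add_finrank_ker
    rw [LinearMap.range_eq_top.2 hsurj, finrank_top, Module.finrank_self,
      Module.finrank_fin_fun] at h
    omega
  refine ⟨LinearMap.ker f, v, hrank, ?_⟩
  have hcard : (Nat.card (LinearMap.ker f) : ℝ) * 3 = 3 ^ n := by
    rw [Module.natCard_eq_pow_finrank (K := ZMod 3), Nat.card_zmod]
    push_cast
    rw [← pow_succ, hrank]
  have hfilter : (A.filter fun a => a - v ∈ LinearMap.ker f) =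
      A.filter fun a => r ⬝ᵥ a = i := by
    refine Finset.filter_congr fun a _ => ?_
    rw [LinearMap.mem_ker, hf, dotProduct_sub, hv, sub_eq_zero]
  rw [hfilter, ← hcard, mul_comm, mul_div_mul_right _ _ (by norm_num : (3 : ℝ) ≠ 0)]
  rfl

/-- Meshulam's density-increment lemma: a cap-set of density `α` in `𝔽₃ⁿ` either lives in a
small space (`3ⁿ < 2/α²`, i.e. `α² · 3ⁿ < 2`) or has density at least `α + α²/4` on some
affine subspace of codimension 1 (a coset `v + V` of a linear subspace `V` with
`dim V + 1 = n`). -/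
theorem meshulam_density_increment (n : ℕ) (A : Finset (Fin n → ZMod 3))
    (hA : ¬ ∃ x y : Fin n → ZMod 3, y ≠ 0 ∧ x ∈ A ∧ x + y ∈ A ∧ x + 2 • y ∈ A) :
    (((A.card : ℝ) / 3 ^ n) ^ 2 * (3 : ℝ) ^ n < 2) ∨
      ∃ (V : Submodule (ZMod 3) (Fin n → ZMod 3)) (v : Fin n → ZMod 3),
        Module.finrank (ZMod 3) V + 1 = n ∧
        ((A.filter fun a => a - v ∈ V).card : ℝ) / (Nat.card V) ≥
          (A.card : ℝ) / 3 ^ n + ((A.card : ℝ) / 3 ^ n) ^ 2 / 4 := by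
  by_contra! ⟨hlarge, hno⟩
  have hN : (0 : ℝ) < 3 ^ n := by positivity
  set α : ℝ := (A.card : ℝ) / 3 ^ n
  have hα : (A.card : ℝ) = α * 3 ^ n := by simp [α, hN.ne']
  have hα0 : 0 ≤ α := div_nonneg (Nat.cast_nonneg _) hN.le
  clear_value α
  have hαpos : 0 < α := by
    refine hα0.lt_of_ne fun h => ?_
    rw [← h] at hlarge
    norm_num at hlarge
  have hcube := card_cube_le_of_fiberCard_le A hA (t := α ^ 2 * 3 ^ n / 12) (by positivity) <| by
    intro r hr i
    obtain ⟨V, v, hV, hd⟩ := exists_submodule_of_fiberCard A hr i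
    have h := hno V v hV
    rw [hd, div_lt_iff₀ hN] at h
    rw [hα]
    linarith
  rw [hα] at hcube
  generalize (3 : ℝ) ^ n = N at *
  have h₁ : α * N ^ 2 * 2 ≤ α * N ^ 2 * (α ^ 2 * N) := by gcongr
  have h₂ : 0 < α ^ 3 * N ^ 3 := by positivity
  have h₃ : 0 ≤ α ^ 4 * N ^ 3 := by positivity
  linarith
end
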